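/- Let G=(V,E) be a finite simple graph and let u,v ∈ V. Then {u,v} is globally linked in G in ℝ² if and only if either uv ∈ E or there is an ℛ₂-connected subgraph H = (V′,E′) of G with u,v ∈ V′ and κ_H(u,v) ≥ 3. -/

import Mathlib

open scoped BigOperators

noncomputable section

namespace Rigidity

variable {V : Type*}

/-- Euclidean distance between two points of `ℝ^d` (given as coordinate functions). -/
def eDist {d : ℕ} (x y : Fin d → ℝ) : ℝ := Real.sqrt (∑ i, (x i - y i) ^ 2)

/-- Two frameworks `(G,p)` and `(G,q)` are equivalent if corresponding edge lengths agree. -/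
def Equivalent {d : ℕ} (G : SimpleGraph V) (p q : V → Fin d → ℝ) : Prop :=
  ∀ u v : V, G.Adj u v → eDist (p u) (p v) = eDist (q u) (q v)

/-- Two placements are congruent if all pairwise distances agree. -/
def Congruent {d : ℕ} (p q : V → Fin d → ℝ) : Prop :=
  ∀ u v : V, eDist (p u) (p v) = eDist (q u) (q v)

/-- A placement is generic if the multiset of its coordinates is algebraically
independent over `ℚ`. -/
def Generic {d : ℕ} (p : V → Fin d → ℝ) : Prop :=
  AlgebraicIndependent ℚ (fun vi : V × Fin d => p vi.1 vi.2)

/-- `{u,v}` is globally linked in the framework `(G,p)`. -/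
def GloballyLinkedIn {d : ℕ} (G : SimpleGraph V) (p : V → Fin d → ℝ) (u v : V) : Prop :=
  ∀ q : V → Fin d → ℝ, Equivalent G p q → eDist (q u) (q v) = eDist (p u) (p v)

/-- `{u,v}` is globally `d`-linked in `G`. -/
def GloballyLinked (d : ℕ) (G : SimpleGraph V) (u v : V) : Prop :=
  ∀ p : V → Fin d → ℝ, Generic p → GloballyLinkedIn G p u v

/-- The framework `(G,p)` is rigid. -/
def RigidFramework {d : ℕ} (G : SimpleGraph V) (p : V → Fin d → ℝ) : Prop :=
  ∃ ε > (0:ℝ), ∀ q : V → Fin d → ℝ, Equivalent G p q →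
    (∀ v, eDist (p v) (q v) < ε) → Congruent p q

/-- `G` is `d`-rigid: every generic framework of `G` in `ℝ^d` is rigid. -/
def IsRigidGraph (d : ℕ) (G : SimpleGraph V) : Prop :=
  ∀ p : V → Fin d → ℝ, Generic p → RigidFramework G p

/-- The framework `(G,p)` is globally rigid. -/
def GloballyRigidFramework {d : ℕ} (G : SimpleGraph V) (p : V → Fin d → ℝ) : Prop :=
  ∀ q : V → Fin d → ℝ, Equivalent G p q → Congruent p q

/-- The row of the rigidity matrix corresponding to the (ordered) edge `(u,v)`. -/
def edgeVec [DecidableEq V] {d : ℕ} (p : V → Fin d → ℝ) (u v : V) : V × Fin d → ℝ :=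
  fun wi => if wi.1 = u then p u wi.2 - p v wi.2
            else if wi.1 = v then p v wi.2 - p u wi.2 else 0

/-- The rank of the set of rows of the rigidity matrix of `(·,p)` indexed by `F`. -/
def rankAt [DecidableEq V] (d : ℕ) (p : V → Fin d → ℝ) (F : Set (Sym2 V)) : ℕ :=
  Module.finrank ℝ (Submodule.span ℝ
    {x : V × Fin d → ℝ | ∃ u v : V, s(u, v) ∈ F ∧ x = edgeVec p u v})

/-- `r_d(F)`: the rank of the set of rows indexed by `F` of the rigidity matrix of a
generic framework, equivalently the maximum of this rank over all placements. -/
def rd [DecidableEq V] (d : ℕ) (F : Set (Sym2 V)) : ℕ :=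
  sSup {n : ℕ | ∃ p : V → Fin d → ℝ, n = rankAt d p F}

/-- An edge set is `ℛ_d`-independent if its rank equals its cardinality. -/
def RdIndep [DecidableEq V] (d : ℕ) (F : Set (Sym2 V)) : Prop := rd d F = F.ncard

/-- An `ℛ_d`-circuit: not independent, but every proper subset is independent. -/
def RdCircuit [DecidableEq V] (d : ℕ) (C : Set (Sym2 V)) : Prop :=
  ¬ RdIndep d C ∧ ∀ C' : Set (Sym2 V), C' ⊂ C → RdIndep d C'

/-- An `ℛ_d`-circuit of the graph `G`. -/
def RdCircuitOf [DecidableEq V] (d : ℕ) (G : SimpleGraph V) (C : Set (Sym2 V)) : Prop :=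
  C ⊆ G.edgeSet ∧ RdCircuit d C

/-- `F` is (the edge set of) an `ℛ_d`-component of `G`: an equivalence class of the
relation "`e = f` or some `ℛ_d`-circuit of `G` contains both `e` and `f`". -/
def IsRdComponent [DecidableEq V] (d : ℕ) (G : SimpleGraph V) (F : Set (Sym2 V)) : Prop :=
  ∃ e ∈ G.edgeSet, F = {f | f ∈ G.edgeSet ∧
    (e = f ∨ ∃ C, RdCircuitOf d G C ∧ e ∈ C ∧ f ∈ C)}

/-- The set of vertices covered by an edge set. -/
def vertexSpan (F : Set (Sym2 V)) : Set V := {v | ∃ e ∈ F, v ∈ e}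

/-- A nonempty edge set is `ℛ_d`-connected if any two of its edges lie on a common
`ℛ_d`-circuit contained in it (or are equal). -/
def RdConnectedSet [DecidableEq V] (d : ℕ) (F : Set (Sym2 V)) : Prop :=
  F.Nonempty ∧ ∀ e ∈ F, ∀ f ∈ F, e = f ∨ ∃ C, C ⊆ F ∧ RdCircuit d C ∧ e ∈ C ∧ f ∈ C

/-- A graph (with at least one edge) is `ℛ_d`-connected. -/
def RdConnected [DecidableEq V] (d : ℕ) (H : SimpleGraph V) : Prop :=
  RdConnectedSet d H.edgeSet

/-- `e` is an `ℛ_d`-bridge of `G`: `r_d(E ∖ {e}) = r_d(E) − 1`. -/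
def IsRdBridge [DecidableEq V] (d : ℕ) (G : SimpleGraph V) (e : Sym2 V) : Prop :=
  e ∈ G.edgeSet ∧ rd d (G.edgeSet \ {e}) + 1 = rd d G.edgeSet

/-- `G + uv`. -/
def addEdge (G : SimpleGraph V) (u v : V) : SimpleGraph V :=
  G ⊔ SimpleGraph.fromEdgeSet {s(u, v)}

/-- `{u,v}` is `d`-linked in `G` if `r_d(G+uv) = r_d(G)`. -/
def IsLinked [DecidableEq V] (d : ℕ) (G : SimpleGraph V) (u v : V) : Prop :=
  rd d (addEdge G u v).edgeSet = rd d G.edgeSet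

/-- There exist `k` pairwise internally vertex-disjoint `u`–`v` paths in `H`
(i.e. `κ_H(u,v) ≥ k`). -/
def InternallyDisjointPaths (H : SimpleGraph V) (u v : V) (k : ℕ) : Prop :=
  ∃ P : Fin k → H.Walk u v, (∀ i, (P i).IsPath) ∧
    ∀ i j, i ≠ j → ∀ w, w ∈ (P i).support → w ∈ (P j).support → w = u ∨ w = v

/-- An unordered pair forming a 2-separator: two distinct vertices whose deletion
disconnects the graph. -/
def TwoSepPair (H : SimpleGraph V) (e : Sym2 V) : Prop :=
  ¬ e.IsDiag ∧ ¬ (H.induce {v | v ∉ e}).Connected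

/-- The augmented graph `Ĥ`: add an edge for every 2-separator. -/
def aug (H : SimpleGraph V) : SimpleGraph V :=
  H ⊔ SimpleGraph.fromEdgeSet {e | TwoSepPair H e}

/-- A subgraph is 3-connected: at least 4 vertices, and deleting fewer than 3
vertices leaves it connected. -/
def IsThreeConnectedSubgraph {G : SimpleGraph V} (J : G.Subgraph) : Prop :=
  4 ≤ J.verts.ncard ∧ ∀ S : Set V, S.ncard < 3 → (J.deleteVerts S).coe.Connected

/-- A 3-block of `H`: a maximal 3-connected subgraph of the augmented graph `Ĥ`. -/
def IsThreeBlock (H : SimpleGraph V) (J : (aug H).Subgraph) : Prop :=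
  IsThreeConnectedSubgraph J ∧
    ∀ J' : (aug H).Subgraph, IsThreeConnectedSubgraph J' → J ≤ J' → J = J'

/-- `h_H(e)`: the number of 3-blocks of `H` containing both vertices of `e`. -/
def numBlocksOn (H : SimpleGraph V) (e : Sym2 V) : ℕ :=
  {J : (aug H).Subgraph | IsThreeBlock H J ∧ ∀ v ∈ e, v ∈ J.verts}.ncard

open Classical in
/-- `k(H) = Σ (h_H(ab) − 1)` over all 2-separators `{a,b}` of `H`. -/
def kGraph [Fintype V] [DecidableEq V] (H : SimpleGraph V) : ℕ :=
  ∑ e : Sym2 V, if TwoSepPair H e then numBlocksOn H e - 1 else 0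

/-- The graph of an `ℛ₂`-component, on its own vertex set. -/
def componentGraph [DecidableEq V] (F : Set (Sym2 V)) :
    SimpleGraph (vertexSpan F) :=
  (SimpleGraph.fromEdgeSet F).induce (vertexSpan F)

/-- `X` is the vertex set of an `ℛ_d`-block of `G`: a 3-block of a non-trivial
`ℛ_d`-component of `G`. -/
def IsRdBlockVerts [DecidableEq V] (d : ℕ) (G : SimpleGraph V) (X : Set V) : Prop :=
  ∃ F : Set (Sym2 V), IsRdComponent d G F ∧ 2 ≤ F.ncard ∧
    ∃ J : (aug (componentGraph F)).Subgraph,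
      IsThreeBlock (componentGraph F) J ∧ X = Subtype.val '' J.verts

/-- The globally linked closure of `G` in `ℝ^d`. -/
def glc (d : ℕ) (G : SimpleGraph V) : SimpleGraph V :=
  G ⊔ SimpleGraph.fromEdgeSet {e | ∃ u v : V, e = s(u, v) ∧ GloballyLinked d G u v}

/-- A globally `d`-linked cluster: the vertex set of a maximal complete subgraph of
`glc_d(G)`. -/
def IsCluster (d : ℕ) (G : SimpleGraph V) (X : Set V) : Prop :=
  (∀ a ∈ X, ∀ b ∈ X, a ≠ b → (glc d G).Adj a b) ∧
    ∀ Y : Set V, X ⊆ Y → (∀ a ∈ Y, ∀ b ∈ Y, a ≠ b → (glc d G).Adj a b) → Y = X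

/-- Equilibrium stress of a framework, encoded as a symmetric function vanishing on
non-edges. -/
def IsEqStress [Fintype V] {d : ℕ} (G : SimpleGraph V) (p : V → Fin d → ℝ)
    (ω : V → V → ℝ) : Prop :=
  (∀ u v, ω u v = ω v u) ∧ (∀ u v, ¬ G.Adj u v → ω u v = 0) ∧
    ∀ u, ∑ v, ω u v • (p u - p v) = 0

/-- `{u,v}` is `d`-stress-linked in `G`. -/
def StressLinked [Fintype V] (d : ℕ) (G : SimpleGraph V) (u v : V) : Prop :=
  ∀ p : V → Fin d → ℝ, Generic p → ∀ q : V → Fin d → ℝ,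
    (∀ ω, IsEqStress G p ω → IsEqStress G q ω) →
    ∀ ω, IsEqStress (addEdge G u v) p ω → IsEqStress (addEdge G u v) q ω

/-- Equivalence of complex frameworks. -/
def CEquivalent {d : ℕ} (G : SimpleGraph V) (p q : V → Fin d → ℂ) : Prop :=
  ∀ u v : V, G.Adj u v →
    ∑ i, (p u i - p v i) ^ 2 = ∑ i, (q u i - q v i) ^ 2

/-- Generic complex placement. -/
def CGeneric {d : ℕ} (p : V → Fin d → ℂ) : Prop :=
  AlgebraicIndependent ℚ (fun vi : V × Fin d => p vi.1 vi.2)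

/-- `{u,v}` is globally linked in `G` in `ℂ^d`. -/
def CGloballyLinked (d : ℕ) (G : SimpleGraph V) (u v : V) : Prop :=
  ∀ p : V → Fin d → ℂ, CGeneric p → ∀ q : V → Fin d → ℂ, CEquivalent G p q →
    ∑ i, (q u i - q v i) ^ 2 = ∑ i, (p u i - p v i) ^ 2

/-- A flexing of the framework `(G,q)`. -/
def IsFlexing {d : ℕ} (G : SimpleGraph V) (q : V → Fin d → ℝ)
    (φ : Set.Icc (0:ℝ) 1 → V → Fin d → ℝ) : Prop :=
  Continuous φ ∧ φ ⟨0, Set.left_mem_Icc.mpr zero_le_one⟩ = q ∧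
    (∀ t, Equivalent G q (φ t)) ∧
    ∀ t : Set.Icc (0:ℝ) 1, 0 < (t : ℝ) → ¬ Congruent q (φ t)

/-- A finite loopless multigraph on vertex type `V` with edge type `E`. -/
structure Multigraph (V : Type*) (E : Type*) where
  ends : E → Sym2 V
  loopless : ∀ e, ¬ (ends e).IsDiag

/-- The data `(B, bar)` exhibits `G` as a body-bar graph induced by `H`. -/
def IsBodyBar {V E W : Type*} (H : Multigraph V E) (G : SimpleGraph W)
    (B : V → Set W) (bar : E → W × W) : Prop :=
  (∀ w : W, ∃! v : V, w ∈ B v) ∧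
  (∀ v : V, (B v).ncard = {e : E | v ∈ H.ends e}.ncard) ∧
  (∀ e : E, ∃ w z : V, H.ends e = s(w, z) ∧ (bar e).1 ∈ B w ∧ (bar e).2 ∈ B z) ∧
  (∀ e : E, (bar e).1 ≠ (bar e).2) ∧
  (∀ e e' : E, e ≠ e' →
    ({(bar e).1, (bar e).2} ∩ {(bar e').1, (bar e').2} : Set W) = ∅) ∧
  (∀ a b : W, G.Adj a b ↔ a ≠ b ∧
    ((∃ v : V, a ∈ B v ∧ b ∈ B v) ∨ ∃ e : E, s(a, b) = s((bar e).1, (bar e).2)))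

/-- `P` is a partition of the set `X`. -/
def IsPartitionOf {V : Type*} (X : Set V) (P : Set (Set V)) : Prop :=
  (∀ p ∈ P, p.Nonempty ∧ p ⊆ X) ∧ ∀ v ∈ X, ∃! p, p ∈ P ∧ v ∈ p

/-- The subgraph `(X,F)` of the multigraph `H` is `k`-tree-connected. -/
def SubTreeConnected {V E : Type*} (k : ℕ) (H : Multigraph V E)
    (X : Set V) (F : Set E) : Prop :=
  X.Nonempty ∧ (∀ e ∈ F, ∀ v ∈ H.ends e, v ∈ X) ∧
    ∀ P : Set (Set V), IsPartitionOf X P →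
      k * (P.ncard - 1) ≤ {e | e ∈ F ∧ ¬ ∃ p ∈ P, ∀ v ∈ H.ends e, v ∈ p}.ncard

/-- `(X,F)` is a `k`-superbrick of `H`: a maximal `k`-tree-connected subgraph. -/
def IsSuperbrick {V E : Type*} (k : ℕ) (H : Multigraph V E)
    (X : Set V) (F : Set E) : Prop :=
  SubTreeConnected k H X F ∧
    ∀ X' F', SubTreeConnected k H X' F' → X ⊆ X' → F ⊆ F' → X = X' ∧ F = F'

/-- The row of `e` in the planar rigidity matrix of `p`, as a functional on velocity assignments. -/
def row (p : V → Fin 2 → ℝ) : Sym2 V → (V → Fin 2 → ℝ) →ₗ[ℝ] ℝ :=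
  Sym2.lift ⟨fun a b =>
    { toFun := fun μ => (p a 0 - p b 0) * (μ a 0 - μ b 0) + (p a 1 - p b 1) * (μ a 1 - μ b 1)
      map_add' := fun x y => by simp only [Pi.add_apply]; ring
      map_smul' := fun c x => by
        simp only [Pi.smul_apply, smul_eq_mul, RingHom.id_apply]; ring },
    fun a b => by ext μ; simp only [LinearMap.coe_mk, AddHom.coe_mk]; ring⟩

@[simp]
lemma row_mk (p μ : V → Fin 2 → ℝ) (a b : V) :
    row p s(a, b) μ =
      (p a 0 - p b 0) * (μ a 0 - μ b 0) + (p a 1 - p b 1) * (μ a 1 - μ b 1) := rfl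

lemma row_comm (p μ : V → Fin 2 → ℝ) (e : Sym2 V) : row p e μ = row μ e p := by
  induction e with | _ a b => simp only [row_mk]; ring

lemma row_add_sub (p q : V → Fin 2 → ℝ) (e : Sym2 V) :
    row (p + q) e (p - q) = row p e p - row q e q := by
  induction e with | _ a b => simp only [row_mk, Pi.add_apply, Pi.sub_apply]; ring

lemma row_smul (c : ℝ) (p : V → Fin 2 → ℝ) (e : Sym2 V) : row (c • p) e = c • row p e := by
  ext μ
  induction e with | _ a b =>
    simp only [row_mk, Pi.smul_apply, smul_eq_mul, LinearMap.smul_apply]; ring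

lemma row_congr {p q μ ν : V → Fin 2 → ℝ} {e : Sym2 V} (hp : ∀ w ∈ e, p w = q w)
    (hμ : ∀ w ∈ e, μ w = ν w) : row p e μ = row q e ν := by
  induction e with | _ a b =>
    have ha := hp a (by simp)
    have hb := hp b (by simp)
    have ha' := hμ a (by simp)
    have hb' := hμ b (by simp)
    simp only [row_mk, ha, hb, ha', hb']

lemma row_diag (p : V → Fin 2 → ℝ) {e : Sym2 V} (h : e.IsDiag) : row p e = 0 := by
  induction e with | _ a b =>
    obtain rfl : a = b := by simpa using h
    ext μ
    simp

/-- Independence of the rows indexed by `S` in the rigidity matrix of `p`. -/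
def Ind (p : V → Fin 2 → ℝ) (S : Set (Sym2 V)) : Prop := LinearIndepOn ℝ (row p) S

/-- The edges whose row lies in the span of the rows of `S`: every infinitesimal motion of `S`
preserves them to first order. -/
def Cl (p : V → Fin 2 → ℝ) (S : Set (Sym2 V)) : Set (Sym2 V) :=
  {e | ∀ μ, (∀ f ∈ S, row p f μ = 0) → row p e μ = 0}

lemma Ind.mono {p : V → Fin 2 → ℝ} {S T : Set (Sym2 V)} (h : Ind p T) (hST : S ⊆ T) :
    Ind p S := LinearIndepOn.mono h hST

lemma Ind.empty (p : V → Fin 2 → ℝ) : Ind p ∅ := linearIndepOn_empty _ _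

lemma subset_cl (p : V → Fin 2 → ℝ) (S : Set (Sym2 V)) : S ⊆ Cl p S := fun _ he _ hμ => hμ _ he

lemma cl_mono (p : V → Fin 2 → ℝ) {S T : Set (Sym2 V)} (h : S ⊆ T) : Cl p S ⊆ Cl p T :=
  fun _ he μ hμ => he μ fun f hf => hμ f (h hf)

lemma cl_subset_cl {p : V → Fin 2 → ℝ} {S T : Set (Sym2 V)} (h : S ⊆ Cl p T) :
    Cl p S ⊆ Cl p T :=
  fun _ he μ hμ => he μ fun f hf => h hf μ hμ

lemma diag_mem_cl (p : V → Fin 2 → ℝ) (S : Set (Sym2 V)) {e : Sym2 V} (h : e.IsDiag) :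
    e ∈ Cl p S := fun μ _ => by rw [row_diag p h]; rfl

section Finite

variable [Finite V]

lemma mem_cl_iff_span {p : V → Fin 2 → ℝ} {S : Set (Sym2 V)} {e : Sym2 V} :
    e ∈ Cl p S ↔ row p e ∈ Submodule.span ℝ (row p '' S) := by
  constructor
  · intro h
    have : Finite S := Subtype.finite
    have := mem_span_of_iInf_ker_le_ker (L := fun f : S => row p f) (K := row p e) (by
      intro μ hμ
      simp only [Submodule.mem_iInf, LinearMap.mem_ker, Subtype.forall] at hμ ⊢
      exact h μ hμ)
    rwa [Set.image_eq_range]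
  · intro h μ hμ
    have : Submodule.span ℝ (row p '' S) ≤ LinearMap.ker (LinearMap.applyₗ (R := ℝ) μ) := by
      rw [Submodule.span_le]
      rintro _ ⟨f, hf, rfl⟩
      simpa using hμ f hf
    simpa using this h

lemma ind_insert {p : V → Fin 2 → ℝ} {S : Set (Sym2 V)} {e : Sym2 V} (he : e ∉ S) :
    Ind p (insert e S) ↔ Ind p S ∧ e ∉ Cl p S := by
  rw [Ind, linearIndepOn_insert he, mem_cl_iff_span, Ind]

lemma Ind.insert {p : V → Fin 2 → ℝ} {S : Set (Sym2 V)} {e : Sym2 V} (h : Ind p S)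
    {μ : V → Fin 2 → ℝ} (hμ : ∀ f ∈ S, row p f μ = 0) (he : row p e μ ≠ 0) :
    Ind p (insert e S) := by
  rw [ind_insert (fun h => he (hμ e h))]
  exact ⟨h, fun h' => he (h' μ hμ)⟩

lemma Ind.exists_motion {p : V → Fin 2 → ℝ} {S : Set (Sym2 V)} {e : Sym2 V}
    (h : Ind p (Insert.insert e S)) (he : e ∉ S) :
    ∃ μ, (∀ f ∈ S, row p f μ = 0) ∧ row p e μ ≠ 0 := by
  have := ((ind_insert he).1 h).2
  simpa [Cl] using this

lemma ind_ncard_le {p : V → Fin 2 → ℝ} {S T : Set (Sym2 V)} (hS : Ind p S) (h : S ⊆ Cl p T) :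
    S.ncard ≤ T.ncard := by
  classical
  have := Fintype.ofFinite V
  have := Fintype.ofFinite S
  have h1 : Module.finrank ℝ (Submodule.span ℝ (Set.range fun e : S => row p e)) = S.ncard := by
    rw [finrank_span_eq_card (show LinearIndependent ℝ fun e : S => row p e from hS),
      ← Nat.card_eq_fintype_card]
    rfl
  rw [← h1, ← Set.image_eq_range (row p) S]
  have h2 : Submodule.span ℝ (row p '' S) ≤ Submodule.span ℝ (row p '' T) := by
    rw [Submodule.span_le]
    rintro _ ⟨f, hf, rfl⟩
    exact mem_cl_iff_span.1 (h hf)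
  refine (Submodule.finrank_mono h2).trans ?_
  have := Fintype.ofFinite (row p '' T)
  refine (finrank_span_le_card _).trans ?_
  rw [← Set.ncard_eq_toFinset_card']
  exact Set.ncard_image_le (Set.toFinite _)

/-- The rigidity matroid of the framework with placement `p` on the complete graph. -/
def rowMatroid (p : V → Fin 2 → ℝ) : Matroid (Sym2 V) :=
  (IndepMatroid.ofFinite (E := Set.univ) (Set.toFinite _) (Ind p) (Ind.empty p)
    (fun _ _ h hs => h.mono hs)
    (by
      intro I J hI hJ hlt
      by_contra! hcon
      refine hlt.not_ge (ind_ncard_le hJ fun e he => ?_)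
      by_cases heI : e ∈ I
      · exact subset_cl _ _ heI
      · by_contra hcl
        exact hcon e he heI ((ind_insert heI).2 ⟨hI, hcl⟩))
    (fun _ _ => Set.subset_univ _)).matroid

@[simp]
lemma rowMatroid_indep (p : V → Fin 2 → ℝ) : (rowMatroid p).Indep = Ind p := rfl

@[simp]
lemma rowMatroid_ground (p : V → Fin 2 → ℝ) : (rowMatroid p).E = Set.univ := rfl

lemma Ind.closure {p : V → Fin 2 → ℝ} {S : Set (Sym2 V)} (h : Ind p S) :
    (rowMatroid p).closure S = Cl p S := by
  ext e
  by_cases heS : e ∈ S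
  · simp only [subset_cl p S heS, iff_true]
    exact Matroid.mem_closure_of_mem _ heS (Set.subset_univ _)
  · have hS : (rowMatroid p).Indep S := h
    rw [hS.mem_closure_iff_of_notMem heS, Matroid.dep_iff, rowMatroid_indep, ind_insert heS]
    simp [h]

lemma rowMatroid_closure (p : V → Fin 2 → ℝ) (S : Set (Sym2 V)) :
    (rowMatroid p).closure S = Cl p S := by
  obtain ⟨I, hI⟩ := (rowMatroid p).exists_isBasis S (Set.subset_univ _)
  have h1 := hI.closure_eq_closure
  have hi : Ind p I := hI.indep
  rw [← h1, hi.closure]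
  refine (cl_mono p hI.subset).antisymm (cl_subset_cl ?_)
  rw [← hi.closure]
  exact hI.subset_closure

/-- Circuits of the rigidity matroid at `p`. -/
def Circ (p : V → Fin 2 → ℝ) (C : Set (Sym2 V)) : Prop := (rowMatroid p).IsCircuit C

lemma circ_iff {p : V → Fin 2 → ℝ} {C : Set (Sym2 V)} :
    Circ p C ↔ ¬ Ind p C ∧ ∀ C', C' ⊂ C → Ind p C' := by
  rw [Circ, Matroid.isCircuit_iff_forall_ssubset, Matroid.dep_iff]
  simp [Set.subset_univ]

lemma Circ.mem_cl {p : V → Fin 2 → ℝ} {C : Set (Sym2 V)} (hC : Circ p C) {e : Sym2 V}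
    (he : e ∈ C) : e ∈ Cl p (C \ {e}) := by
  rw [← rowMatroid_closure]
  exact Matroid.IsCircuit.mem_closure_sdiff_singleton_of_mem hC he

lemma Circ.ind_diff {p : V → Fin 2 → ℝ} {C : Set (Sym2 V)} (hC : Circ p C) {e : Sym2 V}
    (he : e ∈ C) : Ind p (C \ {e}) :=
  (circ_iff.1 hC).2 _ (Set.sdiff_singleton_ssubset.2 he)

lemma Circ.ind_of_ssubset {p : V → Fin 2 → ℝ} {C S : Set (Sym2 V)} (hC : Circ p C)
    (h : S ⊂ C) : Ind p S := (circ_iff.1 hC).2 _ h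

lemma Circ.not_ind {p : V → Fin 2 → ℝ} {C : Set (Sym2 V)} (hC : Circ p C) : ¬ Ind p C :=
  (circ_iff.1 hC).1

lemma Circ.eq_of_subset {p : V → Fin 2 → ℝ} {C S : Set (Sym2 V)} (hC : Circ p C)
    (h : S ⊆ C) (hS : ¬ Ind p S) : S = C := by
  by_contra hne
  exact hS (hC.ind_of_ssubset (h.ssubset_of_ne hne))

lemma exists_circ_of_mem_cl {p : V → Fin 2 → ℝ} {S : Set (Sym2 V)} {e : Sym2 V}
    (he : e ∈ Cl p S) (heS : e ∉ S) : ∃ C ⊆ insert e S, Circ p C ∧ e ∈ C := by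
  rw [← rowMatroid_closure] at he
  obtain ⟨C, hCs, hC, heC⟩ := Matroid.exists_isCircuit_of_mem_closure he heS
  exact ⟨C, hCs, hC, heC⟩

lemma exists_circ_subset {p : V → Fin 2 → ℝ} {S : Set (Sym2 V)} (h : ¬ Ind p S) :
    ∃ C ⊆ S, Circ p C := by
  have : (rowMatroid p).Dep S := by
    rw [Matroid.dep_iff]; exact ⟨h, Set.subset_univ _⟩
  obtain ⟨C, hC, hCS⟩ := this.exists_isCircuit_subset
  exact ⟨C, hC, hCS⟩

lemma exists_basis (p : V → Fin 2 → ℝ) {I S : Set (Sym2 V)} (hI : Ind p I) (hIS : I ⊆ S) :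
    ∃ J, I ⊆ J ∧ J ⊆ S ∧ Ind p J ∧ S ⊆ Cl p J := by
  have hI' : (rowMatroid p).Indep I := hI
  obtain ⟨J, hJ, hIJ⟩ := hI'.subset_isBasis_of_subset hIS (Set.subset_univ _)
  refine ⟨J, hIJ, hJ.subset, hJ.indep, ?_⟩
  rw [← rowMatroid_closure]
  exact hJ.subset_closure

lemma Circ.not_isDiag {p : V → Fin 2 → ℝ} {C : Set (Sym2 V)} (hC : Circ p C)
    (hn : 2 ≤ C.ncard) {e : Sym2 V} (he : e ∈ C) : ¬ e.IsDiag := by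
  intro hd
  have : Ind p {e} := hC.ind_of_ssubset (by
    refine (Set.singleton_subset_iff.2 he).ssubset_of_ne ?_
    rintro rfl
    simp at hn)
  have h0 : Ind p (insert e ∅) := by simpa using this
  exact ((ind_insert (by simp)).1 h0).2 (diag_mem_cl _ _ hd)

end Finite

section Generic

/-- `p` places the vertices of `N` on the first axis and is otherwise generic: every rational
polynomial vanishing at `p` vanishes at each placement with `N` on the first axis. -/
def GenOn (N : Set V) (p : V → Fin 2 → ℝ) : Prop :=
  (∀ w ∈ N, p w 1 = 0) ∧ ∀ P : MvPolynomial (V × Fin 2) ℚ,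
    MvPolynomial.aeval (fun vi : V × Fin 2 => p vi.1 vi.2) P = 0 →
      ∀ x : V → Fin 2 → ℝ, (∀ w ∈ N, x w 1 = 0) →
        MvPolynomial.aeval (fun vi : V × Fin 2 => x vi.1 vi.2) P = 0

lemma Generic.genOn {p : V → Fin 2 → ℝ} (hp : Generic p) : GenOn ∅ p := by
  refine ⟨by simp, fun P hP x _ => ?_⟩
  rw [hp.eq_zero_of_aeval_eq_zero P hP, map_zero]

lemma exists_algebraicIndependent_real (ι : Type*) [Finite ι] :
    ∃ t : ι → ℝ, AlgebraicIndependent ℚ t := by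
  obtain ⟨s, hs⟩ := exists_isTranscendenceBasis ℚ ℝ
  have hinf : Infinite s := by
    by_contra hfin
    rw [not_infinite_iff_finite] at hfin
    have := hs.isAlgebraic
    have h1 := Algebra.IsAlgebraic.cardinalMk_le_max
      (Algebra.adjoin ℚ (Set.range ((↑) : s → ℝ))) ℝ
    have h2 : Cardinal.mk (Algebra.adjoin ℚ (Set.range ((↑) : s → ℝ))) ≤ Cardinal.aleph0 := by
      rw [← Cardinal.mk_congr hs.1.aevalEquiv.toEquiv]
      refine MvPolynomial.cardinalMk_le_max.trans ?_
      simp [Cardinal.mk_le_aleph0]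
    have h3 := h1.trans (max_le h2 le_rfl)
    rw [Cardinal.mk_real] at h3
    exact absurd h3 (not_le.2 Cardinal.aleph0_lt_continuum)
  obtain ⟨n, ⟨e⟩⟩ := Finite.exists_equiv_fin ι
  have f := Infinite.natEmbedding s
  exact ⟨fun i => (f (e i) : ℝ), hs.1.comp (fun i => f (e i)) fun i j h => by
    simpa [Fin.val_inj] using h⟩

lemma exists_genOn [Finite V] (N : Set V) : ∃ p : V → Fin 2 → ℝ, GenOn N p := by
  classical
  obtain ⟨t, ht⟩ := exists_algebraicIndependent_real (V × Fin 2)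
  have key : ∀ (x : V → Fin 2 → ℝ) (P : MvPolynomial (V × Fin 2) ℚ),
      MvPolynomial.aeval (fun vi : V × Fin 2 => if vi.1 ∈ N ∧ vi.2 = 1 then 0 else x vi.1 vi.2) P =
      MvPolynomial.aeval (fun vi : V × Fin 2 => x vi.1 vi.2) (MvPolynomial.bind₁
        (fun vi : V × Fin 2 => if vi.1 ∈ N ∧ vi.2 = 1 then 0 else MvPolynomial.X vi) P) := by
    intro x P
    rw [MvPolynomial.aeval_bind₁]
    congr 2
    ext vi
    split_ifs <;> simp
  refine ⟨fun w i => if w ∈ N ∧ i = 1 then 0 else t (w, i), by simp +contextual, ?_⟩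
  intro P hP x hx
  rw [key (fun w i => t (w, i))] at hP
  have h0 := ht.eq_zero_of_aeval_eq_zero _ hP
  have hx' : (fun vi : V × Fin 2 => x vi.1 vi.2) =
      fun vi : V × Fin 2 => if vi.1 ∈ N ∧ vi.2 = 1 then 0 else x vi.1 vi.2 := by
    ext ⟨w, i⟩
    split_ifs with h
    · obtain ⟨h1, rfl⟩ := h
      exact hx w h1
    · rfl
  rw [hx', key, h0, map_zero]

lemma transcendental_linear {a r : ℚ} (hr : r ≠ 0) :
    Transcendental ℚ (Polynomial.C a + Polynomial.C r * Polynomial.X) := by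
  rw [add_comm]
  refine Polynomial.transcendental _ ?_ ?_
  · rw [Polynomial.natDegree_linear hr]
    exact one_ne_zero
  · rw [Polynomial.leadingCoeff_linear hr]
    exact mem_nonZeroDivisors_of_ne_zero hr

lemma exists_generic_dist_lt [Finite V] (p : V → Fin 2 → ℝ) {ε : ℝ} (hε : 0 < ε) :
    ∃ q : V → Fin 2 → ℝ, Generic q ∧ ∀ w i, |q w i - p w i| < ε := by
  obtain ⟨t, ht⟩ := exists_algebraicIndependent_real (V × Fin 2)
  have h1 : ∀ vi : V × Fin 2, ∃ r : ℚ, r ≠ 0 ∧ |(r : ℝ) * t vi| < ε / 2 := by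
    intro vi
    obtain ⟨r, hr0, hr⟩ := exists_rat_btwn (show (0 : ℝ) < ε / 2 / (|t vi| + 1) by positivity)
    have hr0' : (0 : ℝ) < r := by exact_mod_cast hr0
    refine ⟨r, by rintro rfl; simp at hr0', ?_⟩
    rw [abs_mul, abs_of_pos hr0']
    rw [lt_div_iff₀ (by positivity)] at hr
    nlinarith
  choose r hr0 hr using h1
  have h2 : ∀ vi : V × Fin 2, ∃ a : ℚ, |(a : ℝ) - p vi.1 vi.2| < ε / 2 := by
    intro vi
    obtain ⟨a, ha1, ha2⟩ := exists_rat_btwn (show p vi.1 vi.2 < p vi.1 vi.2 + ε / 2 by linarith)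
    exact ⟨a, by rw [abs_of_pos (by linarith)]; linarith⟩
  choose a ha using h2
  refine ⟨fun w i => (a (w, i) : ℝ) + r (w, i) * t (w, i), ?_, fun w i => ?_⟩
  · have := ht.polynomial_aeval_of_transcendental
      (f := fun vi => Polynomial.C (a vi) + Polynomial.C (r vi) * Polynomial.X)
      (fun vi => transcendental_linear (hr0 vi))
    unfold Generic
    convert this using 2
    simp
  · have := ha (w, i)
    have := hr (w, i)
    rw [abs_lt] at *
    constructor <;> simp only at * <;> linarith


section Transfer

variable [Finite V]

/-- Coordinates of a functional on velocity assignments. -/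
def coords [DecidableEq V] : ((V → Fin 2 → ℝ) →ₗ[ℝ] ℝ) →ₗ[ℝ] (V × Fin 2 → ℝ) where
  toFun φ vi := φ (Pi.single vi.1 (Pi.single vi.2 1))
  map_add' _ _ := rfl
  map_smul' _ _ := rfl

lemma coords_injective [DecidableEq V] : Function.Injective (coords (V := V)) := by
  have := Fintype.ofFinite V
  intro φ ψ h
  refine LinearMap.pi_ext' fun w => LinearMap.pi_ext' fun i => LinearMap.ext_ring ?_
  exact congrFun h (w, i)

lemma coords_row [DecidableEq V] (p : V → Fin 2 → ℝ) (a b : V) (vi : V × Fin 2) :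
    coords (row p s(a, b)) vi = (p a vi.2 - p b vi.2) *
      ((if vi.1 = a then 1 else 0) - (if vi.1 = b then 1 else 0)) := by
  obtain ⟨w, i⟩ := vi
  have : ∀ c : V, ∀ j : Fin 2, (Pi.single w (Pi.single i (1 : ℝ)) : V → Fin 2 → ℝ) c j =
      if w = c then (if i = j then 1 else 0) else 0 := by
    intro c j
    by_cases h : w = c
    · subst h
      by_cases hij : i = j
      · subst hij; simp
      · simp [Ne.symm hij, hij]
    · simp [Ne.symm h, h]
  change row p s(a, b) (Pi.single w (Pi.single i 1)) = _
  rw [row_mk]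
  simp only [this]
  fin_cases i <;> simp

lemma coords_row_eq_edgeVec [DecidableEq V] (p : V → Fin 2 → ℝ) (a b : V) :
    coords (row p s(a, b)) = edgeVec p a b := by
  ext ⟨w, i⟩
  rw [coords_row, edgeVec]
  by_cases h1 : w = a
  · by_cases h2 : w = b
    · simp [← h1, ← h2]
    · have h3 : a ≠ b := fun h => h2 (h1.trans h)
      simp [h1, h3]
  · by_cases h2 : w = b
    · have h3 : b ≠ a := fun h => h1 (h2.trans h)
      simp [h2, h3]
    · simp [h1, h2]

lemma ind_iff_coords [DecidableEq V] {p : V → Fin 2 → ℝ} {S : Set (Sym2 V)} :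
    Ind p S ↔ LinearIndependent ℝ (fun e : S => coords (row p e)) := by
  have := LinearMap.linearIndependent_iff (v := fun e : S => row p e) (coords (V := V))
    (LinearMap.ker_eq_bot.2 coords_injective)
  exact this.symm

lemma linearIndependent_iff_gram_det_ne_zero {m n : Type*} [Fintype m] [Fintype n] [DecidableEq m]
    (A : Matrix m n ℝ) : LinearIndependent ℝ (fun i => A i) ↔ (A * A.transpose).det ≠ 0 := by
  rw [← isUnit_iff_ne_zero, ← Matrix.isUnit_iff_isUnit_det,
    ← Matrix.linearIndependent_rows_iff_isUnit, linearIndependent_iff_card_eq_finrank_span,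
    linearIndependent_iff_card_eq_finrank_span, Set.finrank, Set.finrank]
  rw [show Set.range (fun i => A i) = Set.range A.row from rfl,
    ← Matrix.rank_eq_finrank_span_row, ← Matrix.rank_eq_finrank_span_row,
    Matrix.rank_self_mul_transpose]

lemma exists_polynomial_ind (S : Set (Sym2 V)) : ∃ P : MvPolynomial (V × Fin 2) ℚ,
    ∀ p : V → Fin 2 → ℝ,
      Ind p S ↔ MvPolynomial.aeval (fun vi : V × Fin 2 => p vi.1 vi.2) P ≠ 0 := by
  classical
  have := Fintype.ofFinite V
  have := Fintype.ofFinite S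
  let A : Matrix S (V × Fin 2) (MvPolynomial (V × Fin 2) ℚ) := fun e vi =>
    (MvPolynomial.X ((Quot.out e.1).1, vi.2) - MvPolynomial.X ((Quot.out e.1).2, vi.2)) *
      ((if vi.1 = (Quot.out e.1).1 then 1 else 0) - (if vi.1 = (Quot.out e.1).2 then 1 else 0))
  refine ⟨(A * A.transpose).det, fun p => ?_⟩
  rw [ind_iff_coords]
  have hA : (fun e : S => coords (row p e)) =
      fun e : S => (A.map (MvPolynomial.aeval (fun vi : V × Fin 2 => p vi.1 vi.2))) e := by
    ext e vi
    have he : s((Quot.out e.1).1, (Quot.out e.1).2) = e.1 := Quot.out_eq e.1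
    conv_lhs => rw [← he]
    rw [coords_row]
    change _ = MvPolynomial.aeval _ (A e vi)
    simp only [A, map_mul, map_sub, MvPolynomial.aeval_X]
    congr 2 <;> split_ifs <;> simp
  rw [hA, linearIndependent_iff_gram_det_ne_zero, AlgHom.map_det]
  simp only [AlgHom.mapMatrix_apply, Matrix.map_mul, Matrix.transpose_map]

lemma GenOn.ind {N : Set V} {p : V → Fin 2 → ℝ} (hp : GenOn N p) {S : Set (Sym2 V)}
    {x : V → Fin 2 → ℝ} (hx : ∀ w ∈ N, x w 1 = 0) (h : Ind x S) : Ind p S := by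
  obtain ⟨P, hP⟩ := exists_polynomial_ind S
  rw [hP] at h ⊢
  exact fun h0 => h (hp.2 P h0 x hx)

lemma Generic.ind {p : V → Fin 2 → ℝ} (hp : Generic p) {S : Set (Sym2 V)}
    {x : V → Fin 2 → ℝ} (h : Ind x S) : Ind p S :=
  hp.genOn.ind (by simp) h

lemma rankAt_eq_finrank [DecidableEq V] (p : V → Fin 2 → ℝ) (F : Set (Sym2 V)) :
    rankAt 2 p F = Module.finrank ℝ (Submodule.span ℝ (row p '' F)) := by
  have h : {x : V × Fin 2 → ℝ | ∃ u v : V, s(u, v) ∈ F ∧ x = edgeVec p u v} =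
      coords '' (row p '' F) := by
    ext x
    constructor
    · rintro ⟨a, b, hab, rfl⟩
      exact ⟨_, ⟨_, hab, rfl⟩, coords_row_eq_edgeVec p a b⟩
    · rintro ⟨_, ⟨e, he, rfl⟩, rfl⟩
      induction e with | _ a b => exact ⟨a, b, he, coords_row_eq_edgeVec p a b⟩
  rw [rankAt, h, Submodule.span_image, ← (Submodule.equivMapOfInjective coords coords_injective _).finrank_eq]

lemma Ind.finrank_eq {p : V → Fin 2 → ℝ} {S : Set (Sym2 V)} (h : Ind p S) :
    Module.finrank ℝ (Submodule.span ℝ (row p '' S)) = S.ncard := by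
  have := Fintype.ofFinite S
  rw [Set.image_eq_range, finrank_span_eq_card (show LinearIndependent ℝ fun e : S => row p e from h),
      ← Nat.card_eq_fintype_card]
  rfl

lemma Generic.rd_eq [DecidableEq V] {p : V → Fin 2 → ℝ} (hp : Generic p) (F : Set (Sym2 V)) :
    rd 2 F = rankAt 2 p F := by
  have hle : ∀ x, rankAt 2 x F ≤ rankAt 2 p F := by
    intro x
    obtain ⟨J, -, hJF, hJ, hcl⟩ := exists_basis x (Ind.empty x) (Set.empty_subset F)
    rw [rankAt_eq_finrank, rankAt_eq_finrank]
    have h1 : Submodule.span ℝ (row x '' F) ≤ Submodule.span ℝ (row x '' J) := by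
      rw [Submodule.span_le]
      rintro _ ⟨f, hf, rfl⟩
      exact mem_cl_iff_span.1 (hcl hf)
    refine (Submodule.finrank_mono h1).trans ?_
    rw [hJ.finrank_eq, ← (hp.ind hJ).finrank_eq]
    exact Submodule.finrank_mono (Submodule.span_mono (Set.image_mono hJF))
  refine le_antisymm (csSup_le ⟨_, p, rfl⟩ ?_) (le_csSup ⟨rankAt 2 p F, ?_⟩ ⟨p, rfl⟩)
  · rintro _ ⟨x, rfl⟩; exact hle x
  · rintro _ ⟨x, rfl⟩; exact hle x

lemma Generic.rdIndep_iff [DecidableEq V] {p : V → Fin 2 → ℝ} (hp : Generic p)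
    {F : Set (Sym2 V)} : RdIndep 2 F ↔ Ind p F := by
  have := Fintype.ofFinite F
  rw [RdIndep, hp.rd_eq, rankAt_eq_finrank, Set.image_eq_range, Ind]
  change _ ↔ LinearIndependent ℝ fun e : F => row p e
  rw [linearIndependent_iff_card_eq_finrank_span, ← Nat.card_eq_fintype_card, eq_comm]
  rfl

lemma Generic.rdCircuit_iff [DecidableEq V] {p : V → Fin 2 → ℝ} (hp : Generic p)
    {C : Set (Sym2 V)} : RdCircuit 2 C ↔ Circ p C := by
  simp only [RdCircuit, circ_iff, hp.rdIndep_iff]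

end Transfer

end Generic

section Combinatorics

/-- The neighbours of `w` in the edge set `S`. -/
def nb (S : Set (Sym2 V)) (w : V) : Set V := {x | s(w, x) ∈ S}

/-- The edges of `S` not incident with `w`. -/
def away (S : Set (Sym2 V)) (w : V) : Set (Sym2 V) := {e ∈ S | w ∉ e}

/-- All pairs (including diagonal ones) inside `X`. -/
def pairs (X : Set V) : Set (Sym2 V) := {e | ∀ w ∈ e, w ∈ X}

lemma mem_vertexSpan_iff_nb {S : Set (Sym2 V)} {w : V} : w ∈ vertexSpan S ↔ (nb S w).Nonempty := by
  constructor
  · rintro ⟨e, he, hw⟩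
    obtain ⟨x, rfl⟩ := Sym2.mem_iff_exists.1 hw
    exact ⟨x, he⟩
  · rintro ⟨x, hx⟩
    exact ⟨_, hx, by simp⟩

lemma vertexSpan_mono {S T : Set (Sym2 V)} (h : S ⊆ T) : vertexSpan S ⊆ vertexSpan T :=
  fun _ ⟨e, he, hw⟩ => ⟨e, h he, hw⟩

lemma subset_pairs_vertexSpan (S : Set (Sym2 V)) : S ⊆ pairs (vertexSpan S) :=
  fun e he _ hw => ⟨e, he, hw⟩

lemma mk_mem_pairs {X : Set V} {a b : V} : s(a, b) ∈ pairs X ↔ a ∈ X ∧ b ∈ X := by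
  simp [pairs]

lemma away_subset (S : Set (Sym2 V)) (w : V) : away S w ⊆ S := fun _ h => h.1

lemma notMem_vertexSpan_away (S : Set (Sym2 V)) (w : V) : w ∉ vertexSpan (away S w) := by
  rintro ⟨e, he, hw⟩
  exact he.2 hw

lemma away_union_star (S : Set (Sym2 V)) (w : V) :
    away S w ∪ (fun x => s(w, x)) '' nb S w = S := by
  ext e
  constructor
  · rintro (h | ⟨x, hx, rfl⟩)
    · exact h.1
    · exact hx
  · intro h
    by_cases hw : w ∈ e
    · obtain ⟨x, rfl⟩ := Sym2.mem_iff_exists.1 hw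
      exact Or.inr ⟨x, h, rfl⟩
    · exact Or.inl ⟨h, hw⟩

lemma ne_of_mem_nb {S : Set (Sym2 V)} (hS : ∀ e ∈ S, ¬ e.IsDiag) {w x : V} (h : x ∈ nb S w) :
    w ≠ x := by
  rintro rfl
  exact hS _ h (by simp)

lemma sum_nb_ncard [Finite V] {C : Set (Sym2 V)} (hC : ∀ e ∈ C, ¬ e.IsDiag) (X : Finset V) :
    ∑ w ∈ X, (nb C w).ncard =
      {e ∈ C | ∃ w ∈ e, w ∈ X}.ncard + {e ∈ C | ∀ w ∈ e, w ∈ X}.ncard := by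
  classical
  have := Fintype.ofFinite V
  have h1 : ∀ w, (nb C w).ncard = ∑ e ∈ C.toFinset, if w ∈ e then 1 else 0 := by
    intro w
    rw [← Finset.card_filter, ← Set.ncard_image_of_injective (nb C w) (f := fun x => s(w, x))
      (fun a b h => Sym2.congr_right.1 h), ← Set.ncard_coe_finset]
    congr 1
    ext e
    simp only [Set.mem_image, Finset.coe_filter, Set.mem_toFinset, Set.mem_ofPred_eq]
    constructor
    · rintro ⟨x, hx, rfl⟩
      exact ⟨hx, by simp⟩
    · rintro ⟨he, hw⟩
      obtain ⟨x, rfl⟩ := Sym2.mem_iff_exists.1 hw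
      exact ⟨x, he, rfl⟩
  have h2 : ∀ Q : Sym2 V → Prop, {e ∈ C | Q e}.ncard = ∑ e ∈ C.toFinset, if Q e then 1 else 0 := by
    intro Q
    rw [← Finset.card_filter, ← Set.ncard_coe_finset]
    congr 1
    ext e
    simp
  rw [h2, h2, Finset.sum_congr rfl fun w _ => h1 w, Finset.sum_comm, ← Finset.sum_add_distrib]
  refine Finset.sum_congr rfl fun e he => ?_
  rw [Set.mem_toFinset] at he
  have hd := hC e he
  induction e with | _ a b =>
    have hab : a ≠ b := by simpa using hd
    rw [← Finset.card_filter]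
    have : {w ∈ X | w ∈ s(a, b)} = {w ∈ ({a, b} : Finset V) | w ∈ X} := by
      ext w; simp [and_comm]
    rw [this, Finset.card_filter, Finset.sum_pair hab]
    by_cases ha : a ∈ X <;> by_cases hb : b ∈ X <;> simp [ha, hb]

lemma exists_triple_of_ncard_eq_three {X : Set V} (h : X.ncard = 3) :
    ∃ x y z, x ≠ y ∧ x ≠ z ∧ y ≠ z ∧ X = {x, y, z} := Set.ncard_eq_three.1 h

end Combinatorics

section Geometry

/-- Twice the signed area of the triangle `abc`. -/
def area (p : V → Fin 2 → ℝ) (a b c : V) : ℝ :=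
  (p b 0 - p a 0) * (p c 1 - p a 1) - (p b 1 - p a 1) * (p c 0 - p a 0)

/-- Points in general position: no two share a coordinate and no three are collinear. -/
structure GenPos (p : V → Fin 2 → ℝ) : Prop where
  coord_ne : ∀ a b, a ≠ b → ∀ i, p a i ≠ p b i
  area_ne : ∀ a b c, a ≠ b → a ≠ c → b ≠ c → area p a b c ≠ 0

lemma GenOn.area_ne {N : Set V} {p : V → Fin 2 → ℝ} (hp : GenOn N p) {a b c : V}
    {x : V → Fin 2 → ℝ} (hx : ∀ w ∈ N, x w 1 = 0) (h : area x a b c ≠ 0) : area p a b c ≠ 0 := by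
  intro h0
  have := hp.2 ((MvPolynomial.X (b, 0) - MvPolynomial.X (a, 0)) *
    (MvPolynomial.X (c, 1) - MvPolynomial.X (a, 1)) -
    (MvPolynomial.X (b, 1) - MvPolynomial.X (a, 1)) *
    (MvPolynomial.X (c, 0) - MvPolynomial.X (a, 0))) (by simpa [area] using h0) x hx
  exact h (by simpa [area] using this)

lemma GenOn.coord_ne {N : Set V} {p : V → Fin 2 → ℝ} (hp : GenOn N p) {a b : V} {i : Fin 2}
    {x : V → Fin 2 → ℝ} (hx : ∀ w ∈ N, x w 1 = 0) (h : x a i ≠ x b i) : p a i ≠ p b i := by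
  intro h0
  have := hp.2 (MvPolynomial.X (a, i) - MvPolynomial.X (b, i))
    (by simpa [sub_eq_zero] using h0) x hx
  exact h (by simpa [sub_eq_zero] using this)

lemma Generic.genPos {p : V → Fin 2 → ℝ} (hp : Generic p) : GenPos p := by
  classical
  constructor
  · intro a b hab i
    exact hp.genOn.coord_ne (x := fun w _ => if w = a then 1 else 0) (by simp) (by simp [hab.symm])
  · intro a b c hab hac hbc
    exact hp.genOn.area_ne (x := fun w i => if w = b ∧ i = 0 ∨ w = c ∧ i = 1 then 1 else 0)
      (by simp) (by simp [area, hab, hac, hbc, hbc.symm])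

variable {p : V → Fin 2 → ℝ}

lemma row_update_of_notMem [DecidableEq V] {w : V} {e : Sym2 V} (he : w ∉ e) (x : Fin 2 → ℝ)
    (μ : V → Fin 2 → ℝ) : row p e (Function.update μ w x) = row p e μ :=
  row_congr (fun _ _ => rfl) fun v hv => by
    rw [Function.update_of_ne]; rintro rfl; exact he hv

lemma row_placement_update_of_notMem [DecidableEq V] {w : V} {e : Sym2 V} (he : w ∉ e)
    (x : Fin 2 → ℝ) : row (Function.update p w x) e = row p e := by
  ext μ
  rw [row_comm, row_update_of_notMem he, row_comm]

lemma ind_congr {q : V → Fin 2 → ℝ} {S : Set (Sym2 V)} (h : ∀ e ∈ S, row p e = row q e) :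
    Ind p S ↔ Ind q S := by
  have : (fun e : S => row p e) = fun e : S => row q e := by
    ext1 e; exact h e e.2
  change LinearIndependent ℝ (fun e : S => row p e) ↔ LinearIndependent ℝ (fun e : S => row q e)
  rw [this]

variable [Finite V]

lemma Ind.insert_one {S : Set (Sym2 V)} (h : Ind p S) {w x : V} (hw : w ∉ vertexSpan S)
    (hne : ∃ i, p w i ≠ p x i) : Ind p (Insert.insert s(w, x) S) := by
  classical
  have hwx : x ≠ w := by rintro rfl; simp at hne
  refine h.insert (μ := Function.update 0 w (p w - p x)) (fun f hf => ?_) ?_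
  · rw [row_update_of_notMem (fun hwf => hw ⟨f, hf, hwf⟩), map_zero]
  · simp only [row_mk, Function.update_self, Function.update_of_ne hwx, Pi.sub_apply, Pi.zero_apply,
      sub_zero]
    obtain ⟨i, hi⟩ := hne
    intro h0
    obtain ⟨h1, h2⟩ := mul_self_add_mul_self_eq_zero.1 h0
    fin_cases i
    · exact hi (sub_eq_zero.1 h1)
    · exact hi (sub_eq_zero.1 h2)

lemma Ind.insert_two {S : Set (Sym2 V)} (h : Ind p S) {w x y : V} (hw : w ∉ vertexSpan S)
    (ha : area p w x y ≠ 0) :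
    Ind p (Insert.insert s(w, y) (Insert.insert s(w, x) S)) := by
  classical
  have hwx : x ≠ w := by rintro rfl; simp [area] at ha
  have hwy : y ≠ w := by rintro rfl; simp [area] at ha
  have h1 : Ind p (Insert.insert s(w, x) S) := by
    refine h.insert_one hw ?_
    by_contra! h0
    exact ha (by simp [area, h0])
  refine h1.insert (μ := Function.update 0 w ![-(p w 1 - p x 1), p w 0 - p x 0])
    (fun f hf => ?_) ?_
  · rcases hf with rfl | hf
    · simp [Function.update_of_ne hwx]
      ring
    · rw [row_update_of_notMem (fun hwf => hw ⟨f, hf, hwf⟩), map_zero]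
  · simp [Function.update_of_ne hwy]
    intro h0
    apply ha
    rw [area]
    linarith

/-- The obstruction to extending a motion `μ` of the points `x, y, z` to a point `w` joined to all
three of them. -/
def obst (p μ : V → Fin 2 → ℝ) (w x y z : V) : ℝ :=
  area p w y z * ((p w 0 - p x 0) * μ x 0 + (p w 1 - p x 1) * μ x 1) +
  area p w z x * ((p w 0 - p y 0) * μ y 0 + (p w 1 - p y 1) * μ y 1) +
  area p w x y * ((p w 0 - p z 0) * μ z 0 + (p w 1 - p z 1) * μ z 1)

lemma obst_rotate (p μ : V → Fin 2 → ℝ) (w x y z : V) :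
    obst p μ w y z x = obst p μ w x y z := by
  simp only [obst]; ring

lemma Ind.insert_three_aux {S : Set (Sym2 V)} (h : Ind p S) {w x y z : V}
    (hw : w ∉ vertexSpan S) (hwz : z ≠ w)
    {μ : V → Fin 2 → ℝ} (hμ : ∀ f ∈ S, row p f μ = 0) (hE : obst p μ w x y z ≠ 0)
    (ha : area p w x y ≠ 0) :
    Ind p (S ∪ {s(w, x), s(w, y), s(w, z)}) := by
  classical
  have hwx : x ≠ w := by rintro rfl; simp [area] at ha
  have hwy : y ≠ w := by rintro rfl; simp [area] at ha
  have h2 := h.insert_two hw ha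
  set r1 := (p w 0 - p x 0) * μ x 0 + (p w 1 - p x 1) * μ x 1 with hr1
  set r2 := (p w 0 - p y 0) * μ y 0 + (p w 1 - p y 1) * μ y 1 with hr2
  set D := (p w 0 - p x 0) * (p w 1 - p y 1) - (p w 1 - p x 1) * (p w 0 - p y 0) with hD
  have hDa : D = area p w x y := by rw [hD, area]; ring
  have hD0 : D ≠ 0 := hDa ▸ ha
  set m : Fin 2 → ℝ := ![(r1 * (p w 1 - p y 1) - r2 * (p w 1 - p x 1)) / D,
    ((p w 0 - p x 0) * r2 - (p w 0 - p y 0) * r1) / D] with hm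
  have hm0 : m 0 = (r1 * (p w 1 - p y 1) - r2 * (p w 1 - p x 1)) / D := rfl
  have hm1 : m 1 = ((p w 0 - p x 0) * r2 - (p w 0 - p y 0) * r1) / D := rfl
  have e1 : (p w 0 - p x 0) * m 0 + (p w 1 - p x 1) * m 1 = r1 := by
    rw [hm0, hm1]; field_simp; rw [hD]; ring
  have e2 : (p w 0 - p y 0) * m 0 + (p w 1 - p y 1) * m 1 = r2 := by
    rw [hm0, hm1]; field_simp; rw [hD]; ring
  have h3 := h2.insert (e := s(w, z)) (μ := Function.update μ w m) (fun f hf => ?_) ?_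
  · convert h3 using 1
    ext e
    simp only [Set.mem_union, Set.mem_insert_iff, Set.mem_singleton_iff]
    tauto
  · rcases hf with rfl | rfl | hf
    · simp only [row_mk, Function.update_self, Function.update_of_ne hwy]
      linarith
    · simp only [row_mk, Function.update_self, Function.update_of_ne hwx]
      linarith
    · rw [row_update_of_notMem (fun hwf => hw ⟨f, hf, hwf⟩), hμ f hf]
  · simp only [row_mk, Function.update_self, Function.update_of_ne hwz]
    intro h0
    apply hE
    have e3 : (p w 0 - p z 0) * m 0 + (p w 1 - p z 1) * m 1 =
      (p w 0 - p z 0) * μ z 0 + (p w 1 - p z 1) * μ z 1 := by linarith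
    rw [obst, ← e3, ← hr1, ← hr2, ← e1, ← e2]
    simp only [area]
    ring

lemma Ind.insert_three {S : Set (Sym2 V)} (h : Ind p S) {w x y z : V}
    (hw : w ∉ vertexSpan S) (hwx : x ≠ w) (hwy : y ≠ w) (hwz : z ≠ w)
    {μ : V → Fin 2 → ℝ} (hμ : ∀ f ∈ S, row p f μ = 0) (hE : obst p μ w x y z ≠ 0) :
    Ind p (S ∪ {s(w, x), s(w, y), s(w, z)}) := by
  by_cases h1 : area p w x y = 0
  · by_cases h2 : area p w y z = 0
    · have h3 : area p w z x ≠ 0 := by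
        intro h3; exact hE (by simp [obst, h1, h2, h3])
      have := h.insert_three_aux hw hwy hμ (x := z) (y := x) (by rwa [← obst_rotate]) h3
      convert this using 2
      ext e; simp only [Set.mem_insert_iff, Set.mem_singleton_iff]; tauto
    · have := h.insert_three_aux hw hwx hμ (x := y) (y := z) (by rwa [obst_rotate]) h2
      convert this using 2
      ext e; simp only [Set.mem_insert_iff, Set.mem_singleton_iff]; tauto
  · exact h.insert_three_aux hw hwz hμ hE h1

end Geometry

section Rigid

variable {p : V → Fin 2 → ℝ}

/-- Every pair of vertices of `X` is preserved to first order by all motions of `S`. -/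
def Rig (p : V → Fin 2 → ℝ) (S : Set (Sym2 V)) (X : Set V) : Prop := pairs X ⊆ Cl p S

lemma Rig.mem {S : Set (Sym2 V)} {X : Set V} (h : Rig p S X) {a b : V} (ha : a ∈ X) (hb : b ∈ X) :
    s(a, b) ∈ Cl p S := h (mk_mem_pairs.2 ⟨ha, hb⟩)

lemma rig_iff {S : Set (Sym2 V)} {X : Set V} :
    Rig p S X ↔ ∀ a ∈ X, ∀ b ∈ X, s(a, b) ∈ Cl p S := by
  refine ⟨fun h a ha b hb => h.mem ha hb, fun h e he => ?_⟩
  induction e with | _ a b =>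
    obtain ⟨ha, hb⟩ := mk_mem_pairs.1 he
    exact h a ha b hb

lemma Rig.mono {S T : Set (Sym2 V)} {X : Set V} (h : Rig p S X) (hST : S ⊆ T) : Rig p T X :=
  Set.Subset.trans h (cl_mono p hST)

lemma Rig.trans {S T : Set (Sym2 V)} {X : Set V} (h : Rig p S X) (hST : S ⊆ Cl p T) : Rig p T X :=
  Set.Subset.trans h (cl_subset_cl hST)

lemma Rig.anti {S : Set (Sym2 V)} {X Y : Set V} (h : Rig p S X) (hY : Y ⊆ X) : Rig p S Y :=
  fun _ he => h fun w hw => hY (he w hw)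

lemma Rig.pair (p : V → Fin 2 → ℝ) {S : Set (Sym2 V)} {a b : V} (h : s(a, b) ∈ Cl p S) :
    Rig p S {a, b} := by
  rw [rig_iff]
  have h' : s(b, a) ∈ Cl p S := by rwa [Sym2.eq_swap]
  rintro x (rfl | rfl) y (rfl | rfl)
  · exact diag_mem_cl _ _ (by simp)
  · exact h
  · exact h'
  · exact diag_mem_cl _ _ (by simp)

/-- The velocity of `μ` at `a` is that of the infinitesimal isometry with parameters
`t₀, t₁, θ`. -/
def TrivAt (p μ : V → Fin 2 → ℝ) (t₀ t₁ θ : ℝ) (a : V) : Prop :=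
  μ a 0 = t₀ - θ * p a 1 ∧ μ a 1 = t₁ + θ * p a 0

lemma TrivAt.row_eq_zero {μ : V → Fin 2 → ℝ} {t₀ t₁ θ : ℝ} {a b : V}
    (ha : TrivAt p μ t₀ t₁ θ a) (hb : TrivAt p μ t₀ t₁ θ b) : row p s(a, b) μ = 0 := by
  rw [row_mk, ha.1, ha.2, hb.1, hb.2]; ring

lemma exists_trivAt {μ : V → Fin 2 → ℝ} {a b : V} (hne : p a 0 ≠ p b 0)
    (h : row p s(a, b) μ = 0) :
    ∃ t₀ t₁ θ, TrivAt p μ t₀ t₁ θ a ∧ TrivAt p μ t₀ t₁ θ b := by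
  have hd : p a 0 - p b 0 ≠ 0 := sub_ne_zero.2 hne
  rw [row_mk] at h
  refine ⟨μ a 0 + (μ a 1 - μ b 1) / (p a 0 - p b 0) * p a 1,
    μ a 1 - (μ a 1 - μ b 1) / (p a 0 - p b 0) * p a 0,
    (μ a 1 - μ b 1) / (p a 0 - p b 0), ⟨by ring, by ring⟩, ?_, ?_⟩
  · field_simp
    linarith
  · field_simp
    ring

lemma TrivAt.of_rows {μ : V → Fin 2 → ℝ} {t₀ t₁ θ : ℝ} {a b c : V}
    (ha : TrivAt p μ t₀ t₁ θ a) (hb : TrivAt p μ t₀ t₁ θ b)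
    (hac : row p s(c, a) μ = 0) (hbc : row p s(c, b) μ = 0) (harea : area p a b c ≠ 0) :
    TrivAt p μ t₀ t₁ θ c := by
  rw [row_mk, ha.1, ha.2] at hac
  rw [row_mk, hb.1, hb.2] at hbc
  have e0 : area p a b c * (μ c 0 - (t₀ - θ * p c 1)) = 0 := by
    rw [area]
    linear_combination (p c 1 - p b 1) * hac - (p c 1 - p a 1) * hbc
  have e1 : area p a b c * (μ c 1 - (t₁ + θ * p c 0)) = 0 := by
    rw [area]
    linear_combination (-(p c 0 - p b 0)) * hac + (p c 0 - p a 0) * hbc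
  exact ⟨sub_eq_zero.1 ((mul_eq_zero.1 e0).resolve_left harea),
    sub_eq_zero.1 ((mul_eq_zero.1 e1).resolve_left harea)⟩

lemma Rig.trivAt {S : Set (Sym2 V)} {X : Set V} (hp : GenPos p) (h : Rig p S X)
    {μ : V → Fin 2 → ℝ} (hμ : ∀ f ∈ S, row p f μ = 0) {a b : V} (ha : a ∈ X) (hb : b ∈ X)
    (hab : a ≠ b) {t₀ t₁ θ : ℝ} (h1 : TrivAt p μ t₀ t₁ θ a) (h2 : TrivAt p μ t₀ t₁ θ b)
    {c : V} (hc : c ∈ X) : TrivAt p μ t₀ t₁ θ c := by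
  by_cases hca : c = a
  · exact hca ▸ h1
  by_cases hcb : c = b
  · exact hcb ▸ h2
  exact h1.of_rows h2 (h.mem hc ha μ hμ) (h.mem hc hb μ hμ)
    (hp.area_ne a b c hab (Ne.symm hca) (Ne.symm hcb))

lemma Rig.union {S : Set (Sym2 V)} {X Y : Set V} (hp : GenPos p) (hX : Rig p S X)
    (hY : Rig p S Y) {a b : V} (hab : a ≠ b) (haX : a ∈ X) (hbX : b ∈ X) (haY : a ∈ Y)
    (hbY : b ∈ Y) : Rig p S (X ∪ Y) := by
  rw [rig_iff]
  intro x hx y hy μ hμ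
  obtain ⟨t₀, t₁, θ, h1, h2⟩ := exists_trivAt (hp.coord_ne a b hab 0) (hX.mem haX hbX μ hμ)
  have key : ∀ c ∈ X ∪ Y, TrivAt p μ t₀ t₁ θ c := by
    rintro c (hc | hc)
    · exact hX.trivAt hp hμ haX hbX hab h1 h2 hc
    · exact hY.trivAt hp hμ haY hbY hab h1 h2 hc
  exact (key x hx).row_eq_zero (key y hy)

lemma Rig.insert {S : Set (Sym2 V)} {X : Set V} (hp : GenPos p) (hX : Rig p S X) {a b c : V}
    (hab : a ≠ b) (ha : a ∈ X) (hb : b ∈ X) (hca : s(c, a) ∈ Cl p S) (hcb : s(c, b) ∈ Cl p S) :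
    Rig p S (Insert.insert c X) := by
  by_cases hc : c ∈ X
  · rwa [Set.insert_eq_of_mem hc]
  rw [rig_iff]
  intro x hx y hy μ hμ
  obtain ⟨t₀, t₁, θ, h1, h2⟩ := exists_trivAt (hp.coord_ne a b hab 0) (hX.mem ha hb μ hμ)
  have key : ∀ d ∈ Insert.insert c X, TrivAt p μ t₀ t₁ θ d := by
    rintro d (rfl | hd)
    · exact h1.of_rows h2 (hca μ hμ) (hcb μ hμ) (hp.area_ne a b d hab
        (by rintro rfl; exact hc ha) (by rintro rfl; exact hc hb))
    · exact hX.trivAt hp hμ ha hb hab h1 h2 hd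
  exact (key x hx).row_eq_zero (key y hy)

lemma Rig.triple {S : Set (Sym2 V)} (hp : GenPos p) {x y z : V} (hxy : x ≠ y)
    (h1 : s(x, y) ∈ Cl p S) (h2 : s(x, z) ∈ Cl p S) (h3 : s(y, z) ∈ Cl p S) :
    Rig p S {x, y, z} := by
  have := (Rig.pair p h1).insert hp hxy (c := z) (by simp) (by simp)
    (by rwa [Sym2.eq_swap]) (by rwa [Sym2.eq_swap])
  convert this using 1
  ext v; simp only [Set.mem_insert_iff, Set.mem_singleton_iff]; tauto

lemma mem_cl_of_triangle {S : Set (Sym2 V)} (hp : GenPos p) {w x y z : V}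
    (hxy : x ≠ y) (h : Rig p S {x, y, z}) :
    s(w, z) ∈ Cl p (S ∪ {s(w, x), s(w, y)}) := by
  have h1 : Rig p (S ∪ {s(w, x), s(w, y)}) {x, y, z} := h.mono Set.subset_union_left
  have h2 := h1.insert hp hxy (c := w) (by simp) (by simp) (subset_cl _ _ (by simp))
    (subset_cl _ _ (by simp))
  exact h2.mem (by simp) (by simp)

variable [Finite V]

lemma not_ind_of_triangle {S : Set (Sym2 V)} (hp : GenPos p) {w x y z : V}
    (hw : w ∉ vertexSpan S) (hxy : x ≠ y) (hxz : x ≠ z) (hyz : y ≠ z)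
    (h : Rig p S {x, y, z}) : ¬ Ind p (S ∪ {s(w, x), s(w, y), s(w, z)}) := by
  intro hi
  by_cases hwz : w = z
  · have h0 : Ind p (Insert.insert s(w, z) ∅) := hi.mono (by simp)
    exact ((ind_insert (by simp)).1 h0).2 (diag_mem_cl _ _ (by simp [hwz]))
  have he : s(w, z) ∉ S ∪ {s(w, x), s(w, y)} := by
    rintro (h1 | h1 | h1)
    · exact hw ⟨_, h1, by simp⟩
    · exact hxz (Sym2.congr_right.1 h1).symm
    · exact hyz (Sym2.congr_right.1 h1).symm
  have : S ∪ {s(w, x), s(w, y), s(w, z)} = Insert.insert s(w, z) (S ∪ {s(w, x), s(w, y)}) := by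
    ext e; simp only [Set.mem_union, Set.mem_insert_iff, Set.mem_singleton_iff]; tauto
  rw [this, ind_insert he] at hi
  exact hi.2 (mem_cl_of_triangle hp hxy h)

lemma exists_ind_rig (hp : GenPos p) {X : Set V} (hX : 2 ≤ X.ncard) :
    ∃ S ⊆ pairs X, Ind p S ∧ Rig p S X ∧ S.ncard + 3 = 2 * X.ncard := by
  obtain ⟨n, hn⟩ : ∃ n, X.ncard = n + 2 := ⟨X.ncard - 2, by omega⟩
  clear hX
  induction n generalizing X with
  | zero =>
    obtain ⟨a, b, hab, rfl⟩ := Set.ncard_eq_two.1 hn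
    refine ⟨{s(a, b)}, ?_, ?_, Rig.pair p (subset_cl _ _ rfl), ?_⟩
    · rintro _ rfl
      simp [mk_mem_pairs]
    · have := (Ind.empty p).insert_one (w := a) (x := b) (by simp [vertexSpan])
        ⟨0, hp.coord_ne a b hab 0⟩
      simpa using this
    · rw [hn]; simp
  | succ n ih =>
    obtain ⟨w, hw⟩ : X.Nonempty := by
      rw [← Set.ncard_pos]; omega
    have hcard : (X \ {w}).ncard = n + 2 := by
      rw [Set.ncard_sdiff_singleton_of_mem hw]; omega
    obtain ⟨S, hS, hi, hr, hc⟩ := ih hcard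
    obtain ⟨a, ha, b, hb, hab⟩ := (Set.one_lt_ncard (s := X \ {w})).1 (by omega)
    have hwS : w ∉ vertexSpan S := by
      rintro ⟨e, he, hwe⟩
      exact (hS he w hwe).2 rfl
    have hwa : w ≠ a := fun h => ha.2 h.symm
    have hwb : w ≠ b := fun h => hb.2 h.symm
    refine ⟨Insert.insert s(w, b) (Insert.insert s(w, a) S), ?_,
      hi.insert_two hwS (hp.area_ne w a b hwa hwb hab), ?_, ?_⟩
    · rintro e (rfl | rfl | he)
      · exact mk_mem_pairs.2 ⟨hw, hb.1⟩
      · exact mk_mem_pairs.2 ⟨hw, ha.1⟩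
      · exact fun v hv => (hS he v hv).1
    · have := (hr.mono (T := Insert.insert s(w, b) (Insert.insert s(w, a) S))
        (by intro e he; simp [he])).insert hp hab ha hb (c := w)
        (subset_cl _ _ (by simp)) (subset_cl _ _ (by simp))
      rwa [Set.insert_sdiff_singleton, Set.insert_eq_of_mem hw] at this
    · have h1 : s(w, a) ∉ S := fun h => hwS ⟨_, h, by simp⟩
      have h2 : s(w, b) ∉ Insert.insert s(w, a) S := by
        rintro (h | h)
        · exact hab (Sym2.congr_right.1 h).symm
        · exact hwS ⟨_, h, by simp⟩
      rw [Set.ncard_insert_of_notMem h2, Set.ncard_insert_of_notMem h1]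
      omega

lemma Ind.ncard_add_three_le {S : Set (Sym2 V)} (hp : GenPos p) (h : Ind p S) {X : Set V}
    (hX : 2 ≤ X.ncard) (hS : S ⊆ pairs X) : S.ncard + 3 ≤ 2 * X.ncard := by
  obtain ⟨T, -, -, hr, hc⟩ := exists_ind_rig hp hX
  have := ind_ncard_le h (hS.trans hr)
  omega

lemma Rig.le_ncard_add_three {S : Set (Sym2 V)} (hp : GenPos p) {X : Set V}
    (h : Rig p S X) (hX : 2 ≤ X.ncard) : 2 * X.ncard ≤ S.ncard + 3 := by
  obtain ⟨T, hT, hi, -, hc⟩ := exists_ind_rig hp hX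
  have := ind_ncard_le hi (hT.trans h)
  omega

lemma two_le_ncard_of_mem {X : Set V} {e : Sym2 V} (hd : ¬ e.IsDiag) (he : e ∈ pairs X) :
    2 ≤ X.ncard := by
  induction e with | _ a b =>
    have hab : a ≠ b := by simpa using hd
    rw [← Set.ncard_pair hab]
    refine Set.ncard_le_ncard ?_
    have := mk_mem_pairs.1 he
    rintro v (rfl | rfl)
    exacts [this.1, this.2]

lemma Ind.not_isDiag {S : Set (Sym2 V)} (h : Ind p S) {e : Sym2 V} (he : e ∈ S) :
    ¬ e.IsDiag := by
  intro hd
  have h0 : Ind p (Insert.insert e ∅) := h.mono (by simpa using he)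
  exact ((ind_insert (by simp)).1 h0).2 (diag_mem_cl _ _ hd)

lemma Circ.three_le_nb {C : Set (Sym2 V)} (hp : GenPos p) (hC : Circ p C)
    (hd : ∀ e ∈ C, ¬ e.IsDiag) {w : V} (hw : w ∈ vertexSpan C) : 3 ≤ (nb C w).ncard := by
  by_contra! hlt
  obtain ⟨x, hx⟩ := mem_vertexSpan_iff_nb.1 hw
  have hS : Ind p (away C w) := hC.ind_of_ssubset ((away_subset C w).ssubset_of_ne (by
    intro h
    have : s(w, x) ∈ away C w := by rw [h]; exact hx
    exact this.2 (by simp)))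
  have hpos : 0 < (nb C w).ncard := (Set.ncard_pos).2 ⟨x, hx⟩
  have hwS := notMem_vertexSpan_away C w
  apply hC.not_ind
  rw [← away_union_star C w]
  obtain h1 | h1 : (nb C w).ncard = 1 ∨ (nb C w).ncard = 2 := by omega
  · obtain ⟨y, hy⟩ := Set.ncard_eq_one.1 h1
    have hwy : w ≠ y := ne_of_mem_nb hd (hy ▸ rfl)
    rw [hy, Set.image_singleton, Set.union_singleton]
    exact hS.insert_one hwS ⟨0, hp.coord_ne w y hwy 0⟩
  · obtain ⟨y, z, hyz, hn⟩ := Set.ncard_eq_two.1 h1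
    have hwy : w ≠ y := ne_of_mem_nb hd (hn ▸ by simp)
    have hwz : w ≠ z := ne_of_mem_nb hd (hn ▸ by simp)
    have := hS.insert_two hwS (hp.area_ne w y z hwy hwz hyz)
    rw [hn]
    convert this using 1
    ext e
    simp only [Set.image_pair, Set.mem_union, Set.mem_insert_iff, Set.mem_singleton_iff]
    tauto

/-- The generic 1-extension: a pair that is not yet controlled can be replaced by a vertex of
degree three. -/
lemma Generic.ind_one_extension (hp : Generic p) {S : Set (Sym2 V)} (hS : Ind p S) {w x y z : V}
    (hw : w ∉ vertexSpan S) (hwx : x ≠ w) (hwy : y ≠ w) (hwz : z ≠ w)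
    (hxy : x ≠ y) (hxz : x ≠ z) (hyz : y ≠ z) (h : s(x, y) ∉ Cl p S) :
    Ind p (S ∪ {s(w, x), s(w, y), s(w, z)}) := by
  classical
  obtain ⟨μ, hμ, hxyμ⟩ : ∃ μ, (∀ f ∈ S, row p f μ = 0) ∧ row p s(x, y) μ ≠ 0 := by
    simpa [Cl] using h
  set p' := Function.update p w ![(p x 0 + p y 0) / 2, (p x 1 + p y 1) / 2] with hp'
  have hrow : ∀ e ∈ S, row p e = row p' e := fun e he =>
    (row_placement_update_of_notMem (fun hwe => hw ⟨e, he, hwe⟩) _).symm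
  have hS' : Ind p' S := (ind_congr hrow).1 hS
  refine hp.ind (hS'.insert_three hw hwx hwy hwz (μ := μ) (fun f hf => by rw [← hrow f hf, hμ f hf]) ?_)
  have hx : p' x = p x := Function.update_of_ne hwx _ _
  have hy : p' y = p y := Function.update_of_ne hwy _ _
  have hz : p' z = p z := Function.update_of_ne hwz _ _
  have hw0 : p' w 0 = (p x 0 + p y 0) / 2 := by simp [hp']
  have hw1 : p' w 1 = (p x 1 + p y 1) / 2 := by simp [hp']
  have key : obst p' μ w x y z = - (area p x y z / 4) * row p s(x, y) μ := by
    rw [row_mk, obst]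
    simp only [area, hx, hy, hz, hw0, hw1]
    ring
  rw [key]
  exact mul_ne_zero (neg_ne_zero.2 (div_ne_zero (hp.genPos.area_ne x y z hxy hxz hyz) (by norm_num)))
    hxyμ

lemma Circ.away_ind {C : Set (Sym2 V)} (hC : Circ p C) {w x : V} (hx : x ∈ nb C w) :
    Ind p (away C w) := hC.ind_of_ssubset ((away_subset C w).ssubset_of_ne (by
    intro h
    have : s(w, x) ∈ away C w := by rw [h]; exact hx
    exact this.2 (by simp)))

lemma Circ.pair_mem_cl_away (hp : Generic p) {C : Set (Sym2 V)} (hC : Circ p C)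
    (hd : ∀ e ∈ C, ¬ e.IsDiag) {w x y z : V} (hn : nb C w = {x, y, z})
    (hxy : x ≠ y) (hxz : x ≠ z) (hyz : y ≠ z) :
    s(x, y) ∈ Cl p (away C w) ∧ s(x, z) ∈ Cl p (away C w) ∧ s(y, z) ∈ Cl p (away C w) := by
  have hx : x ∈ nb C w := by simp [hn]
  have hwx : x ≠ w := (ne_of_mem_nb hd hx).symm
  have hwy : y ≠ w := (ne_of_mem_nb hd (x := y) (by simp [hn])).symm
  have hwz : z ≠ w := (ne_of_mem_nb hd (x := z) (by simp [hn])).symm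
  have hi := hC.away_ind hx
  have hw := notMem_vertexSpan_away C w
  have hC' : C = away C w ∪ {s(w, x), s(w, y), s(w, z)} := by
    conv_lhs => rw [← away_union_star C w, hn]
    simp [Set.image_insert_eq]
  refine ⟨?_, ?_, ?_⟩ <;> by_contra hcl <;> apply hC.not_ind <;> rw [hC']
  · exact hp.ind_one_extension hi hw hwx hwy hwz hxy hxz hyz hcl
  · convert hp.ind_one_extension hi hw hwx hwz hwy hxz hxy hyz.symm hcl using 2
    ext e; simp only [Set.mem_insert_iff, Set.mem_singleton_iff]; tauto
  · convert hp.ind_one_extension hi hw hwy hwz hwx hyz hxy.symm hxz.symm hcl using 2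
    ext e; simp only [Set.mem_insert_iff, Set.mem_singleton_iff]; tauto

lemma star_eq_of_nb {C : Set (Sym2 V)} {w x y z : V} (hn : nb C w = {x, y, z}) :
    away C w ∪ {s(w, x), s(w, y), s(w, z)} = C := by
  conv_rhs => rw [← away_union_star C w, hn]
  simp [Set.image_insert_eq]

lemma Circ.exists_degree_three {C : Set (Sym2 V)} (hp : GenPos p) (hC : Circ p C)
    (hd : ∀ e ∈ C, ¬ e.IsDiag) : ∃ w ∈ vertexSpan C, (nb C w).ncard = 3 := by
  classical
  have := Fintype.ofFinite V
  obtain ⟨e0, he0⟩ : C.Nonempty := by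
    rw [Set.nonempty_iff_ne_empty]
    rintro rfl
    exact hC.not_ind (Ind.empty p)
  have hsub := subset_pairs_vertexSpan C
  have h2 := two_le_ncard_of_mem (hd _ he0) (hsub he0)
  have h1 := (hC.ind_diff he0).ncard_add_three_le hp h2 (Set.sdiff_subset.trans hsub)
  rw [Set.ncard_sdiff_singleton_of_mem he0] at h1
  have hpos : 0 < C.ncard := (Set.ncard_pos (Set.toFinite _)).2 ⟨e0, he0⟩
  by_contra! hcon
  have hsum := sum_nb_ncard hd (vertexSpan C).toFinset
  have h3 : ∀ w ∈ (vertexSpan C).toFinset, 4 ≤ (nb C w).ncard := by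
    intro w hw
    rw [Set.mem_toFinset] at hw
    have := hC.three_le_nb hp hd hw
    have := hcon w hw
    omega
  have h4 := Finset.sum_le_sum h3
  rw [hsum] at h4
  have h5 : {e ∈ C | ∃ w ∈ e, w ∈ (vertexSpan C).toFinset}.ncard ≤ C.ncard :=
    Set.ncard_le_ncard (Set.sep_subset _ _)
  have h6 : {e ∈ C | ∀ w ∈ e, w ∈ (vertexSpan C).toFinset}.ncard ≤ C.ncard :=
    Set.ncard_le_ncard (Set.sep_subset _ _)
  rw [Finset.sum_const, smul_eq_mul, ← Set.ncard_eq_toFinset_card'] at h4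
  omega

lemma Circ.two_le_ncard {C : Set (Sym2 V)} (hC : Circ p C) (hp : GenPos p)
    {e : Sym2 V} (he : e ∈ C) (hd : ¬ e.IsDiag) : 2 ≤ C.ncard := by
  by_contra! hlt
  have hpos : 0 < C.ncard := (Set.ncard_pos (Set.toFinite _)).2 ⟨e, he⟩
  obtain ⟨f, rfl⟩ := Set.ncard_eq_one.1 (show C.ncard = 1 by omega)
  obtain rfl : e = f := he
  induction e with | _ a b =>
    have := (Ind.empty p).insert_one (w := a) (x := b) (by simp [vertexSpan])
        ⟨0, hp.coord_ne a b (by simpa using hd) 0⟩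
    exact hC.not_ind (by simpa using this)

lemma Circ.forall_not_isDiag {C : Set (Sym2 V)} (hC : Circ p C) (hp : GenPos p)
    {e : Sym2 V} (he : e ∈ C) (hd : ¬ e.IsDiag) : ∀ f ∈ C, ¬ f.IsDiag :=
  fun _ hf => hC.not_isDiag (hC.two_le_ncard hp he hd) hf

/-- Generic circuits in the plane are rigid. -/
lemma Circ.rig (hp : Generic p) {C : Set (Sym2 V)} (hC : Circ p C)
    (hd : ∀ e ∈ C, ¬ e.IsDiag) : Rig p C (vertexSpan C) := by
  induction hN : C.ncard using Nat.strong_induction_on generalizing C with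
  | _ N ih =>
  subst hN
  have hg := hp.genPos
  obtain ⟨w, hw, hdeg⟩ := hC.exists_degree_three hg hd
  obtain ⟨x, y, z, hxy, hxz, hyz, hn⟩ := exists_triple_of_ncard_eq_three hdeg
  obtain ⟨h1, h2, h3⟩ := hC.pair_mem_cl_away hp hd hn hxy hxz hyz
  have hstar := star_eq_of_nb hn
  have hwS := notMem_vertexSpan_away C w
  have key : ∀ a b, a ≠ b → s(a, b) ∈ Cl p (away C w) → ∃ S ⊆ away C w, ∃ Y, Rig p S Y ∧
      a ∈ Y ∧ b ∈ Y ∧ vertexSpan S ⊆ Y := by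
    intro a b hab hcl
    by_cases hmem : s(a, b) ∈ away C w
    · refine ⟨{s(a, b)}, by simpa using hmem, {a, b}, Rig.pair p (subset_cl _ _ rfl), by simp,
        by simp, ?_⟩
      rintro v ⟨e, rfl, hv⟩
      simpa using hv
    · obtain ⟨D, hDs, hD, hDe⟩ := exists_circ_of_mem_cl hcl hmem
      have hDd := hD.forall_not_isDiag hg hDe (by simpa using hab)
      have hlt : D.ncard < C.ncard := by
        have e1 : D.ncard ≤ (away C w).ncard + 1 :=
          (Set.ncard_le_ncard hDs).trans (Set.ncard_insert_le _ _)
        have e2 : (away C w).ncard + 3 = C.ncard := by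
          have hdisj : Disjoint (away C w) {s(w, x), s(w, y), s(w, z)} := by
            rw [Set.disjoint_left]
            rintro e he (rfl | rfl | rfl) <;> exact he.2 (by simp)
          conv_rhs => rw [← hstar]
          rw [Set.ncard_union_eq hdisj, Set.ncard_eq_three.2 ⟨s(w, x), s(w, y), s(w, z),
            fun h => hxy (Sym2.congr_right.1 h), fun h => hxz (Sym2.congr_right.1 h),
            fun h => hyz (Sym2.congr_right.1 h), rfl⟩]
        omega
      have hr := ih _ hlt hD hDd rfl
      refine ⟨D \ {s(a, b)}, ?_, vertexSpan D, hr.trans ?_, ⟨_, hDe, by simp⟩, ⟨_, hDe, by simp⟩,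
        vertexSpan_mono Set.sdiff_subset⟩
      · rintro e ⟨he, hne⟩
        exact (hDs he).resolve_left hne
      · intro e he
        by_cases hee : e = s(a, b)
        · rw [hee]; exact hD.mem_cl (hee ▸ hDe)
        · exact subset_cl _ _ ⟨he, hee⟩
  obtain ⟨S1, hS1, Y1, hr1, hx1, hy1, hv1⟩ := key x y hxy h1
  obtain ⟨S2, hS2, Y2, hr2, hx2, hz2, hv2⟩ := key x z hxz h2
  obtain ⟨S3, hS3, Y3, hr3, hy3, hz3, hv3⟩ := key y z hyz h3
  set S := S1 ∪ S2 ∪ S3 with hSdef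
  have hsub1 : S1 ⊆ S := fun e he => Or.inl (Or.inl he)
  have hsub2 : S2 ⊆ S := fun e he => Or.inl (Or.inr he)
  have hsub3 : S3 ⊆ S := fun e he => Or.inr he
  have ht : Rig p S {x, y, z} := Rig.triple hg hxy ((hr1.mono hsub1).mem hx1 hy1)
    ((hr2.mono hsub2).mem hx2 hz2) ((hr3.mono hsub3).mem hy3 hz3)
  have hall : Rig p S ({x, y, z} ∪ Y1 ∪ Y2 ∪ Y3) :=
    ((ht.union hg (hr1.mono hsub1) hxy (by simp) (by simp) hx1 hy1).union hg (hr2.mono hsub2) hxz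
      (by simp) (by simp) hx2 hz2).union hg (hr3.mono hsub3) hyz (by simp) (by simp) hy3 hz3
  have hSaway : S ⊆ away C w := Set.union_subset (Set.union_subset hS1 hS2) hS3
  have hSw : w ∉ vertexSpan S := fun h => hwS (vertexSpan_mono hSaway h)
  have heq : S ∪ {s(w, x), s(w, y), s(w, z)} = C := by
    refine hC.eq_of_subset ?_ (not_ind_of_triangle hg hSw hxy hxz hyz ht)
    rw [← hstar]
    exact Set.union_subset_union_left _ hSaway
  have hSC : S ⊆ C := heq ▸ Set.subset_union_left
  have hfin := (hall.mono hSC).insert hg hxy (c := w) (by simp) (by simp)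
    (subset_cl _ _ (by rw [← heq]; simp)) (subset_cl _ _ (by rw [← heq]; simp))
  refine hfin.anti ?_
  rintro v ⟨e, he, hv⟩
  rw [← heq] at he
  rcases he with ((he | he) | he) | rfl | rfl | rfl
  · have := hv1 ⟨e, he, hv⟩
    simp [this]
  · have := hv2 ⟨e, he, hv⟩
    simp [this]
  · have := hv3 ⟨e, he, hv⟩
    simp [this]
  all_goals
    rw [Sym2.mem_iff] at hv
    rcases hv with rfl | rfl <;> simp

end Rigid

section Algebra

open MvPolynomial

lemma not_algebraicIndependent_of_ncard_lt {ι : Type*} [Finite ι] {d : ι → ℝ} {S : Set ℝ}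
    (hS : S.Finite) (h : ∀ i, d i ∈ Algebra.adjoin ℚ S) (hlt : S.ncard < Nat.card ι) :
    ¬ AlgebraicIndependent ℚ d := by
  intro hd
  have hd' := hd.comp _ (Finite.equivFin ι).symm.injective
  let f : MvPolynomial S ℚ →ₐ[ℚ] ℝ := aeval ((↑) : S → ℝ)
  have hr : f.range = Algebra.adjoin ℚ S := by
    rw [← Algebra.adjoin_range_eq_range_aeval, Subtype.range_coe]
  let d' : Fin (Nat.card ι) → f.range :=
    fun i => ⟨d ((Finite.equivFin ι).symm i), hr ▸ h _⟩
  have hd2 : AlgebraicIndependent ℚ d' :=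
    (f.range.val.algebraicIndependent_iff Subtype.val_injective).1 hd'
  have h1 := hd2.cardinalMk_le_trdeg
  have h2 := trdeg_le_of_surjective f.rangeRestrict f.rangeRestrict_surjective
  have := hS.fintype
  rw [MvPolynomial.trdeg_of_isDomain, Cardinal.lift_id] at h2
  have h3 := h1.trans h2
  rw [Cardinal.mk_fin, Cardinal.mk_fintype, Nat.cast_le, ← Nat.card_eq_fintype_card] at h3
  exact absurd hlt (not_lt.2 h3)

lemma totalDegree_pderiv_lt {ι : Type*} {P : MvPolynomial ι ℚ} {i : ι}
    (h : pderiv i P ≠ 0) : (pderiv i P).totalDegree < P.totalDegree := by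
  classical
  obtain ⟨m, hm, hdeg⟩ := Finset.exists_mem_eq_sup (pderiv i P).support
    (support_nonempty.2 h) fun s => s.sum fun _ e => e
  change (pderiv i P).totalDegree = _ at hdeg
  have hc : coeff (m + Finsupp.single i 1) P ≠ 0 := by
    intro h0
    rw [mem_support_iff, coeff_pderiv, h0, zero_mul] at hm
    exact hm rfl
  have := le_totalDegree (mem_support_iff.2 hc)
  rw [Finsupp.sum_add_index' (by simp) (by simp), Finsupp.sum_single_index rfl] at this
  omega

lemma exists_pderiv_ne_zero {ι : Type*} {P : MvPolynomial ι ℚ} (h : P.totalDegree ≠ 0) :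
    ∃ i, pderiv i P ≠ 0 := by
  classical
  by_contra! h0
  apply h
  rw [totalDegree_eq_zero_iff]
  intro m hm i
  by_contra hmi
  have h1 : coeff (m - Finsupp.single i 1) (pderiv i P) = 0 := by rw [h0 i, coeff_zero]
  have h2 : m - Finsupp.single i 1 + Finsupp.single i 1 = m :=
    tsub_add_cancel_of_le (Finsupp.single_le_iff.2 (Nat.one_le_iff_ne_zero.2 hmi))
  rw [coeff_pderiv, h2] at h1
  rcases mul_eq_zero.1 h1 with h3 | h3
  · exact mem_support_iff.1 hm h3
  · have : (0 : ℚ) < (((m - Finsupp.single i 1 : ι →₀ ℕ) i : ℕ) : ℚ) + 1 := by positivity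
    exact this.ne' h3

lemma exists_relation {ι : Type*} {d : ι → ℝ} (h : ¬ AlgebraicIndependent ℚ d) :
    ∃ P : MvPolynomial ι ℚ, aeval d P = 0 ∧ ∃ i, aeval d (pderiv i P) ≠ 0 := by
  classical
  have hex : ∃ n, ∃ P : MvPolynomial ι ℚ, P.totalDegree = n ∧ P ≠ 0 ∧ aeval d P = 0 := by
    rw [algebraicIndependent_iff] at h
    push Not at h
    obtain ⟨P, h1, h2⟩ := h
    exact ⟨_, P, rfl, h2, h1⟩
  obtain ⟨P, hdeg, hP0, hP⟩ := Nat.find_spec hex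
  refine ⟨P, hP, ?_⟩
  have hne : P.totalDegree ≠ 0 := by
    intro h0
    rw [totalDegree_eq_zero_iff_eq_C] at h0
    rw [h0, aeval_C] at hP
    apply hP0
    rw [h0, (map_eq_zero (algebraMap ℚ ℝ)).1 hP, C_0]
  obtain ⟨i, hi⟩ := exists_pderiv_ne_zero hne
  refine ⟨i, fun h0 => ?_⟩
  exact Nat.find_min hex (m := (pderiv i P).totalDegree)
    (by rw [← hdeg]; exact totalDegree_pderiv_lt hi) ⟨_, rfl, hi, h0⟩

lemma hasDerivAt_aeval {ι : Type*} [Fintype ι] {g : ℝ → ι → ℝ} {g' : ι → ℝ} {t : ℝ}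
    (hg : ∀ i, HasDerivAt (fun s => g s i) (g' i) t) (P : MvPolynomial ι ℚ) :
    HasDerivAt (fun s => aeval (g s) P) (∑ i, aeval (g t) (pderiv i P) * g' i) t := by
  classical
  induction P using MvPolynomial.induction_on with
  | C a => simpa using hasDerivAt_const t ((algebraMap ℚ ℝ) a)
  | add P Q hP hQ =>
    simp only [map_add, add_mul, Finset.sum_add_distrib]
    exact hP.add hQ
  | mul_X P i hP =>
    have := hP.mul (hg i)
    simp only [map_mul, aeval_X]
    refine this.congr_deriv ?_
    simp only [pderiv_mul, map_add, map_mul, aeval_X, pderiv_X, add_mul, Finset.sum_add_distrib,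
      Finset.sum_mul]
    congr 1
    · exact Finset.sum_congr rfl fun j _ => by ring
    · rw [Finset.sum_eq_single i]
      · simp
      · intro j _ hj; simp [Pi.single_eq_of_ne hj.symm]
      · simp

end Algebra

section Stress

variable [Finite V] {p : V → Fin 2 → ℝ}

lemma exists_coordinates (hp : GenPos p) {X : Set V} (hX : 2 ≤ X.ncard) :
    ∃ S : Set ℝ, S.Finite ∧ S.ncard + 3 ≤ 2 * X.ncard ∧
      ∀ e ∈ pairs X, row p e p ∈ Algebra.adjoin ℚ S := by
  classical
  obtain ⟨a, ha, b, hb, hab⟩ := (Set.one_lt_ncard (Set.toFinite X)).1 hX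
  set L := √((p b 0 - p a 0) ^ 2 + (p b 1 - p a 1) ^ 2) with hL
  have hpos : 0 < (p b 0 - p a 0) ^ 2 + (p b 1 - p a 1) ^ 2 := by
    have := sub_ne_zero.2 (hp.coord_ne b a hab.symm 0)
    positivity
  have hLpos : 0 < L := Real.sqrt_pos.2 hpos
  have hLsq : L ^ 2 = (p b 0 - p a 0) ^ 2 + (p b 1 - p a 1) ^ 2 := Real.sq_sqrt hpos.le
  let f : V → ℝ := fun w =>
    ((p w 0 - p a 0) * (p b 0 - p a 0) + (p w 1 - p a 1) * (p b 1 - p a 1)) / L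
  let g : V → ℝ := fun w =>
    ((p w 1 - p a 1) * (p b 0 - p a 0) - (p w 0 - p a 0) * (p b 1 - p a 1)) / L
  have hdist : ∀ w z, row p s(w, z) p = (f w - f z) ^ 2 + (g w - g z) ^ 2 := by
    intro w z
    have h1 : (f w - f z) ^ 2 + (g w - g z) ^ 2 =
        ((p w 0 - p z 0) ^ 2 + (p w 1 - p z 1) ^ 2) *
          ((p b 0 - p a 0) ^ 2 + (p b 1 - p a 1) ^ 2) / L ^ 2 := by
      simp only [f, g]
      field_simp
      ring
    rw [h1, ← hLsq, mul_div_assoc, div_self (by positivity), row_mk]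
    ring
  set Y := X \ {a, b} with hY
  have hYcard : Y.ncard + 2 = X.ncard := by
    have h2 : ({a, b} : Set V) ⊆ X := by rintro w (rfl | rfl) <;> assumption
    have := Set.ncard_sdiff_add_ncard_of_subset h2
    rwa [Set.ncard_pair hab] at this
  refine ⟨insert (f b) (f '' Y ∪ g '' Y), Set.toFinite _, ?_, ?_⟩
  · have h1 := Set.ncard_insert_le (f b) (f '' Y ∪ g '' Y)
    have h2 := Set.ncard_union_le (f '' Y) (g '' Y)
    have h3 := Set.ncard_image_le (f := f) (Set.toFinite Y)
    have h4 := Set.ncard_image_le (f := g) (Set.toFinite Y)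
    omega
  · have hmem : ∀ w ∈ X, f w ∈ Algebra.adjoin ℚ (insert (f b) (f '' Y ∪ g '' Y)) ∧
        g w ∈ Algebra.adjoin ℚ (insert (f b) (f '' Y ∪ g '' Y)) := by
      intro w hw
      by_cases hwa : w = a
      · subst hwa
        have h1 : f w = 0 := by simp [f]
        have h2 : g w = 0 := by simp [g]
        rw [h1, h2]
        exact ⟨zero_mem _, zero_mem _⟩
      by_cases hwb : w = b
      · subst hwb
        have h2 : g w = 0 := by simp [g, mul_comm]
        rw [h2]
        exact ⟨Algebra.subset_adjoin (by simp), zero_mem _⟩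
      have hwY : w ∈ Y := ⟨hw, by simp [hwa, hwb]⟩
      exact ⟨Algebra.subset_adjoin (Or.inr (Or.inl ⟨w, hwY, rfl⟩)),
        Algebra.subset_adjoin (Or.inr (Or.inr ⟨w, hwY, rfl⟩))⟩
    intro e he
    induction e with | _ w z =>
      obtain ⟨hw, hz⟩ := mk_mem_pairs.1 he
      rw [hdist]
      exact add_mem (pow_mem (sub_mem (hmem w hw).1 (hmem z hz).1) 2)
        (pow_mem (sub_mem (hmem w hw).2 (hmem z hz).2) 2)

lemma Circ.two_le_ncard_vertexSpan {C : Set (Sym2 V)} (hC : Circ p C)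
    (hd : ∀ e ∈ C, ¬ e.IsDiag) : 2 ≤ (vertexSpan C).ncard := by
  obtain ⟨e, he⟩ : C.Nonempty := by
    rw [Set.nonempty_iff_ne_empty]
    rintro rfl
    exact hC.not_ind (Ind.empty p)
  exact two_le_ncard_of_mem (hd e he) (subset_pairs_vertexSpan C he)

lemma Circ.le_ncard_add_two (hp : Generic p) {C : Set (Sym2 V)} (hC : Circ p C)
    (hd : ∀ e ∈ C, ¬ e.IsDiag) : 2 * (vertexSpan C).ncard ≤ C.ncard + 2 := by
  obtain ⟨e, he⟩ : C.Nonempty := by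
    rw [Set.nonempty_iff_ne_empty]
    rintro rfl
    exact hC.not_ind (Ind.empty p)
  have hr : Rig p (C \ {e}) (vertexSpan C) := by
    refine (hC.rig hp hd).trans fun f hf => ?_
    by_cases hfe : f = e
    · rw [hfe]; exact hC.mem_cl he
    · exact subset_cl _ _ ⟨hf, hfe⟩
  have := hr.le_ncard_add_three hp.genPos (hC.two_le_ncard_vertexSpan hd)
  have := Set.ncard_sdiff_singleton_add_one he
  omega

lemma hasDerivAt_row (x μ : V → Fin 2 → ℝ) (e : Sym2 V) :
    HasDerivAt (fun t : ℝ => row (x + t • μ) e (x + t • μ)) (2 * row x e μ) 0 := by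
  have h : (fun t : ℝ => row (x + t • μ) e (x + t • μ)) =
      fun t : ℝ => row x e x + t * (2 * row x e μ) + t ^ 2 * row μ e μ := by
    ext t
    induction e with | _ a b =>
      simp only [row_mk, Pi.add_apply, Pi.smul_apply, smul_eq_mul]; ring
  rw [h]
  have h1 := ((hasDerivAt_id (0 : ℝ)).mul_const (2 * row x e μ)).const_add (row x e x)
  have h2 := (hasDerivAt_pow 2 (0 : ℝ)).mul_const (row μ e μ)
  refine (h1.add h2).congr_deriv ?_
  simp

/-- A generic placement of a circuit and any placement with the same edge lengths carry a common
nowhere-vanishing equilibrium stress. -/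
lemma Circ.exists_common_stress (hp : Generic p) {C : Set (Sym2 V)} (hC : Circ p C)
    (hd : ∀ e ∈ C, ¬ e.IsDiag) {q : V → Fin 2 → ℝ} (hq : ∀ e ∈ C, row p e p = row q e q) :
    ∃ l : Sym2 V → ℝ, (∀ e ∈ C, l e ≠ 0) ∧
      (∀ μ, ∑ e ∈ C.toFinite.toFinset, l e * row p e μ = 0) ∧
      ∀ μ, ∑ e ∈ C.toFinite.toFinset, l e * row q e μ = 0 := by
  classical
  have := Fintype.ofFinite C
  obtain ⟨S, hSf, hSc, hS⟩ := exists_coordinates hp.genPos (hC.two_le_ncard_vertexSpan hd)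
  have hle := hC.le_ncard_add_two hp hd
  let d : (V → Fin 2 → ℝ) → C → ℝ := fun x e => row x e x
  have hdep : ¬ AlgebraicIndependent ℚ (d p) := by
    refine not_algebraicIndependent_of_ncard_lt hSf
      (fun e => hS _ (subset_pairs_vertexSpan C e.2)) ?_
    rw [Nat.card_coe_set_eq]
    omega
  obtain ⟨P, hP, i, hi⟩ := exists_relation hdep
  let D : C → MvPolynomial (V × Fin 2) ℚ := fun e =>
    (MvPolynomial.X ((Quot.out e.1).1, 0) - MvPolynomial.X ((Quot.out e.1).2, 0)) ^ 2 +
      (MvPolynomial.X ((Quot.out e.1).1, 1) - MvPolynomial.X ((Quot.out e.1).2, 1)) ^ 2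
  have hD : ∀ x : V → Fin 2 → ℝ,
      (fun e => MvPolynomial.aeval (fun vi : V × Fin 2 => x vi.1 vi.2) (D e)) = d x := by
    intro x
    ext e
    have he : s((Quot.out e.1).1, (Quot.out e.1).2) = e.1 := Quot.out_eq e.1
    simp only [D, d, map_add, map_pow, map_sub, MvPolynomial.aeval_X]
    conv_rhs => rw [← he]
    rw [row_mk]
    ring
  have hall : ∀ x, MvPolynomial.aeval (d x) P = 0 := by
    intro x
    have h1 := hp.genOn.2 (MvPolynomial.bind₁ D P) (by
      rw [MvPolynomial.aeval_bind₁, hD, hP]) x (by simp)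
    rwa [MvPolynomial.aeval_bind₁, hD] at h1
  let l : Sym2 V → ℝ := fun e =>
    if h : e ∈ C then MvPolynomial.aeval (d p) (MvPolynomial.pderiv ⟨e, h⟩ P) else 0
  have hdq : d q = d p := by ext e; exact (hq e e.2).symm
  have hstress : ∀ x, d x = d p → ∀ μ, ∑ e ∈ C.toFinite.toFinset, l e * row x e μ = 0 := by
    intro x hx μ
    have h1 := hasDerivAt_aeval (g := fun t => d (x + t • μ)) (t := 0)
      (fun e => hasDerivAt_row x μ e) P
    simp only [hall] at h1
    have h2 := h1.unique (hasDerivAt_const 0 (0 : ℝ))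
    simp only [zero_smul, add_zero, hx] at h2
    have h3 : ∑ e : C, l e * row x e μ = 0 := by
      have : ∑ e : C, 2 * (l e * row x e μ) = 0 := by
        rw [← h2]
        refine Finset.sum_congr rfl fun e _ => ?_
        simp only [l, e.2, dif_pos]
        ring
      rw [← Finset.mul_sum] at this
      linarith
    rw [← h3]
    exact (Finset.sum_subtype _ (by simp) _)
  have hl : l ≠ 0 := by
    intro h
    apply hi
    have := congrFun h i.1
    simpa [l] using this
  refine ⟨l, fun e he h0 => ?_, hstress p rfl, hstress q hdq⟩
  have hind := hC.ind_diff he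
  have h4 : ∀ f ∈ C, l f = 0 := by
    have h5 := (linearIndepOn_finset_iff (s := (C \ {e}).toFinite.toFinset) (v := row p)).1
      (by rw [Set.Finite.coe_toFinset]; exact hind) l ?_
    · intro f hf
      by_cases hfe : f = e
      · rw [hfe, h0]
      · exact h5 f (by simp [hf, hfe])
    · refine LinearMap.ext fun μ => ?_
      rw [LinearMap.sum_apply, LinearMap.zero_apply, ← hstress p rfl μ]
      refine Finset.sum_subset (by simp) fun f hf hf' => ?_
      have : f = e := by
        by_contra hne
        exact hf' (by simpa [hne] using hf)
      simp [this, h0]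
  exact hi (by have := h4 i i.2; simpa [l] using this)

lemma sum_eq_star {C : Set (Sym2 V)} {w x y z : V} (hn : nb C w = {x, y, z})
    (hxy : x ≠ y) (hxz : x ≠ z) (hyz : y ≠ z) {f : Sym2 V → ℝ} (hf : ∀ e, w ∉ e → f e = 0) :
    ∑ e ∈ C.toFinite.toFinset, f e = f s(w, x) + f s(w, y) + f s(w, z) := by
  classical
  have hstar := star_eq_of_nb hn
  have : ∑ e ∈ ({s(w, x), s(w, y), s(w, z)} : Finset (Sym2 V)), f e =
      f s(w, x) + f s(w, y) + f s(w, z) := by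
    rw [Finset.sum_insert, Finset.sum_pair, add_assoc]
    · exact fun h => hyz (Sym2.congr_right.1 h)
    · simp only [Finset.mem_insert, Finset.mem_singleton, Sym2.congr_right]
      tauto
  rw [← this]
  symm
  refine Finset.sum_subset ?_ fun e he he' => hf e fun hwe => he' ?_
  · intro e he
    rw [Set.Finite.mem_toFinset, ← hstar]
    exact Or.inr (by simpa using he)
  · rw [Set.Finite.mem_toFinset, ← hstar] at he
    rcases he with he | he
    · exact absurd hwe he.2
    · simpa using he

lemma stress_inner {l a0 a1 b0 b1 c0 c1 m n a0' a1' b0' b1' c0' c1' : ℝ} (hm : m ≠ 0)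
    (hl : l ≠ 0) (h0 : l * a0 + m * b0 + n * c0 = 0) (h1 : l * a1 + m * b1 + n * c1 = 0)
    (h0' : l * a0' + m * b0' + n * c0' = 0) (h1' : l * a1' + m * b1' + n * c1' = 0)
    (ha : a0 * a0 + a1 * a1 = a0' * a0' + a1' * a1')
    (hb : b0 * b0 + b1 * b1 = b0' * b0' + b1' * b1')
    (hc : c0 * c0 + c1 * c1 = c0' * c0' + c1' * c1') :
    a0 * b0 + a1 * b1 = a0' * b0' + a1' * b1' := by
  have e0 : n * c0 = -(l * a0 + m * b0) := by linarith
  have e1 : n * c1 = -(l * a1 + m * b1) := by linarith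
  have e0' : n * c0' = -(l * a0' + m * b0') := by linarith
  have e1' : n * c1' = -(l * a1' + m * b1') := by linarith
  have h : (n * c0) ^ 2 + (n * c1) ^ 2 = (n * c0') ^ 2 + (n * c1') ^ 2 := by
    linear_combination n ^ 2 * hc
  rw [e0, e1, e0', e1'] at h
  have h2 : 2 * l * m * (a0 * b0 + a1 * b1 - (a0' * b0' + a1' * b1')) = 0 := by
    linear_combination h - l ^ 2 * ha - m ^ 2 * hb
  have h3 : 2 * l * m ≠ 0 := by positivity
  have := (mul_eq_zero.1 h2).resolve_left h3
  linarith

lemma Circ.row_pair_eq (hp : Generic p) {C : Set (Sym2 V)} (hC : Circ p C)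
    (hd : ∀ e ∈ C, ¬ e.IsDiag) {q : V → Fin 2 → ℝ} (hq : ∀ e ∈ C, row p e p = row q e q)
    {w x y z : V} (hn : nb C w = {x, y, z}) (hxy : x ≠ y) (hxz : x ≠ z) (hyz : y ≠ z) :
    row p s(x, y) p = row q s(x, y) q := by
  classical
  obtain ⟨l, hl, hlp, hlq⟩ := hC.exists_common_stress hp hd hq
  have hx : x ∈ nb C w := by simp [hn]
  have hy : y ∈ nb C w := by simp [hn]
  have hz : z ∈ nb C w := by simp [hn]
  have hxw := (ne_of_mem_nb hd hx).symm
  have hyw := (ne_of_mem_nb hd hy).symm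
  have hzw := (ne_of_mem_nb hd hz).symm
  have key : ∀ r : V → Fin 2 → ℝ, (∀ μ, ∑ e ∈ C.toFinite.toFinset, l e * row r e μ = 0) →
      ∀ i, l s(w, x) * (r w i - r x i) + l s(w, y) * (r w i - r y i) +
        l s(w, z) * (r w i - r z i) = 0 := by
    intro r hr i
    have h := hr (Pi.single w (Pi.single i 1))
    rw [sum_eq_star hn hxy hxz hyz] at h
    · rw [← h]
      fin_cases i <;> simp [Pi.single_eq_of_ne hxw, Pi.single_eq_of_ne hyw,
        Pi.single_eq_of_ne hzw]
    · intro e he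
      rw [row_congr (q := r) (ν := 0) (fun _ _ => rfl), map_zero, mul_zero]
      intro v hv
      refine Pi.single_eq_of_ne (fun h => he ?_) _
      rwa [← h]
  have hA := hq _ hx
  have hB := hq _ hy
  have hCc := hq _ hz
  simp only [row_mk] at hA hB hCc ⊢
  have := stress_inner (hl _ hy) (hl _ hx) (key p hlp 0) (key p hlp 1) (key q hlq 0) (key q hlq 1)
    hA hB hCc
  linarith

end Stress

section Separation

/-- `a` and `b` are separated, in the graph with edge set `H` restricted to `A`, by at most two
vertices; `U` is a side of the separation. -/
def Sep (H : Set (Sym2 V)) (A : Set V) (a b : V) : Prop :=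
  ∃ U S : Set V, U ⊆ A ∧ S ⊆ A ∧ S.ncard ≤ 2 ∧ a ∈ U ∧ b ∈ A ∧ b ∉ U ∧ b ∉ S ∧ Disjoint U S ∧
    ∀ x ∈ U, ∀ y ∈ A, s(x, y) ∈ H → y ∈ U ∨ y ∈ S

lemma Sep.symm {H : Set (Sym2 V)} {A : Set V} {a b : V} (h : Sep H A a b) : Sep H A b a := by
  obtain ⟨U, S, hU, hS, hc, ha, hb, hbU, hbS, hd, hE⟩ := h
  have haS := Set.disjoint_left.1 hd ha
  refine ⟨A \ (U ∪ S), S, Set.sdiff_subset, hS, hc, ⟨hb, by simp [hbU, hbS]⟩, hU ha,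
    fun h => h.2 (Or.inl ha), haS, Set.disjoint_left.2 fun x hx hxS => hx.2 (Or.inr hxS), ?_⟩
  intro x hx y hy hxy
  by_contra! hcon
  have hyU : y ∈ U := by
    by_contra hyU
    exact hcon.1 ⟨hy, by simp [hyU, hcon.2]⟩
  exact hx.2 (hE y hyU x hx.1 (by rwa [Sym2.eq_swap]))

/-- An edge set of a rigid graph on `A` all of whose non-adjacent pairs have small separators. -/
structure Good (p : V → Fin 2 → ℝ) (H : Set (Sym2 V)) (A : Set V) : Prop where
  rig : Rig p (H ∩ pairs A) A
  sep : ∀ a ∈ A, ∀ b ∈ A, s(a, b) ∉ H → Sep H A a b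

variable [Finite V]

/-- The neighbours of a vertex of degree three in a circuit of `H` are pairwise joined in `H`. -/
structure DegreeThreeClosed (p : V → Fin 2 → ℝ) (H : Set (Sym2 V)) : Prop where
  diag : ∀ e : Sym2 V, e.IsDiag → e ∈ H
  pair : ∀ C ⊆ H, Circ p C → (∀ e ∈ C, ¬ e.IsDiag) → ∀ w x y z, nb C w = {x, y, z} →
    x ≠ y → x ≠ z → y ≠ z → s(x, y) ∈ H

variable {p : V → Fin 2 → ℝ} {H : Set (Sym2 V)} {A : Set V}

lemma DegreeThreeClosed.clique (hp : Generic p) (hH : DegreeThreeClosed p H)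
    {T : Set (Sym2 V)} (hT : T ⊆ H) {w x y z : V} (hx : s(w, x) ∈ H) (hcl : s(w, x) ∈ Cl p T)
    (hwx : w ≠ x) (hn : nb T w ⊆ {y, z}) (hxy : x ≠ y) (hxz : x ≠ z) :
    s(x, y) ∈ H ∧ s(x, z) ∈ H ∧ s(y, z) ∈ H := by
  have hxT : s(w, x) ∉ T := fun h => by
    rcases hn h with h | h
    · exact hxy h
    · exact hxz h
  obtain ⟨C, hCT, hC, hxC⟩ := exists_circ_of_mem_cl hcl hxT
  have hd := hC.forall_not_isDiag hp.genPos hxC (by simpa using hwx)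
  have h3 := hC.three_le_nb hp.genPos hd (w := w) ⟨_, hxC, by simp⟩
  have hsub : nb C w ⊆ {x, y, z} := by
    intro v hv
    rcases hCT hv with h | h
    · exact Or.inl (Sym2.congr_right.1 h)
    · exact Or.inr (hn h)
  have hyz : y ≠ z := by
    rintro rfl
    have h1 := Set.ncard_le_ncard hsub
    have h2 : ({x, y, y} : Set V).ncard ≤ 2 := by
      rw [Set.pair_eq_singleton]; exact Set.ncard_insert_le _ _ |>.trans (by simp)
    omega
  have hcard : ({x, y, z} : Set V).ncard = 3 := Set.ncard_eq_three.2 ⟨x, y, z, hxy, hxz, hyz, rfl⟩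
  have heq : nb C w = {x, y, z} := Set.eq_of_subset_of_ncard_le hsub (by omega)
  have hCH : C ⊆ H := hCT.trans (Set.insert_subset hx hT)
  refine ⟨hH.pair C hCH hC hd w x y z heq hxy hxz hyz, hH.pair C hCH hC hd w x z y ?_ hxz hxy hyz.symm,
    hH.pair C hCH hC hd w y z x ?_ hyz hxy.symm hxz.symm⟩
  · rw [heq]; ext; simp; tauto
  · rw [heq]; ext; simp; tauto

lemma Rig.clique (hp : Generic p) (hH : DegreeThreeClosed p H) (hA : Rig p (H ∩ pairs A) A)
    {w a b c : V} (hw : w ∉ A) (ha : a ∈ A) (hb : b ∈ A) (hc : c ∈ A) (hab : a ≠ b) (hac : a ≠ c)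
    (hbc : b ≠ c) (hwa : s(w, a) ∈ H) (hwb : s(w, b) ∈ H) (hwc : s(w, c) ∈ H) : s(a, b) ∈ H := by
  have hrig : Rig p (H ∩ pairs A) {b, c, a} := hA.anti (by
    rintro v (rfl | rfl | rfl) <;> assumption)
  refine (hH.clique hp (T := (H ∩ pairs A) ∪ {s(w, b), s(w, c)}) (w := w) (x := a) (y := b) (z := c)
    ?_ hwa (mem_cl_of_triangle hp.genPos hbc hrig) (fun h => hw (h ▸ ha)) ?_ hab hac).1
  · rintro e (he | rfl | rfl)
    exacts [he.1, hwb, hwc]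
  · rintro v (hv | hv | hv)
    · exact absurd (mk_mem_pairs.1 hv.2).1 hw
    · exact Or.inl (Sym2.congr_right.1 hv)
    · exact Or.inr (Sym2.congr_right.1 hv)

/-- A vertex joined to three vertices of a good set can be added to it. -/
lemma Good.insert (hp : Generic p) (hH : DegreeThreeClosed p H) (hA : Good p H A)
    {w x y z : V} (hw : w ∉ A) (hx : x ∈ A) (hy : y ∈ A) (hz : z ∈ A) (hxy : x ≠ y) (hxz : x ≠ z)
    (hyz : y ≠ z) (hwx : s(w, x) ∈ H) (hwy : s(w, y) ∈ H) (hwz : s(w, z) ∈ H) :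
    Good p H (Insert.insert w A) := by
  have hsubA : A ⊆ Insert.insert w A := Set.subset_insert _ _
  have hclique : ∀ a ∈ A, ∀ b ∈ A, s(w, a) ∈ H → s(w, b) ∈ H → s(a, b) ∈ H := by
    intro a ha b hb hwa hwb
    by_cases hab : a = b
    · exact hH.diag _ (by simpa using hab)
    obtain ⟨c, hc, hca, hcb, hwc⟩ : ∃ c ∈ A, a ≠ c ∧ b ≠ c ∧ s(w, c) ∈ H := by
      by_cases h1 : a ≠ x ∧ b ≠ x
      · exact ⟨x, hx, h1.1, h1.2, hwx⟩
      by_cases h2 : a ≠ y ∧ b ≠ y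
      · exact ⟨y, hy, h2.1, h2.2, hwy⟩
      refine ⟨z, hz, ?_, ?_, hwz⟩ <;> rintro rfl <;> grind
    exact hA.rig.clique hp hH hw ha hb hc hab hca hcb hwa hwb hwc
  have hext : ∀ U S : Set V, U ⊆ A → S ⊆ A → Disjoint U S →
      (∀ x ∈ U, ∀ y ∈ A, s(x, y) ∈ H → y ∈ U ∨ y ∈ S) → ∀ t ∈ U, s(w, t) ∈ H → 
      Insert.insert w U ⊆ Insert.insert w A ∧ S ⊆ Insert.insert w A ∧ Disjoint (Insert.insert w U) S ∧
      ∀ x ∈ Insert.insert w U, ∀ y ∈ Insert.insert w A, s(x, y) ∈ H →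
        y ∈ Insert.insert w U ∨ y ∈ S := by
    intro U S hU hS hd hE t ht hwt
    refine ⟨Set.insert_subset_insert hU, hS.trans hsubA, ?_, ?_⟩
    · rw [Set.disjoint_insert_left]
      exact ⟨fun h => hw (hS h), hd⟩
    · rintro a ha b (rfl | hb) hab
      · exact Or.inl (Or.inl rfl)
      have hgoal : b ∈ U ∨ b ∈ S := by
        rcases ha with rfl | ha
        · exact hE t ht b hb (hclique t (hU ht) b hb hwt hab)
        · exact hE a ha b hb hab
      exact hgoal.imp Or.inr id
  have hsepw : ∀ b ∈ A, s(w, b) ∉ H → Sep H (Insert.insert w A) w b := by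
    intro b hb hwb
    obtain ⟨t, ht, hwt, htb⟩ : ∃ t ∈ A, s(w, t) ∈ H ∧ s(t, b) ∉ H := by
      by_contra! hcon
      have hxb := hcon x hx hwx
      have hyb := hcon y hy hwy
      have hzb := hcon z hz hwz
      have hr0 : Rig p (H ∩ pairs {w, b, y, z}) {y, z} := Rig.pair p (subset_cl _ _
        ⟨hclique y hy z hz hwy hwz, mk_mem_pairs.2 ⟨by simp, by simp⟩⟩)
      have hr1 := hr0.insert hp.genPos hyz (c := b) (by simp) (by simp)
        (subset_cl _ _ ⟨by rwa [Sym2.eq_swap], mk_mem_pairs.2 ⟨by simp, by simp⟩⟩)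
        (subset_cl _ _ ⟨by rwa [Sym2.eq_swap], mk_mem_pairs.2 ⟨by simp, by simp⟩⟩)
      have hr2 := hr1.insert hp.genPos hyz (c := w) (by simp) (by simp)
        (subset_cl _ _ ⟨hwy, mk_mem_pairs.2 ⟨by simp, by simp⟩⟩)
        (subset_cl _ _ ⟨hwz, mk_mem_pairs.2 ⟨by simp, by simp⟩⟩)
      refine hwb (hr2.clique hp hH (w := x) (a := w) (b := b) (c := z) ?_ (by simp) (by simp)
        (by simp) ?_ ?_ ?_ (by rwa [Sym2.eq_swap]) hxb (hclique x hx z hz hwx hwz))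
      · rintro (rfl | rfl | rfl | rfl)
        exacts [hw hx, hwb hwx, hxy rfl, hxz rfl]
      · rintro rfl; exact hw hb
      · rintro rfl; exact hw hz
      · rintro rfl; exact hwb hwz
    obtain ⟨U, S, hU, hS, hc, htU, -, hbU, hbS, hd, hE⟩ := hA.sep t ht b hb htb
    obtain ⟨h1, h2, h3, h4⟩ := hext U S hU hS hd hE t htU hwt
    refine ⟨_, S, h1, h2, hc, by simp, hsubA hb, ?_, hbS, h3, h4⟩
    rintro (rfl | h)
    exacts [hw hb, hbU h]
  refine ⟨?_, ?_⟩
  · have h1 : Rig p (H ∩ pairs (Insert.insert w A)) A :=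
      hA.rig.mono (Set.inter_subset_inter_right _ fun e he v hv => hsubA (he v hv))
    exact h1.insert hp.genPos hxy hx hy
      (subset_cl _ _ ⟨hwx, mk_mem_pairs.2 ⟨by simp, by simp [hx]⟩⟩)
      (subset_cl _ _ ⟨hwy, mk_mem_pairs.2 ⟨by simp, by simp [hy]⟩⟩)
  · rintro a (rfl | ha) b (rfl | hb) hab
    · exact absurd (hH.diag _ (by simp)) hab
    · exact hsepw b hb hab
    · exact (hsepw a ha (by rwa [Sym2.eq_swap])).symm
    · obtain ⟨U, S, hU, hS, hc, haU, -, hbU, hbS, hd, hE⟩ := hA.sep a ha b hb hab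
      by_cases hex : ∃ t ∈ U, s(w, t) ∈ H
      · obtain ⟨t, ht, hwt⟩ := hex
        obtain ⟨h1, h2, h3, h4⟩ := hext U S hU hS hd hE t ht hwt
        refine ⟨_, S, h1, h2, hc, by simp [haU], hsubA hb, ?_, hbS, h3, h4⟩
        rintro (rfl | h)
        exacts [hw hb, hbU h]
      · push Not at hex
        refine ⟨U, S, hU.trans hsubA, hS.trans hsubA, hc, haU, hsubA hb, hbU, hbS, hd, ?_⟩
        rintro s hs r (rfl | hr) hsr
        · exact absurd (by rwa [Sym2.eq_swap]) (hex s hs)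
        · exact hE s hs r hr hsr

/-- Two adjacent vertices with the same two adjacent neighbours in a good set can be added. -/
lemma Good.insert_pair (hp : Generic p) (hH : DegreeThreeClosed p H) (hA : Good p H A)
    {w z x y : V} (hw : w ∉ A) (hz : z ∉ A) (hx : x ∈ A) (hy : y ∈ A) (hxy : x ≠ y)
    (hwx : s(w, x) ∈ H) (hwy : s(w, y) ∈ H) (hzx : s(z, x) ∈ H) (hzy : s(z, y) ∈ H)
    (hxyH : s(x, y) ∈ H) (hwzH : s(w, z) ∈ H) (hnw : ∀ v ∈ A, s(w, v) ∈ H → v = x ∨ v = y)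
    (hnz : ∀ v ∈ A, s(z, v) ∈ H → v = x ∨ v = y) :
    Good p H (Insert.insert w (Insert.insert z A)) := by
  have hsubA : A ⊆ Insert.insert w (Insert.insert z A) :=
    (Set.subset_insert _ _).trans (Set.subset_insert _ _)
  have hsepw : ∀ c, c = w ∨ c = z → ∀ b ∈ A, s(c, b) ∉ H →
      Sep H (Insert.insert w (Insert.insert z A)) c b := by
    intro c hc b hb hcb
    have hbx : b ≠ x := by
      rintro rfl
      rcases hc with rfl | rfl
      exacts [hcb hwx, hcb hzx]
    have hby : b ≠ y := by
      rintro rfl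
      rcases hc with rfl | rfl
      exacts [hcb hwy, hcb hzy]
    refine ⟨{w, z}, {x, y}, ?_, ?_, by rw [Set.ncard_pair hxy], hc, hsubA hb, ?_, ?_, ?_, ?_⟩
    · rintro v (rfl | rfl) <;> simp
    · rintro v (rfl | rfl)
      exacts [hsubA hx, hsubA hy]
    · rintro (rfl | rfl)
      exacts [hw hb, hz hb]
    · rintro (h | h)
      exacts [hbx h, hby h]
    · rw [Set.disjoint_left]
      rintro v (rfl | rfl) (rfl | rfl) <;> contradiction
    · rintro s (rfl | rfl) r (rfl | rfl | hr) hsr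
      · simp
      · simp
      · exact Or.inr (hnw r hr hsr)
      · simp
      · simp
      · exact Or.inr (hnz r hr hsr)
  refine ⟨?_, ?_⟩
  · have h1 : Rig p (H ∩ pairs (Insert.insert w (Insert.insert z A))) A :=
      hA.rig.mono (Set.inter_subset_inter_right _ fun e he v hv => hsubA (he v hv))
    have h2 := h1.insert hp.genPos hxy hx hy (c := z)
      (subset_cl _ _ ⟨hzx, mk_mem_pairs.2 ⟨by simp, by simp [hx]⟩⟩)
      (subset_cl _ _ ⟨hzy, mk_mem_pairs.2 ⟨by simp, by simp [hy]⟩⟩)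
    exact h2.insert hp.genPos hxy (Or.inr hx) (Or.inr hy)
      (subset_cl _ _ ⟨hwx, mk_mem_pairs.2 ⟨by simp, by simp [hx]⟩⟩)
      (subset_cl _ _ ⟨hwy, mk_mem_pairs.2 ⟨by simp, by simp [hy]⟩⟩)
  · have hAA : ∀ a ∈ A, ∀ b ∈ A, s(a, b) ∉ H →
        Sep H (Insert.insert w (Insert.insert z A)) a b := by
      intro a ha b hb hab
      obtain ⟨U, S, hU, hS, hc, haU, -, hbU, hbS, hd, hE⟩ := hA.sep a ha b hb hab
      by_cases hex : x ∈ U ∨ y ∈ U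
      · have hxy' : ∀ v, v = x ∨ v = y → v ∈ U ∨ v ∈ S := by
          rintro v (rfl | rfl)
          · rcases hex with h | h
            · exact Or.inl h
            · exact hE _ h _ hx (by rwa [Sym2.eq_swap])
          · rcases hex with h | h
            · exact hE _ h _ hy hxyH
            · exact Or.inl h
        refine ⟨Insert.insert w (Insert.insert z U), S, ?_, hS.trans hsubA, hc, by simp [haU],
          hsubA hb, ?_, hbS, ?_, ?_⟩
        · exact Set.insert_subset_insert (Set.insert_subset_insert hU)
        · rintro (rfl | rfl | h)
          exacts [hw hb, hz hb, hbU h]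
        · rw [Set.disjoint_insert_left, Set.disjoint_insert_left]
          exact ⟨fun h => hw (hS h), fun h => hz (hS h), hd⟩
        · rintro s hs r (rfl | rfl | hr) hsr
          · simp
          · simp
          have : r ∈ U ∨ r ∈ S := by
            rcases hs with rfl | rfl | hs
            · exact hxy' r (hnw r hr hsr)
            · exact hxy' r (hnz r hr hsr)
            · exact hE s hs r hr hsr
          exact this.imp (fun h => Or.inr (Or.inr h)) id
      · refine ⟨U, S, hU.trans hsubA, hS.trans hsubA, hc, haU, hsubA hb, hbU, hbS, hd, ?_⟩
        rintro s hs r (rfl | rfl | hr) hsr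
        · rcases hnw s (hU hs) (by rwa [Sym2.eq_swap]) with rfl | rfl
          exacts [absurd (Or.inl hs) hex, absurd (Or.inr hs) hex]
        · rcases hnz s (hU hs) (by rwa [Sym2.eq_swap]) with rfl | rfl
          exacts [absurd (Or.inl hs) hex, absurd (Or.inr hs) hex]
        · exact hE s hs r hr hsr
    rintro a (rfl | rfl | ha) b (rfl | rfl | hb) hab
    · exact absurd (hH.diag _ (by simp)) hab
    · exact absurd hwzH hab
    · exact hsepw _ (Or.inl rfl) b hb hab
    · exact absurd (by rwa [Sym2.eq_swap]) hab
    · exact absurd (hH.diag _ (by simp)) hab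
    · exact hsepw _ (Or.inr rfl) b hb hab
    · exact (hsepw _ (Or.inl rfl) a ha (by rwa [Sym2.eq_swap])).symm
    · exact (hsepw _ (Or.inr rfl) a ha (by rwa [Sym2.eq_swap])).symm
    · exact hAA a ha b hb hab

end Separation

section Covering

variable [Finite V] {p : V → Fin 2 → ℝ} {H : Set (Sym2 V)} {A : Set V}

lemma two_le_ncard_vertexSpan_inter {C : Set (Sym2 V)} {e : Sym2 V} (he : e ∈ C)
    (heA : e ∈ pairs A) (hd : ¬ e.IsDiag) : 2 ≤ (vertexSpan C ∩ A).ncard :=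
  two_le_ncard_of_mem hd fun v hv => ⟨⟨e, he, hv⟩, heA v hv⟩

/-- A circuit, joining edges inside `A` to edges outside `A`, with few edges outside `A`. -/
structure Crossing (p : V → Fin 2 → ℝ) (H : Set (Sym2 V)) (A : Set V) (C : Set (Sym2 V)) :
    Prop where
  circ : Circ p C
  diag : ∀ e ∈ C, ¬ e.IsDiag
  sub : C ⊆ H ∪ pairs A
  not_sub : ¬ C ⊆ pairs A
  two_le : 2 ≤ (vertexSpan C ∩ A).ncard

lemma Crossing.exists_minimal {C : Set (Sym2 V)} (h : Crossing p H A C) :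
    ∃ C, Crossing p H A C ∧ ∀ D, Crossing p H A D → (C \ pairs A).ncard ≤ (D \ pairs A).ncard := by
  classical
  have hex : ∃ n, ∃ C, Crossing p H A C ∧ (C \ pairs A).ncard = n := ⟨_, C, h, rfl⟩
  obtain ⟨C, hC, hn⟩ := Nat.find_spec hex
  exact ⟨C, hC, fun D hD => hn ▸ Nat.find_min' hex ⟨D, hD, rfl⟩⟩

lemma Crossing.rig (hp : Generic p) {C : Set (Sym2 V)} (hC : Crossing p H A C)
    (hmin : ∀ D, Crossing p H A D → (C \ pairs A).ncard ≤ (D \ pairs A).ncard) :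
    Rig p (C ∩ pairs A) (vertexSpan C ∩ A) := by
  intro g hg
  by_contra hgc
  have hgd : ¬ g.IsDiag := fun h => hgc (diag_mem_cl p _ h)
  have hgA : g ∈ pairs A := fun v hv => (hg v hv).2
  have hgC : g ∉ C := fun h => hgc (subset_cl _ _ ⟨h, hgA⟩)
  obtain ⟨d, hdC, hdA⟩ := Set.not_subset.1 hC.not_sub
  have hgcl : g ∈ Cl p (C \ {d}) := by
    have h1 : g ∈ Cl p C := hC.circ.rig hp hC.diag fun v hv => (hg v hv).1
    refine cl_subset_cl (fun e he => ?_) h1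
    by_cases hed : e = d
    · rw [hed]; exact hC.circ.mem_cl hdC
    · exact subset_cl _ _ ⟨he, hed⟩
  obtain ⟨D, hDs, hD, hgD⟩ := exists_circ_of_mem_cl hgcl fun h => hgC h.1
  have hDd := hD.forall_not_isDiag hp.genPos hgD hgd
  have hcross : Crossing p H A D := by
    refine ⟨hD, hDd, ?_, ?_, two_le_ncard_vertexSpan_inter hgD hgA hgd⟩
    · intro e he
      rcases hDs he with rfl | h
      exacts [Or.inr hgA, hC.sub h.1]
    · intro hsub
      refine hgc (cl_mono p (fun e he => ?_) (hD.mem_cl hgD))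
      exact ⟨((hDs he.1).resolve_left he.2).1, hsub he.1⟩
  have h1 := hmin D hcross
  have h2 : (D \ pairs A) ⊆ (C \ pairs A) \ {d} := by
    rintro e ⟨he, heA⟩
    rcases hDs he with rfl | h
    · exact absurd hgA heA
    · exact ⟨⟨h.1, heA⟩, h.2⟩
  have h3 := Set.ncard_le_ncard h2
  have h4 := Set.ncard_sdiff_singleton_add_one (show d ∈ C \ pairs A from ⟨hdC, hdA⟩)
  omega

lemma Crossing.one_le_ncard (hp : Generic p) {C : Set (Sym2 V)} (hC : Crossing p H A C)
    (hr : Rig p (C ∩ pairs A) (vertexSpan C ∩ A)) : 1 ≤ (C ∩ pairs A).ncard := by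
  have := hr.le_ncard_add_three hp.genPos hC.two_le
  have := hC.two_le
  omega

lemma Crossing.exists_degree_three (hp : Generic p) {C : Set (Sym2 V)} (hC : Crossing p H A C)
    (hr : Rig p (C ∩ pairs A) (vertexSpan C ∩ A)) :
    ∃ w ∉ A, (nb C w).ncard = 3 := by
  classical
  have := Fintype.ofFinite V
  have h1 := hr.le_ncard_add_three hp.genPos hC.two_le
  have h2 := hC.one_le_ncard hp hr
  have h3 := hC.two_le
  obtain ⟨j, hj⟩ := (Set.ncard_pos (Set.toFinite _)).1 h2
  by_contra! hcon
  set X := vertexSpan C \ A with hX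
  have h4 : ∀ w ∈ X.toFinset, 4 ≤ (nb C w).ncard := by
    intro w hw
    rw [Set.mem_toFinset] at hw
    have := hC.circ.three_le_nb hp.genPos hC.diag hw.1
    have := hcon w hw.2
    omega
  have h5 := Finset.sum_le_sum h4
  rw [Finset.sum_const, smul_eq_mul, sum_nb_ncard hC.diag, ← Set.ncard_eq_toFinset_card'] at h5
  have h6 : {e ∈ C | ∃ w ∈ e, w ∈ X.toFinset} ⊆ C \ pairs A := by
    rintro e ⟨he, w, hw, hwX⟩
    rw [Set.mem_toFinset] at hwX
    exact ⟨he, fun h => hwX.2 (h w hw)⟩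
  have h7 : {e ∈ C | ∀ w ∈ e, w ∈ X.toFinset} ⊆ C \ {j} := by
    rintro e ⟨he, h⟩
    refine ⟨he, ?_⟩
    rintro rfl
    induction e with | _ a b =>
      have := h a (by simp)
      rw [Set.mem_toFinset] at this
      exact this.2 (hj.2 a (by simp))
  have h8 := Set.ncard_le_ncard h6
  have h9 := Set.ncard_inter_add_ncard_sdiff_eq_ncard C (pairs A)
  have h10 := Set.ncard_inter_add_ncard_sdiff_eq_ncard (vertexSpan C) A
  rw [← hX] at h10
  have h11 : C.ncard + 2 ≤ 2 * (vertexSpan C).ncard := by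
    have h := (hC.circ.ind_diff hj.1).ncard_add_three_le hp.genPos
      (hC.circ.two_le_ncard_vertexSpan hC.diag)
      (Set.sdiff_subset.trans (subset_pairs_vertexSpan C))
    have := Set.ncard_sdiff_singleton_add_one hj.1
    omega
  have hXpos : 1 ≤ X.ncard := by
    obtain ⟨d, hdC, hdA⟩ := Set.not_subset.1 hC.not_sub
    obtain ⟨v, hv, hvA⟩ : ∃ v ∈ d, v ∉ A := by
      by_contra! h
      exact hdA h
    exact (Set.ncard_pos (Set.toFinite _)).2 ⟨v, ⟨d, hdC, hv⟩, hvA⟩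
  by_cases hX2 : 2 ≤ X.ncard
  · have h12 := ((hC.circ.ind_diff hj.1).mono h7).ncard_add_three_le hp.genPos hX2 (by
      rintro e ⟨-, h⟩ v hv
      simpa using h v hv)
    omega
  · have h12 : {e ∈ C | ∀ w ∈ e, w ∈ X.toFinset} = ∅ := by
      rw [Set.eq_empty_iff_forall_notMem]
      rintro e ⟨he, h⟩
      exact hX2 (two_le_ncard_of_mem (hC.diag e he) fun v hv => by simpa using h v hv)
    rw [h12, Set.ncard_empty] at h5
    omega

/-- If a good set can neither be extended by a vertex with three neighbours, nor by a suitable pair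
of vertices, then it is not crossed by a circuit. -/
lemma Good.not_crossing (hp : Generic p) (hH : DegreeThreeClosed p H) (hA : Good p H A)
    (h1 : ∀ w ∉ A, ∀ x ∈ A, ∀ y ∈ A, ∀ z ∈ A, x ≠ y → x ≠ z → y ≠ z →
      s(w, x) ∈ H → s(w, y) ∈ H → s(w, z) ∈ H → False)
    (h2 : ∀ w ∉ A, ∀ z ∉ A, ∀ x ∈ A, ∀ y ∈ A, w ≠ z → x ≠ y → s(w, x) ∈ H → s(w, y) ∈ H →
      s(z, x) ∈ H → s(z, y) ∈ H → s(x, y) ∈ H → s(w, z) ∈ H → False)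
    (C : Set (Sym2 V)) : ¬ Crossing p H A C := by
  intro hC0
  obtain ⟨C, hC, hmin⟩ := hC0.exists_minimal
  have hr := hC.rig hp hmin
  obtain ⟨w, hw, hdeg⟩ := hC.exists_degree_three hp hr
  obtain ⟨x, y, z, hxy, hxz, hyz, hn⟩ := exists_triple_of_ncard_eq_three hdeg
  have hx : x ∈ nb C w := by simp [hn]
  have hy : y ∈ nb C w := by simp [hn]
  have hz : z ∈ nb C w := by simp [hn]
  have hHw : ∀ v ∈ nb C w, s(w, v) ∈ H := fun v hv =>
    (hC.sub hv).resolve_right fun h => hw (mk_mem_pairs.1 h).1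
  have hclique : s(x, y) ∈ H ∧ s(x, z) ∈ H ∧ s(y, z) ∈ H := by
    refine hH.clique hp (T := ((C \ pairs A) \ {s(w, x)}) ∪ (H ∩ pairs A)) (w := w) ?_
      (hHw x hx) ?_ (ne_of_mem_nb hC.diag hx) ?_ hxy hxz
    · rintro e (⟨⟨he, heA⟩, -⟩ | he)
      exacts [(hC.sub he).resolve_right heA, he.1]
    · refine cl_subset_cl ?_ (hC.circ.mem_cl hx)
      rintro e ⟨he, hne⟩
      by_cases heA : e ∈ pairs A
      · exact cl_mono p Set.subset_union_right (hA.rig heA)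
      · exact subset_cl _ _ (Or.inl ⟨⟨he, heA⟩, hne⟩)
    · rintro v (⟨⟨hv, -⟩, hne⟩ | hv)
      · have : v ∈ nb C w := hv
        rw [hn] at this
        exact this.resolve_left fun h => hne (by rw [h]; rfl)
      · exact absurd (mk_mem_pairs.1 hv.2).1 hw
  obtain ⟨hxyH, hxzH, hyzH⟩ := hclique
  have hpair : ∀ g, g = s(x, y) ∨ g = s(x, z) ∨ g = s(y, z) → g ∉ pairs A →
      g ∈ Cl p (away (C \ pairs A) w) := by
    intro g hg hgA
    have hcl := hC.circ.pair_mem_cl_away hp hC.diag hn hxy hxz hyz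
    have hgcl : g ∈ Cl p (away C w) := by
      rcases hg with rfl | rfl | rfl
      exacts [hcl.1, hcl.2.1, hcl.2.2]
    have hgH : g ∈ H := by
      rcases hg with rfl | rfl | rfl <;> assumption
    have hgd : ¬ g.IsDiag := by
      rcases hg with rfl | rfl | rfl <;> simpa
    have hxw := ne_of_mem_nb hC.diag hx
    have hyw := ne_of_mem_nb hC.diag hy
    have hzw := ne_of_mem_nb hC.diag hz
    have hgw : w ∉ g := by
      rcases hg with rfl | rfl | rfl <;> simp [*]
    by_cases hgC : g ∈ C
    · exact subset_cl _ _ ⟨⟨hgC, hgA⟩, hgw⟩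
    obtain ⟨D, hDs, hD, hgD⟩ := exists_circ_of_mem_cl hgcl fun h => hgC h.1
    have hDd := hD.forall_not_isDiag hp.genPos hgD hgd
    have hlt : (D \ pairs A).ncard < (C \ pairs A).ncard := by
      have hsub : D \ pairs A ⊆ Insert.insert g (((C \ pairs A) \ {s(w, x)}) \ {s(w, y)}) := by
        rintro e ⟨he, heA⟩
        rcases hDs he with rfl | h
        · exact Or.inl rfl
        · refine Or.inr ⟨⟨⟨h.1, heA⟩, ?_⟩, ?_⟩ <;> rintro rfl <;> exact h.2 (by simp)
      have h3 := Set.ncard_le_ncard hsub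
      have h4 := Set.ncard_insert_le g (((C \ pairs A) \ {s(w, x)}) \ {s(w, y)})
      have h5 := Set.ncard_sdiff_singleton_add_one (show s(w, x) ∈ C \ pairs A from
        ⟨hx, fun h => hw (mk_mem_pairs.1 h).1⟩)
      have h6 := Set.ncard_sdiff_singleton_add_one (show s(w, y) ∈ (C \ pairs A) \ {s(w, x)} from
        ⟨⟨hy, fun h => hw (mk_mem_pairs.1 h).1⟩, fun h => hxy (Sym2.congr_right.1 h).symm⟩)
      omega
    refine cl_mono p ?_ (hD.mem_cl hgD)
    rintro e ⟨he, hne⟩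
    have he' := (hDs he).resolve_left hne
    refine ⟨⟨he'.1, fun heA => ?_⟩, he'.2⟩
    refine absurd (hmin D ⟨hD, hDd, ?_, fun h => hgA (h hgD),
      two_le_ncard_vertexSpan_inter he heA (hDd e he)⟩) (not_le.2 hlt)
    intro f hf
    rcases hDs hf with rfl | h
    exacts [Or.inl hgH, hC.sub h.1]
  have hlast : s(x, y) ∉ pairs A → s(x, z) ∉ pairs A → s(y, z) ∉ pairs A → False := by
    intro g1 g2 g3
    have ht : Rig p (away (C \ pairs A) w) {x, y, z} := Rig.triple hp.genPos hxy
      (hpair _ (by simp) g1) (hpair _ (by simp) g2) (hpair _ (by simp) g3)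
    refine not_ind_of_triangle hp.genPos (notMem_vertexSpan_away _ w) hxy hxz hyz ht ?_
    obtain ⟨j, hj⟩ := (Set.ncard_pos (Set.toFinite _)).1 (hC.one_le_ncard hp hr)
    refine (hC.circ.ind_diff hj.1).mono ?_
    have hj' : ∀ v, s(w, v) ≠ j := by
      rintro v rfl
      exact hw (mk_mem_pairs.1 hj.2).1
    rintro e (he | rfl | rfl | rfl)
    · exact ⟨he.1.1, fun h => he.1.2 (by rw [h]; exact hj.2)⟩
    · exact ⟨hx, hj' x⟩
    · exact ⟨hy, hj' y⟩
    · exact ⟨hz, hj' z⟩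
  have hsw : ∀ a b : V, s(a, b) ∈ H → s(b, a) ∈ H := fun a b h => by rwa [Sym2.eq_swap]
  have hwx := hHw x hx
  have hwy := hHw y hy
  have hwz := hHw z hz
  have nx := ne_of_mem_nb hC.diag hx
  have ny := ne_of_mem_nb hC.diag hy
  have nz := ne_of_mem_nb hC.diag hz
  by_cases hxA : x ∈ A <;> by_cases hyA : y ∈ A <;> by_cases hzA : z ∈ A
  · exact h1 w hw x hxA y hyA z hzA hxy hxz hyz hwx hwy hwz
  · exact h2 w hw z hzA x hxA y hyA nz hxy hwx hwy (hsw _ _ hxzH) (hsw _ _ hyzH) hxyH hwz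
  · exact h2 w hw y hyA x hxA z hzA ny hxz hwx hwz (hsw _ _ hxyH) hyzH hxzH hwy
  · exact hlast (by simp [mk_mem_pairs, hyA]) (by simp [mk_mem_pairs, hzA])
      (by simp [mk_mem_pairs, hyA])
  · exact h2 w hw x hxA y hyA z hzA nx hyz hwy hwz hxyH hxzH hyzH hwx
  · exact hlast (by simp [mk_mem_pairs, hxA]) (by simp [mk_mem_pairs, hzA])
      (by simp [mk_mem_pairs, hzA])
  · exact hlast (by simp [mk_mem_pairs, hyA]) (by simp [mk_mem_pairs, hxA])
      (by simp [mk_mem_pairs, hyA])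
  · exact hlast (by simp [mk_mem_pairs, hyA]) (by simp [mk_mem_pairs, hxA])
      (by simp [mk_mem_pairs, hyA])

lemma exists_good_cover (hp : Generic p) (hH : DegreeThreeClosed p H) {F : Set (Sym2 V)}
    (hFH : F ⊆ H) (hFd : ∀ e ∈ F, ¬ e.IsDiag) (hne : F.Nonempty)
    (hF : ∀ e ∈ F, ∀ f ∈ F, e = f ∨ ∃ C ⊆ F, Circ p C ∧ e ∈ C ∧ f ∈ C) :
    ∃ A, Good p H A ∧ vertexSpan F ⊆ A := by
  obtain ⟨e0, he0⟩ := hne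
  have hbase : Good p H {v | v ∈ e0} := by
    induction e0 with | _ a b =>
      have hset : {v | v ∈ s(a, b)} = ({a, b} : Set V) := by ext v; simp
      have hab : s(a, b) ∈ H := hFH he0
      rw [hset]
      refine ⟨Rig.pair p (subset_cl _ _ ⟨hab, mk_mem_pairs.2 ⟨by simp, by simp⟩⟩), ?_⟩
      rintro x (rfl | rfl) y (rfl | rfl) hxy
      · exact absurd (hH.diag _ (by simp)) hxy
      · exact absurd hab hxy
      · exact absurd (by rwa [Sym2.eq_swap]) hxy
      · exact absurd (hH.diag _ (by simp)) hxy
  obtain ⟨A, hA0, hA⟩ := (Set.toFinite {A | Good p H A}).exists_le_maximal hbase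
  have hnot : ∀ w ∉ A, ∀ B, Insert.insert w A ⊆ B → ¬ Good p H B := fun w hw B hB hG =>
    hw (hA.2 hG ((Set.subset_insert _ _).trans hB) (hB (by simp)))
  have h1 : ∀ w ∉ A, ∀ x ∈ A, ∀ y ∈ A, ∀ z ∈ A, x ≠ y → x ≠ z → y ≠ z →
      s(w, x) ∈ H → s(w, y) ∈ H → s(w, z) ∈ H → False :=
    fun w hw x hx y hy z hz hxy hxz hyz hwx hwy hwz => hnot w hw _ subset_rfl
      (hA.1.insert hp hH hw hx hy hz hxy hxz hyz hwx hwy hwz)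
  refine ⟨A, hA.1, ?_⟩
  have h2 : ∀ w ∉ A, ∀ z ∉ A, ∀ x ∈ A, ∀ y ∈ A, w ≠ z → x ≠ y → s(w, x) ∈ H → s(w, y) ∈ H →
      s(z, x) ∈ H → s(z, y) ∈ H → s(x, y) ∈ H → s(w, z) ∈ H → False := by
    intro w hw z hz x hx y hy _ hxy hwx hwy hzx hzy hxyH hwz
    refine hnot w hw _ (Set.insert_subset_insert (Set.subset_insert _ _))
      (hA.1.insert_pair hp hH hw hz hx hy hxy hwx hwy hzx hzy hxyH hwz ?_ ?_)
    · intro v hv hwv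
      by_contra! h
      exact h1 w hw x hx y hy v hv hxy h.1.symm h.2.symm hwx hwy hwv
    · intro v hv hwv
      by_contra! h
      exact h1 z hz x hx y hy v hv hxy h.1.symm h.2.symm hzx hzy hwv
  have he0A : e0 ∈ pairs A := fun v hv => hA0 hv
  rintro v ⟨f, hf, hvf⟩
  have hfA : f ∈ pairs A := by
    by_contra hfA
    obtain ⟨C, hCF, hC, heC, hfC⟩ := (hF e0 he0 f hf).resolve_left (by rintro rfl; exact hfA he0A)
    exact hA.1.not_crossing hp hH h1 h2 C ⟨hC, fun e he => hFd e (hCF he),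
      fun e he => Or.inl (hFH (hCF he)), fun h => hfA (h hfC),
      two_le_ncard_vertexSpan_inter heC he0A (hFd e0 he0)⟩
  exact hfA v hvf

lemma Sep.not_internallyDisjointPaths {F : Set (Sym2 V)} (hFH : F ⊆ H) (hFA : vertexSpan F ⊆ A)
    {u v : V} (h : Sep H A u v) :
    ¬ InternallyDisjointPaths (SimpleGraph.fromEdgeSet F) u v 3 := by
  obtain ⟨U, S, hU, hS, hc, hu, -, hvU, hvS, hd, hE⟩ := h
  rintro ⟨P, -, hP⟩
  have huS := Set.disjoint_left.1 hd hu
  have key : ∀ i, ∃ s ∈ S, s ∈ (P i).support := by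
    intro i
    obtain ⟨d, hd, h1, h2⟩ := (P i).exists_boundary_dart U hu hvU
    have hadj := d.adj
    rw [SimpleGraph.fromEdgeSet_adj] at hadj
    exact ⟨d.snd, (hE _ h1 _ (hFA ⟨_, hadj.1, by simp⟩) (hFH hadj.1)).resolve_left h2,
      (P i).dart_snd_mem_support_of_mem_darts hd⟩
  choose s hsS hsP using key
  have hinj : Function.Injective fun i => (⟨s i, hsS i⟩ : S) := by
    intro i j hij
    by_contra hne
    have hij' : s i = s j := congrArg Subtype.val hij
    rcases hP i j hne (s i) (hsP i) (hij' ▸ hsP j) with h | h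
    · exact huS (h ▸ hsS i)
    · exact hvS (h ▸ hsS i)
  have := Nat.card_le_card_of_injective _ hinj
  rw [Nat.card_coe_set_eq, Nat.card_fin] at this
  omega

/-- The pairs whose distance is the same in two placements. -/
def sameLength (p q : V → Fin 2 → ℝ) : Set (Sym2 V) := {e | row p e p = row q e q}

lemma degreeThreeClosed_sameLength (hp : Generic p) (q : V → Fin 2 → ℝ) :
    DegreeThreeClosed p (sameLength p q) where
  diag e he := by simp only [sameLength, Set.mem_ofPred_eq, row_diag _ he, LinearMap.zero_apply]
  pair C hCH hC hd w x y z hn hxy hxz hyz := hC.row_pair_eq hp hd (fun e he => hCH he) hn hxy hxz hyz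

lemma eDist_eq_iff (p q : V → Fin 2 → ℝ) (a b c d : V) :
    eDist (p a) (p b) = eDist (q c) (q d) ↔ row p s(a, b) p = row q s(c, d) q := by
  rw [eDist, eDist, Real.sqrt_inj (by positivity) (by positivity)]
  simp [Fin.sum_univ_two, pow_two]

end Covering

section Sufficiency

theorem globallyLinked_of_connected [Finite V] [DecidableEq V] {G : SimpleGraph V} {u v : V}
    {F : Set (Sym2 V)} (hFG : F ⊆ G.edgeSet) (hF : RdConnectedSet 2 F) (hu : u ∈ vertexSpan F)
    (hv : v ∈ vertexSpan F) (hP : InternallyDisjointPaths (SimpleGraph.fromEdgeSet F) u v 3) :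
    GloballyLinked 2 G u v := by
  intro p hp q hq
  have hFH : F ⊆ sameLength p q := by
    intro e he
    induction e with | _ a b => exact (eDist_eq_iff p q a b a b).1 (hq a b (hFG he))
  obtain ⟨A, hA, hFA⟩ := exists_good_cover hp (degreeThreeClosed_sameLength hp q) hFH
    (fun e he => G.not_isDiag_of_mem_edgeSet (hFG he)) hF.1 fun e he f hf =>
      (hF.2 e he f hf).imp id fun ⟨C, h1, h2, h3⟩ => ⟨C, h1, hp.rdCircuit_iff.1 h2, h3⟩
  rw [eq_comm, eDist_eq_iff]
  by_contra huv
  exact (hA.sep u (hFA hu) v (hFA hv) huv).not_internallyDisjointPaths hFH hFA hP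

end Sufficiency

section Classes

lemma exists_isCircuit_of_inter_nonempty {α : Type*} [Finite α] {M : Matroid α} {e g : α}
    {C D : Set α} (hC : M.IsCircuit C) (hD : M.IsCircuit D) (he : e ∈ C) (hg : g ∈ D)
    (hCD : (C ∩ D).Nonempty) : ∃ K ⊆ C ∪ D, M.IsCircuit K ∧ e ∈ K ∧ g ∈ K := by
  induction hn : (C ∪ D).ncard using Nat.strong_induction_on generalizing C D with
  | _ n ih =>
    by_cases heD : e ∈ D
    · exact ⟨D, Set.subset_union_right, hD, heD, hg⟩
    by_cases hgC : g ∈ C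
    · exact ⟨C, Set.subset_union_left, hC, he, hgC⟩
    obtain ⟨f, hfC, hfD⟩ := hCD
    obtain ⟨C', hC's, hC', heC'⟩ := hC.strong_elimination hD hfC hfD he heD
    obtain ⟨D', hD's, hD', hgD'⟩ := hD.strong_elimination hC hfD hfC hg hgC
    rw [Set.union_comm] at hD's
    have step : ∀ X Y : Set α, M.IsCircuit X → M.IsCircuit Y → e ∈ X → g ∈ Y → (X ∩ Y).Nonempty →
        X ∪ Y ⊂ C ∪ D → ∃ K ⊆ C ∪ D, M.IsCircuit K ∧ e ∈ K ∧ g ∈ K := by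
      intro X Y hX hY heX hgY hXY hs
      obtain ⟨K, hK, h⟩ := ih _ (hn ▸ Set.ncard_lt_ncard hs) hX hY heX hgY hXY rfl
      exact ⟨K, hK.trans hs.subset, h⟩
    obtain ⟨x, hxC', hxC⟩ : ∃ x ∈ C', x ∉ C := by
      by_contra! h
      have := hC'.eq_of_subset_isCircuit hC h
      exact (hC's (this ▸ hfC)).2 rfl
    obtain ⟨y, hyD', hyD⟩ : ∃ y ∈ D', y ∉ D := by
      by_contra! h
      have := hD'.eq_of_subset_isCircuit hD h
      exact (hD's (this ▸ hfD)).2 rfl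
    have hxD : x ∈ D := (hC's hxC').1.resolve_left hxC
    have hyC : y ∈ C := (hD's hyD').1.resolve_right hyD
    by_cases h1 : C ∪ D ⊆ C ∪ D'
    · refine step C' D' hC' hD' heC' hgD' ⟨x, hxC', (h1 (.inr hxD)).resolve_left hxC⟩ ?_
      refine (Set.ssubset_iff_of_subset ?_).2 ⟨f, .inl hfC, ?_⟩
      · exact Set.union_subset (hC's.trans Set.sdiff_subset) (hD's.trans Set.sdiff_subset)
      · rintro (h | h)
        exacts [(hC's h).2 rfl, (hD's h).2 rfl]
    · exact step C D' hC hD' he hgD' ⟨y, hyC, hyD'⟩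
        ⟨Set.union_subset Set.subset_union_left (hD's.trans Set.sdiff_subset), h1⟩

variable [Finite V] {p : V → Fin 2 → ℝ} {E H R B : Set (Sym2 V)}

/-- The class of `e` for the relation of being equal or on a common circuit in `E`. -/
def circClass (p : V → Fin 2 → ℝ) (E : Set (Sym2 V)) (e : Sym2 V) : Set (Sym2 V) :=
  {f | f ∈ E ∧ (e = f ∨ ∃ C ⊆ E, Circ p C ∧ e ∈ C ∧ f ∈ C)}

lemma circClass_subset (p : V → Fin 2 → ℝ) (E : Set (Sym2 V)) (e : Sym2 V) : circClass p E e ⊆ E :=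
  fun _ h => h.1

lemma mem_circClass {e : Sym2 V} (he : e ∈ E) : e ∈ circClass p E e := ⟨he, .inl rfl⟩

lemma Circ.subset_circClass {C : Set (Sym2 V)} (hC : Circ p C) (hCE : C ⊆ E) {e f : Sym2 V}
    (hf : f ∈ C) (hfe : f ∈ circClass p E e) : C ⊆ circClass p E e := by
  intro g hg
  obtain ⟨-, rfl | ⟨D, hDE, hD, heD, hfD⟩⟩ := hfe
  · exact ⟨hCE hg, .inr ⟨C, hCE, hC, hf, hg⟩⟩
  · obtain ⟨K, hK, hKc, heK, hgK⟩ :=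
      exists_isCircuit_of_inter_nonempty hD hC heD hg ⟨f, hfD, hf⟩
    exact ⟨hCE hg, .inr ⟨K, hK.trans (Set.union_subset hDE hCE), hKc, heK, hgK⟩⟩

lemma rdConnectedSet_circClass [DecidableEq V] (hp : Generic p) {e : Sym2 V} (he : e ∈ E) :
    RdConnectedSet 2 (circClass p E e) := by
  refine ⟨⟨e, mem_circClass he⟩, fun f hf g hg => ?_⟩
  simp only [hp.rdCircuit_iff]
  have key : ∀ C ⊆ E, Circ p C → e ∈ C → C ⊆ circClass p E e :=
    fun C hCE hC heC => hC.subset_circClass hCE heC (mem_circClass he)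
  obtain ⟨-, rfl | ⟨C, hCE, hC, heC, hfC⟩⟩ := hf
  · obtain ⟨-, rfl | ⟨D, hDE, hD, heD, hgD⟩⟩ := hg
    · exact .inl rfl
    · exact .inr ⟨D, key D hDE hD heD, hD, heD, hgD⟩
  · obtain ⟨-, rfl | ⟨D, hDE, hD, heD, hgD⟩⟩ := hg
    · exact .inr ⟨C, key C hCE hC heC, hC, hfC, heC⟩
    · obtain ⟨K, hK, hKc, hfK, hgK⟩ :=
        exists_isCircuit_of_inter_nonempty hC hD hfC hgD ⟨e, heC, heD⟩
      have hKE := hK.trans (Set.union_subset hCE hDE)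
      refine .inr ⟨K, ?_, hKc, hfK, hgK⟩
      exact Circ.subset_circClass hKc hKE hfK (key C hCE hC heC hfC)

/-- If no circuit of `E` meets both `H` and `E \ H`, then a basis of a set spanned by `E` restricts
to a basis of `H`. -/
lemma subset_cl_inter_of_separated (hHE : H ⊆ E)
    (hsep : ∀ C ⊆ E, Circ p C → (C ∩ H).Nonempty → C ⊆ H)
    (hB : Ind p B) (hEB : E ⊆ Cl p B) {H' : Set (Sym2 V)} (hH' : B ∩ H' ⊆ Cl p H)
    (hR' : B \ H' ⊆ Cl p (E \ H)) : H ⊆ Cl p (B ∩ H') := by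
  obtain ⟨I, -, hIH, hI, hIcl⟩ := exists_basis p (Ind.empty p) (Set.empty_subset H)
  obtain ⟨J, -, hJR, hJ, hJcl⟩ := exists_basis p (Ind.empty p) (Set.empty_subset (E \ H))
  have hIJ : Ind p (I ∪ J) := by
    by_contra h
    obtain ⟨C, hCIJ, hC⟩ := exists_circ_subset h
    have hCE : C ⊆ E := hCIJ.trans (Set.union_subset (hIH.trans hHE) (hJR.trans Set.sdiff_subset))
    by_cases hCH : (C ∩ H).Nonempty
    · exact hC.not_ind (hI.mono fun x hx =>
        (hCIJ hx).resolve_right fun hxJ => (hJR hxJ).2 (hsep C hCE hC hCH hx))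
    · exact hC.not_ind (hJ.mono fun x hx =>
        (hCIJ hx).resolve_left fun hxI => hCH ⟨x, hx, hIH hxI⟩)
  have h1 : (I ∪ J).ncard ≤ B.ncard := ind_ncard_le hIJ
    (Set.union_subset (hIH.trans (hHE.trans hEB)) (hJR.trans (Set.sdiff_subset.trans hEB)))
  rw [Set.ncard_union_eq
    (Set.disjoint_left.2 fun x hxI hxJ => (hJR hxJ).2 (hIH hxI))] at h1
  have h2 : (B \ H').ncard ≤ J.ncard :=
    ind_ncard_le (hB.mono Set.sdiff_subset) (hR'.trans (cl_subset_cl hJcl))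
  have h3 := Set.ncard_inter_add_ncard_sdiff_eq_ncard B H'
  intro e he
  by_contra hecl
  have heB : e ∉ B ∩ H' := fun h => hecl (subset_cl p _ h)
  have h4 := ind_ncard_le ((ind_insert heB).2 ⟨hB.mono Set.inter_subset_left, hecl⟩)
    (Set.insert_subset (hIcl he) (hH'.trans (cl_subset_cl hIcl)))
  rw [Set.ncard_insert_of_notMem heB] at h4
  omega

end Classes

section Menger

/-- The vertices `a` and `b` are joined by a walk of `Γ` inside `X`. -/
def ConnIn (Γ : SimpleGraph V) (X : Set V) (a b : V) : Prop :=
  ∃ W : Γ.Walk a b, ∀ w ∈ W.support, w ∈ X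

/-- The set `X` is the set of vertices of a path of `Γ` from `a` to `b`. -/
def PathSet (Γ : SimpleGraph V) (X : Set V) (a b : V) : Prop :=
  ∃ W : Γ.Walk a b, W.IsPath ∧ X = {w | w ∈ W.support}

/-- There are disjoint paths of `Γ` from `A` to `B`, indexed by `ι`. -/
def Linkage (Γ : SimpleGraph V) (A B : Set V) (ι : Type*) : Prop :=
  ∃ X : ι → Set V, (∀ i, ∃ a ∈ A, ∃ b ∈ B, PathSet Γ (X i) a b) ∧
    ∀ i j, i ≠ j → Disjoint (X i) (X j)

variable {Γ Δ : SimpleGraph V} {A B S T X Y : Set V} {a b c x y : V}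

lemma ConnIn.refl (ha : a ∈ X) : ConnIn Γ X a a := ⟨.nil, by simpa using ha⟩

lemma ConnIn.symm (h : ConnIn Γ X a b) : ConnIn Γ X b a :=
  ⟨h.choose.reverse, by simpa using h.choose_spec⟩

lemma ConnIn.trans (h : ConnIn Γ X a b) (h' : ConnIn Γ X b c) : ConnIn Γ X a c := by
  obtain ⟨W, hW⟩ := h
  obtain ⟨W', hW'⟩ := h'
  refine ⟨W.append W', fun w hw => ?_⟩
  rw [SimpleGraph.Walk.mem_support_append_iff] at hw
  exact hw.elim (hW w) (hW' w)

lemma ConnIn.mono (hΓ : Γ ≤ Δ) (h : ConnIn Γ X a b) (hXY : X ⊆ Y) : ConnIn Δ Y a b := by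
  obtain ⟨W, hW⟩ := h
  exact ⟨W.mapLe hΓ, fun w hw => hXY (hW w (by simpa using hw))⟩

lemma ConnIn.left (h : ConnIn Γ X a b) : a ∈ X := h.choose_spec _ h.choose.start_mem_support

lemma ConnIn.right (h : ConnIn Γ X a b) : b ∈ X := h.choose_spec _ h.choose.end_mem_support

lemma ConnIn.tail (h : ConnIn Γ X a b) (hbc : Γ.Adj b c) (hc : c ∈ X) : ConnIn Γ X a c :=
  h.trans ⟨.cons hbc .nil, by simpa using ⟨h.right, hc⟩⟩

lemma ConnIn.induction (h : ConnIn Γ X a b) {P : V → Prop} (ha : P a)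
    (hs : ∀ c d, P c → Γ.Adj c d → d ∈ X → P d) : P b := by
  obtain ⟨W, hW⟩ := h
  induction W with
  | nil => exact ha
  | cons hadj W ih =>
    simp only [SimpleGraph.Walk.support_cons, List.mem_cons, forall_eq_or_imp] at hW
    exact ih (hs _ _ ha hadj (hW.2 _ W.start_mem_support)) hW.2

lemma ConnIn.exists_pathSet (h : ConnIn Γ X a b) : ∃ Y ⊆ X, PathSet Γ Y a b := by
  classical
  obtain ⟨W, hW⟩ := h
  exact ⟨_, fun w hw => hW w (W.support_bypass_subset_support hw), W.bypass, W.bypass_isPath, rfl⟩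

lemma PathSet.symm (h : PathSet Γ X a b) : PathSet Γ X b a := by
  obtain ⟨W, hW, rfl⟩ := h
  exact ⟨W.reverse, hW.reverse, by simp⟩

lemma PathSet.mono (hΓ : Γ ≤ Δ) (h : PathSet Γ X a b) : PathSet Δ X a b := by
  obtain ⟨W, hW, rfl⟩ := h
  exact ⟨W.mapLe hΓ, (SimpleGraph.Walk.isPath_mapLe hΓ).2 hW, by simp⟩

lemma PathSet.connIn (h : PathSet Γ X a b) : ConnIn Γ X a b := by
  obtain ⟨W, hW, rfl⟩ := h
  exact ⟨W, fun w hw => hw⟩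

lemma PathSet.eq_or_connIn (h : PathSet Γ X a b) (hc : c ∈ X) :
    c = b ∨ ConnIn Γ (X \ {b}) a c := by
  classical
  obtain ⟨W, hW, rfl⟩ := h
  by_cases hcb : c = b
  · exact .inl hcb
  · refine .inr ⟨W.takeUntil c hc, fun w hw =>
      ⟨W.support_takeUntil_subset_support hc hw, ?_⟩⟩
    rintro rfl
    exact SimpleGraph.Walk.endpoint_notMem_support_takeUntil hW hc (Ne.symm hcb) hw

/-- A walk from `A` to `B` in `Γ = Δ + xy` gives a walk from `A` to `S + x` in `Δ`, if `S` separates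
`A` from `B` and `y` in `Δ`. -/
lemma exists_connIn_insert (hΔ : ∀ a b, Γ.Adj a b → s(a, b) ≠ s(x, y) → Δ.Adj a b)
    (hS : ∀ a ∈ A, ∀ b ∈ B, ¬ ConnIn Δ Sᶜ a b) (hy : ∀ a ∈ A, ¬ ConnIn Δ Sᶜ a y)
    (ha : a ∈ A) (hb : b ∈ B) (h : ConnIn Γ Tᶜ a b) :
    ∃ a ∈ A, ∃ z ∈ insert x S, ConnIn Δ Tᶜ a z := by
  by_contra! hcon
  have key : ConnIn Δ (Tᶜ \ insert x S) a b := by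
    refine h.induction (ConnIn.refl ⟨h.left, fun hax => hcon a ha a hax (ConnIn.refl h.left)⟩) ?_
    intro c d hc hcd hd
    have hc' : ConnIn Δ Tᶜ a c := hc.mono le_rfl Set.sdiff_subset
    by_cases he : s(c, d) = s(x, y)
    · rw [Sym2.eq_iff] at he
      obtain ⟨rfl, rfl⟩ | ⟨rfl, rfl⟩ := he
      · exact absurd hc' (hcon a ha c (Set.mem_insert _ _))
      · exact absurd (hc.mono le_rfl fun w hw hwS => hw.2 (.inr hwS)) (hy a ha)
    · have hcd' := hΔ c d hcd he
      exact hc.tail hcd' ⟨hd, fun hdx => hcon a ha d hdx (hc'.tail hcd' hd)⟩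
  exact hS a ha b hb (key.mono le_rfl fun w hw hwS => hw.2 (.inr hwS))

lemma PathSet.exists_adj (h : PathSet Γ X a b) (hab : a ≠ b) :
    ∃ c, Γ.Adj a c ∧ PathSet Γ (X \ {a}) c b := by
  obtain ⟨W, hW, rfl⟩ := h
  cases W with
  | nil => exact absurd rfl hab
  | @cons _ c _ hac W =>
    rw [SimpleGraph.Walk.cons_isPath_iff] at hW
    refine ⟨c, hac, W, hW.1, ?_⟩
    ext w
    simp only [SimpleGraph.Walk.support_cons, List.mem_cons, Set.mem_sdiff, Set.mem_ofPred_eq,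
      Set.mem_singleton_iff]
    grind

lemma Linkage.exists_ends [Finite V] {ι : Type*} [Finite ι] {R : Set V} (h : Linkage Γ A R ι)
    (hι : Nat.card ι = R.ncard) : ∃ X : R → Set V, (∀ s, ∃ a ∈ A, PathSet Γ (X s) a s) ∧
      (∀ s, ∀ z ∈ X s, z ∈ R → z = s) ∧ ∀ s t, s ≠ t → Disjoint (X s) (X t) := by
  obtain ⟨X, hX, hd⟩ := h
  choose a ha b hb hP using hX
  have hmem : ∀ i, b i ∈ X i := fun i => (hP i).connIn.right
  have hinj : Function.Injective (fun i => (⟨b i, hb i⟩ : R)) := by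
    intro i j hij
    by_contra hne
    have hij' : b i = b j := congrArg Subtype.val hij
    exact Set.disjoint_left.1 (hd i j hne) (hmem i) (hij' ▸ hmem j)
  have hsurj := ((Nat.bijective_iff_injective_and_card _).2 ⟨hinj, hι⟩).surjective
  choose i hi using hsurj
  have hi' : ∀ s : R, b (i s) = s := fun s => congrArg Subtype.val (hi s)
  have hd' : ∀ s t : R, s ≠ t → Disjoint (X (i s)) (X (i t)) := fun s t hst =>
    hd _ _ fun h => hst (Subtype.ext (by rw [← hi' s, ← hi' t, h]))
  refine ⟨fun s => X (i s), fun s => ⟨a (i s), ha _, by simpa only [hi'] using hP (i s)⟩, ?_, hd'⟩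
  intro s z hz hzR
  by_contra hne
  refine Set.disjoint_left.1 (hd' s ⟨z, hzR⟩ fun h => hne (by rw [h])) hz ?_
  have := hmem (i ⟨z, hzR⟩)
  rwa [hi'] at this

/-- The set form of the theorem of Menger. -/
theorem linkage_of_forall_connIn [Finite V] {ι : Type*} [Finite ι]
    (h : ∀ S : Set V, S.ncard < Nat.card ι → ∃ a ∈ A, ∃ b ∈ B, ConnIn Γ Sᶜ a b) :
    Linkage Γ A B ι := by
  induction hn : Γ.edgeSet.ncard using Nat.strong_induction_on generalizing Γ A B ι with
  | _ n ih =>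
  by_cases hE : Γ.edgeSet = ∅
  · have hcard : Nat.card ι ≤ Nat.card ↥(A ∩ B) := by
      by_contra! hlt
      obtain ⟨a, ha, b, hb, W, hW⟩ := h (A ∩ B) (by simpa using hlt)
      cases W with
      | nil => exact hW a (by simp) ⟨ha, hb⟩
      | cons hadj W => exact Set.notMem_empty _ (hE ▸ Γ.mem_edgeSet.2 hadj)
    obtain ⟨f, hf⟩ : ∃ f : ι → ↥(A ∩ B), Function.Injective f := by
      have := Fintype.ofFinite ι
      have := Fintype.ofFinite ↥(A ∩ B)
      rw [Nat.card_eq_fintype_card, Nat.card_eq_fintype_card] at hcard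
      obtain ⟨f⟩ := Function.Embedding.nonempty_of_card_le hcard
      exact ⟨f, f.injective⟩
    refine ⟨fun i => {(f i : V)}, fun i => ⟨f i, (f i).2.1, f i, (f i).2.2, .nil, by simp, ?_⟩, ?_⟩
    · ext; simp
    · intro i j hij
      rw [Set.disjoint_singleton]
      exact fun h => hij (hf (Subtype.ext h))
  obtain ⟨e, he⟩ := Set.nonempty_iff_ne_empty.2 hE
  set Δ := Γ.deleteEdges {e} with hΔdef
  have hΔΓ : Δ ≤ Γ := SimpleGraph.deleteEdges_le _
  have hΔn : Δ.edgeSet.ncard < n := by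
    rw [← hn, SimpleGraph.edgeSet_deleteEdges]
    exact Set.ncard_lt_ncard ⟨Set.sdiff_subset, fun h => (h he).2 rfl⟩
  by_cases hsep : ∀ S : Set V, S.ncard < Nat.card ι → ∃ a ∈ A, ∃ b ∈ B, ConnIn Δ Sᶜ a b
  · obtain ⟨X, hX, hd⟩ := ih _ hΔn hsep rfl
    refine ⟨X, fun i => ?_, hd⟩
    obtain ⟨a, ha, b, hb, hP⟩ := hX i
    exact ⟨a, ha, b, hb, hP.mono hΔΓ⟩
  push Not at hsep
  obtain ⟨S, hSc, hS⟩ := hsep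
  have hΔ' : ∀ c d, Γ.Adj c d → s(c, d) ≠ e → Δ.Adj c d := by
    intro c d hcd hne
    rw [hΔdef, SimpleGraph.deleteEdges_adj]
    exact ⟨hcd, hne⟩
  -- an end of the deleted edge that is reachable from `A`, the other end not being so
  obtain ⟨x, y, rfl, ⟨a₀, ha₀, hx⟩, hy⟩ : ∃ x y, e = s(x, y) ∧ (∃ a ∈ A, ConnIn Δ Sᶜ a x) ∧
      ∀ a ∈ A, ¬ ConnIn Δ Sᶜ a y := by
    by_contra! hcon
    obtain ⟨a, ha, b, hb, hab⟩ := h S hSc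
    obtain ⟨a', ha', h'⟩ : ∃ a' ∈ A, ConnIn Δ Sᶜ a' b := by
      refine hab.induction (P := fun w => ∃ a' ∈ A, ConnIn Δ Sᶜ a' w)
        ⟨a, ha, ConnIn.refl hab.left⟩ ?_
      rintro c d ⟨a', ha', hc⟩ hcd hd
      by_cases hce : s(c, d) = e
      · exact hcon c d hce.symm ⟨a', ha', hc⟩
      · exact ⟨a', ha', hc.tail (hΔ' c d hcd hce) hd⟩
    exact hS a' ha' b hb h'
  have hΔ'' : ∀ c d, Γ.Adj c d → s(c, d) ≠ s(y, x) → Δ.Adj c d := by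
    rwa [Sym2.eq_swap (a := y)]
  have hxB : ∀ b ∈ B, ¬ ConnIn Δ Sᶜ b x := fun b hb hbx => hS a₀ ha₀ b hb (hx.trans hbx.symm)
  have hS' : ∀ b ∈ B, ∀ a ∈ A, ¬ ConnIn Δ Sᶜ b a := fun b hb a ha h => hS a ha b hb h.symm
  have hleft : ∀ T : Set V, T.ncard < Nat.card ι → ∃ a ∈ A, ∃ z ∈ insert x S, ConnIn Δ Tᶜ a z := by
    intro T hT
    obtain ⟨a, ha, b, hb, hab⟩ := h T hT
    exact exists_connIn_insert hΔ' hS hy ha hb hab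
  have hright : ∀ T : Set V, T.ncard < Nat.card ι → ∃ b ∈ B, ∃ z ∈ insert y S, ConnIn Δ Tᶜ b z := by
    intro T hT
    obtain ⟨a, ha, b, hb, hab⟩ := h T hT
    exact exists_connIn_insert hΔ'' hS' hxB hb ha hab.symm
  have hcx : Nat.card ι = (insert x S).ncard := by
    refine le_antisymm ?_ ((Set.ncard_insert_le _ _).trans hSc)
    by_contra! hlt
    obtain ⟨a, -, z, hz, haz⟩ := hleft _ hlt
    exact haz.right hz
  have hcy : Nat.card ι = (insert y S).ncard := by
    refine le_antisymm ?_ ((Set.ncard_insert_le _ _).trans hSc)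
    by_contra! hlt
    obtain ⟨b, -, z, hz, hbz⟩ := hright _ hlt
    exact hbz.right hz
  have hyS : y ∉ S := fun hyS => by
    rw [Set.insert_eq_of_mem hyS] at hcy
    omega
  obtain ⟨X, hX, hXR, hXd⟩ := (ih _ hΔn hleft rfl).exists_ends hcx
  obtain ⟨Y, hY, hYR, hYd⟩ := (ih _ hΔn hright rfl).exists_ends hcy
  have hmeet : ∀ s t z, z ∈ X s → z ∈ Y t → (s : V) = t := by
    intro s t z hzX hzY
    by_cases hzS : z ∈ S
    · rw [← hXR s z hzX (.inr hzS), ← hYR t z hzY (.inr hzS)]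
    obtain ⟨a, ha, hPa⟩ := hX s
    obtain ⟨b, hb, hPb⟩ := hY t
    have haz : ConnIn Δ Sᶜ a z := by
      obtain rfl | hc := hPa.eq_or_connIn hzX
      · exact hPa.connIn.mono le_rfl fun w hw hwS => hzS (hXR s w hw (.inr hwS) ▸ hwS)
      · exact hc.mono le_rfl fun w hw hwS => hw.2 (hXR s w hw.1 (.inr hwS))
    have hbz : ConnIn Δ Sᶜ b z := by
      obtain rfl | hc := hPb.eq_or_connIn hzY
      · exact hPb.connIn.mono le_rfl fun w hw hwS => hzS (hYR t w hw (.inr hwS) ▸ hwS)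
      · exact hc.mono le_rfl fun w hw hwS => hw.2 (hYR t w hw.1 (.inr hwS))
    exact (hS a ha b hb (haz.trans hbz.symm)).elim
  have hxy : Γ.Adj x y := he
  obtain ⟨σ, hσx, hσ⟩ : ∃ σ : ↥(insert x S) → ↥(insert y S),
      (∀ s : ↥(insert x S), (s : V) = x → (σ s : V) = y) ∧
        ∀ s : ↥(insert x S), (s : V) ≠ x → (σ s : V) = s := by
    classical
    refine ⟨fun s => if h : (s : V) = x then ⟨y, Set.mem_insert _ _⟩ else
      ⟨s, .inr (s.2.resolve_left h)⟩, fun s h => by simp [h], fun s h => by simp [h]⟩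
  have hσ' : ∀ s t : ↥(insert x S), (s : V) = σ t → s = t := by
    intro s t hst
    by_cases ht : (t : V) = x
    · rw [hσx t ht] at hst
      have := s.2
      rw [hst] at this
      exact (this.elim hxy.ne' hyS).elim
    · exact Subtype.ext (hst.trans (hσ t ht))
  have hσi : ∀ s t, σ s = σ t → s = t := by
    intro s t hst
    by_cases hs : (s : V) = x
    · by_cases ht : (t : V) = x
      · exact Subtype.ext (hs.trans ht.symm)
      · exact (hσ' t s (by rw [hst, hσ t ht])).symm
    · exact hσ' s t (by rw [← hst, hσ s hs])
  have hZ : ∀ s, ∃ Z ⊆ X s ∪ Y (σ s), ∃ a ∈ A, ∃ b ∈ B, PathSet Γ Z a b := by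
    intro s
    obtain ⟨a, ha, hPa⟩ := hX s
    obtain ⟨b, hb, hPb⟩ := hY (σ s)
    have h1 : ConnIn Γ (X s ∪ Y (σ s)) a s := hPa.connIn.mono hΔΓ Set.subset_union_left
    have h2 : ConnIn Γ (X s ∪ Y (σ s)) b (σ s) := hPb.connIn.mono hΔΓ Set.subset_union_right
    have h3 : ConnIn Γ (X s ∪ Y (σ s)) a (σ s) := by
      by_cases hs : (s : V) = x
      · exact h1.tail (by rw [hs, hσx s hs]; exact hxy) h2.right
      · rwa [hσ s hs]
    obtain ⟨Z, hZ, hP⟩ := (h3.trans h2.symm).exists_pathSet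
    exact ⟨Z, hZ, a, ha, b, hb, hP⟩
  choose Z hZs hZ using hZ
  obtain ⟨f⟩ : Nonempty (ι ≃ ↥(insert x S)) := Finite.card_eq.1 hcx
  refine ⟨fun i => Z (f i), fun i => hZ (f i), fun i j hij => ?_⟩
  have hij' : f i ≠ f j := fun h => hij (f.injective h)
  refine Set.disjoint_left.2 fun z hzi hzj => ?_
  obtain hzi | hzi := hZs _ hzi <;> obtain hzj | hzj := hZs _ hzj
  · exact Set.disjoint_left.1 (hXd _ _ hij') hzi hzj
  · exact hij' (hσ' _ _ (hmeet _ _ z hzi hzj))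
  · exact hij' (hσ' _ _ (hmeet _ _ z hzj hzi)).symm
  · exact Set.disjoint_left.1 (hYd _ _ fun h => hij' (hσi _ _ h)) hzi hzj

/-- The theorem of Menger for internally disjoint paths between nonadjacent vertices. -/
theorem internallyDisjointPaths_of_forall_connIn [Finite V] {u v : V} {k : ℕ} (huv : u ≠ v)
    (hadj : ¬ Γ.Adj u v)
    (h : ∀ S : Set V, S.ncard < k → u ∉ S → v ∉ S → ConnIn Γ Sᶜ u v) :
    InternallyDisjointPaths Γ u v k := by
  let Δ : SimpleGraph V := Γ.deleteEdges {e | u ∈ e ∨ v ∈ e}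
  have hΔ : ∀ {a b}, Δ.Adj a b ↔ Γ.Adj a b ∧ a ≠ u ∧ b ≠ u ∧ a ≠ v ∧ b ≠ v := by
    intro a b
    simp only [Δ, SimpleGraph.deleteEdges_adj, Set.mem_ofPred_eq, Sym2.mem_iff]
    grind
  have hlink : Linkage Δ (Γ.neighborSet u) (Γ.neighborSet v) (Fin k) := by
    refine linkage_of_forall_connIn fun S hS => ?_
    rw [Nat.card_fin] at hS
    have hc := h (S \ {u, v}) ((Set.ncard_le_ncard Set.sdiff_subset).trans_lt hS) (by simp)
      (by simp)
    obtain ⟨Y, hY, hP⟩ := hc.exists_pathSet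
    obtain ⟨a, hua, hP⟩ := hP.exists_adj huv
    obtain ⟨b, hvb, hP⟩ := hP.symm.exists_adj fun hva => hadj (hva ▸ hua)
    have hsub : (Y \ {u}) \ {v} ⊆ Sᶜ := fun w hw hwS =>
      hY hw.1.1 ⟨hwS, by simpa using ⟨hw.1.2, hw.2⟩⟩
    refine ⟨a, hua, b, hvb, ConnIn.symm (ConnIn.mono le_rfl ?_ hsub)⟩
    refine hP.connIn.induction (ConnIn.refl hP.connIn.left) fun c d hc hcd hd => ?_
    exact hc.tail (hΔ.2 ⟨hcd, hc.right.1.2, hd.1.2, hc.right.2, hd.2⟩) hd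
  obtain ⟨X, hX, hd⟩ := hlink
  have key : ∀ i, ∃ P : Γ.Walk u v, P.IsPath ∧ ∀ w ∈ P.support, w = u ∨ w = v ∨ w ∈ X i := by
    intro i
    obtain ⟨a, ha, b, hb, hP⟩ := hX i
    rw [SimpleGraph.mem_neighborSet] at ha hb
    have hne : ∀ w ∈ X i, w ≠ u ∧ w ≠ v := by
      intro w hw
      have hst : ConnIn Δ (X i) a w := by
        obtain rfl | h := hP.eq_or_connIn hw
        exacts [hP.connIn, h.mono le_rfl Set.sdiff_subset]
      refine hst.induction (P := fun w => w ≠ u ∧ w ≠ v) ⟨ha.ne', fun hav => hadj (hav ▸ ha)⟩ fun c d _ hcd _ => ?_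
      exact ⟨(hΔ.1 hcd).2.2.1, (hΔ.1 hcd).2.2.2.2⟩
    obtain ⟨W, hW, hXW⟩ := hP.mono (SimpleGraph.deleteEdges_le _)
    rw [hXW] at hne ⊢
    refine ⟨.cons ha (W.concat hb.symm), ?_, ?_⟩
    · rw [SimpleGraph.Walk.cons_isPath_iff, SimpleGraph.Walk.concat_isPath_iff]
      refine ⟨⟨hW, fun h => (hne v h).2 rfl⟩, ?_⟩
      simp only [SimpleGraph.Walk.support_concat, List.mem_append,
        List.mem_singleton, not_or]
      exact ⟨fun h => (hne u h).1 rfl, huv⟩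
    · intro w
      simp only [SimpleGraph.Walk.support_cons, SimpleGraph.Walk.support_concat,
        List.mem_append, List.mem_cons,
        Set.mem_ofPred_eq, List.not_mem_nil]
      tauto
  choose P hP hPs using key
  refine ⟨P, hP, fun i j hij w hi hj => ?_⟩
  obtain rfl | rfl | hwi := hPs i w hi
  · exact .inl rfl
  · exact .inr rfl
  obtain rfl | rfl | hwj := hPs j w hj
  · exact .inl rfl
  · exact .inr rfl
  exact (Set.disjoint_left.1 (hd i j hij) hwi hwj).elim

end Menger

section StarOnLine

variable [Finite V] {q μ : V → Fin 2 → ℝ}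

lemma obst_swap (p μ : V → Fin 2 → ℝ) (w x y z : V) :
    obst p μ w y x z = -obst p μ w x y z := by
  simp only [obst, area]; ring

section Update

variable [DecidableEq V] {w x y z : V}

lemma area_update (hx : x ≠ w) (hy : y ≠ w) (c : Fin 2 → ℝ) :
    area (Function.update q w c) w x y =
      (q x 0 - c 0) * (q y 1 - c 1) - (q x 1 - c 1) * (q y 0 - c 0) := by
  simp [area, Function.update_of_ne hx, Function.update_of_ne hy]

lemma obst_update (hx : x ≠ w) (hy : y ≠ w) (hz : z ≠ w) (c : Fin 2 → ℝ) :
    obst (Function.update q w c) μ w x y z =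
      ((q y 0 - c 0) * (q z 1 - c 1) - (q y 1 - c 1) * (q z 0 - c 0)) *
        ((c 0 - q x 0) * μ x 0 + (c 1 - q x 1) * μ x 1) +
      ((q z 0 - c 0) * (q x 1 - c 1) - (q z 1 - c 1) * (q x 0 - c 0)) *
        ((c 0 - q y 0) * μ y 0 + (c 1 - q y 1) * μ y 1) +
      ((q x 0 - c 0) * (q y 1 - c 1) - (q x 1 - c 1) * (q y 0 - c 0)) *
        ((c 0 - q z 0) * μ z 0 + (c 1 - q z 1) * μ z 1) := by
  rw [obst, area_update hx hy, area_update hy hz, area_update hz hx]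
  simp [Function.update_of_ne hx, Function.update_of_ne hy, Function.update_of_ne hz]

lemma obst_update_line (hx : x ≠ w) (hy : y ≠ w) (hz : z ≠ w) (t : ℝ) :
    obst (Function.update q w ![q x 0 + t * (q y 0 - q x 0), q x 1 + t * (q y 1 - q x 1)]) μ
      w x y z = -(t * (1 - t) * area q x y z * row q s(x, y) μ) := by
  rw [obst_update hx hy hz]
  simp [area]
  ring

lemma exists_obst_ne_of_collinear (hx : x ≠ w) (hy : y ≠ w) (hz : z ≠ w)
    (hx1 : q x 1 = 0) (hy1 : q y 1 = 0) (hz1 : q z 1 = 0) (hxz : q x 0 ≠ q z 0)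
    (hyz : q y 0 ≠ q z 0) (hg : row q s(x, y) μ ≠ 0) :
    ∃ c, obst (Function.update q w c) μ w x y z ≠ 0 := by
  by_contra! h
  have h1 := h ![0, 1]
  have h2 := h ![1, 1]
  have h3 := h ![0, 2]
  rw [obst_update hx hy hz] at h1 h2 h3
  simp only [hx1, hy1, hz1, Matrix.cons_val_zero, Matrix.cons_val_one] at h1 h2 h3
  have h0 : (q z 0 - q y 0) * (q z 0 - q x 0) * (μ x 0 - μ y 0) = 0 := by
    linear_combination (q z 0) * (h2 - h1) + 2 * h1 - h3 / 2
  have h4 : μ x 0 - μ y 0 = 0 := by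
    rcases mul_eq_zero.1 h0 with h5 | h5
    · rcases mul_eq_zero.1 h5 with h6 | h6
      · exact absurd (by linarith) hyz
      · exact absurd (by linarith) hxz
    · exact h5
  apply hg
  rw [row_mk, h4, hx1, hy1]
  ring

lemma exists_obst_ne_of_motion (hx : x ≠ w) (hy : y ≠ w) (hz : z ≠ w)
    (hx1 : q x 1 = 0) (hz1 : q z 1 ≠ 0) (hzx : row q s(z, x) μ = 0)
    (hg : row q s(x, y) μ ≠ 0 ∨ q y 1 ≠ 0 ∧ row q s(y, z) μ ≠ 0) :
    ∃ s : ℝ, obst (Function.update q w ![s, 0]) μ w x y z ≠ 0 := by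
  by_contra! h
  have h1 := h (q x 0 + 1)
  have h2 := h (q x 0 + 2)
  rw [obst_update hx hy hz] at h1 h2
  simp only [hx1, Matrix.cons_val_zero, Matrix.cons_val_one] at h1 h2
  simp only [row_mk, hx1] at hzx hg
  have hslope : q z 1 * (μ y 0 - μ x 0) - q y 1 * (μ z 0 - μ x 0) = 0 := by
    linear_combination h2 / 2 - h1
  have hxy : (q x 0 - q y 0) * (μ x 0 - μ y 0) + (0 - q y 1) * (μ x 1 - μ y 1) = 0 := by
    apply mul_left_cancel₀ hz1
    linear_combination (h2 / 2 - 2 * h1) + (q y 1) * hzx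
  rcases hg with hg | ⟨hy1, hg⟩
  · exact hg hxy
  · apply hg
    apply mul_left_cancel₀ (mul_ne_zero hy1 hz1)
    linear_combination (q y 1 * (q y 0 - q z 0) - (q y 1 - q z 1) * (q y 0 - q x 0)) * hslope +
      (q y 1 - q z 1) * q z 1 * hxy - (q y 1 - q z 1) * q y 1 * hzx

end Update

variable {N : Set V}

lemma GenOn.fst_ne (hq : GenOn N q) {a b : V} (hab : a ≠ b) : q a 0 ≠ q b 0 := by
  classical
  exact hq.coord_ne (x := fun w i => if w = a ∧ i = 0 then 1 else 0) (by simp) (by simp [hab.symm])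

lemma GenOn.snd_ne (hq : GenOn N q) {a b : V} (hab : a ≠ b) (ha : a ∉ N) : q a 1 ≠ q b 1 := by
  classical
  refine hq.coord_ne (x := fun w i => if w = a ∧ i = 1 then 1 else 0) ?_ (by simp [hab.symm])
  intro w hw
  simp [show w ≠ a by rintro rfl; exact ha hw]

lemma GenOn.snd_ne_zero (hq : GenOn N q) {a : V} (ha : a ∉ N) : q a 1 ≠ 0 := by
  classical
  intro h
  have := hq.2 (MvPolynomial.X (a, 1)) (by simpa using h)
    (fun w i => if w = a ∧ i = 1 then 1 else 0) (by
      intro w hw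
      simp [show w ≠ a by rintro rfl; exact ha hw])
  simp at this

lemma GenOn.area_ne_of_notMem (hq : GenOn N q) {a b c : V} (hab : a ≠ b) (hac : a ≠ c)
    (hbc : b ≠ c) (hc : c ∉ N) : area q a b c ≠ 0 := by
  classical
  refine hq.area_ne (x := fun w i => if w = b ∧ i = 0 ∨ w = c ∧ i = 1 then 1 else 0) ?_
    (by simp [area, hab, hac, hbc, hbc.symm])
  intro w hw
  simp [show w ≠ c by rintro rfl; exact hc hw]

lemma area_rotate (p : V → Fin 2 → ℝ) (a b c : V) : area p b c a = area p a b c := by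
  simp only [area]; ring

lemma GenOn.exists_obst_ne_left [DecidableEq V] (hq : GenOn N q) {u w y z : V} (huN : u ∉ N)
    (huw : u ≠ w) (hyw : y ≠ w) (hzw : z ≠ w) (huy : u ≠ y) (huz : u ≠ z) (hyz : y ≠ z)
    (hμ : ∀ n ∈ N, row q s(u, n) μ = 0) (hg : row q s(u, y) μ ≠ 0) :
    ∃ c : Fin 2 → ℝ, c 1 = 0 ∧ obst (Function.update q w c) μ w u y z ≠ 0 := by
  have hyN : y ∉ N := fun h => hg (hμ y h)
  have hu1 := hq.snd_ne_zero huN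
  have hy1 := hq.snd_ne_zero hyN
  by_cases hzN : z ∈ N
  · obtain ⟨s, hs⟩ := exists_obst_ne_of_motion (q := q) (μ := μ) hzw hyw huw (hq.1 z hzN) hu1
      (hμ z hzN) (Or.inr ⟨hy1, by rwa [Sym2.eq_swap]⟩)
    refine ⟨![s, 0], by simp, ?_⟩
    rwa [← obst_rotate, obst_swap, neg_ne_zero]
  · have hne := hq.snd_ne huy huN
    have hne' : q u 1 - q y 1 ≠ 0 := sub_ne_zero.2 hne
    refine ⟨_, ?_, ne_of_eq_of_ne (obst_update_line huw hyw hzw (q u 1 / (q u 1 - q y 1))) ?_⟩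
    · simp
      field_simp
      ring
    · have e1 : 1 - q u 1 / (q u 1 - q y 1) = -q y 1 / (q u 1 - q y 1) := by
        field_simp
        ring
      rw [e1]
      refine neg_ne_zero.2 (mul_ne_zero (mul_ne_zero (mul_ne_zero (div_ne_zero hu1 hne')
        (div_ne_zero (neg_ne_zero.2 hy1) hne')) (hq.area_ne_of_notMem huy huz hyz hzN)) hg)

lemma GenOn.exists_obst_ne [DecidableEq V] (hq : GenOn N q) {u w x y z : V} (huN : u ∉ N)
    (hxw : x ≠ w) (hyw : y ≠ w) (hzw : z ≠ w) (hxy : x ≠ y) (hxz : x ≠ z) (hyz : y ≠ z)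
    (hμ : ∀ n ∈ N, row q s(u, n) μ = 0) (hg : row q s(x, y) μ ≠ 0) :
    ∃ c : Fin 2 → ℝ, (u = x ∨ u = y ∨ u = z → c 1 = 0) ∧
      obst (Function.update q w c) μ w x y z ≠ 0 := by
  by_cases hux : u = x
  · subst hux
    obtain ⟨c, hc, h⟩ := hq.exists_obst_ne_left huN hxw hyw hzw hxy hxz hyz hμ hg
    exact ⟨c, fun _ => hc, h⟩
  by_cases huy : u = y
  · subst huy
    obtain ⟨c, hc, h⟩ := hq.exists_obst_ne_left huN hyw hxw hzw hxy.symm hyz hxz hμ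
      (by rwa [Sym2.eq_swap])
    rw [obst_swap, neg_ne_zero] at h
    exact ⟨c, fun _ => hc, h⟩
  by_cases huz : u = z
  · subst huz
    have hu1 := hq.snd_ne_zero huN
    by_cases hxN : x ∈ N
    · obtain ⟨s, hs⟩ := exists_obst_ne_of_motion (q := q) (μ := μ) hxw hyw hzw (hq.1 x hxN) hu1
        (hμ x hxN) (Or.inl hg)
      exact ⟨![s, 0], fun _ => by simp, hs⟩
    by_cases hyN : y ∈ N
    · obtain ⟨s, hs⟩ := exists_obst_ne_of_motion (q := q) (μ := μ) hyw hxw hzw (hq.1 y hyN) hu1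
        (hμ y hyN) (Or.inl (by rwa [Sym2.eq_swap]))
      rw [obst_swap, neg_ne_zero] at hs
      exact ⟨![s, 0], fun _ => by simp, hs⟩
    have hx1 := hq.snd_ne_zero hxN
    have hy1 := hq.snd_ne_zero hyN
    have hne' : q x 1 - q y 1 ≠ 0 := sub_ne_zero.2 (hq.snd_ne hxy hxN)
    refine ⟨_, fun _ => ?_, ne_of_eq_of_ne
      (obst_update_line hxw hyw hzw (q x 1 / (q x 1 - q y 1))) ?_⟩
    · simp
      field_simp
      ring
    · have e1 : 1 - q x 1 / (q x 1 - q y 1) = -q y 1 / (q x 1 - q y 1) := by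
        field_simp
        ring
      rw [e1]
      exact neg_ne_zero.2 (mul_ne_zero (mul_ne_zero (mul_ne_zero (div_ne_zero hx1 hne')
        (div_ne_zero (neg_ne_zero.2 hy1) hne')) (hq.area_ne_of_notMem hxy hxz hyz huN)) hg)
  have hno : ¬(u = x ∨ u = y ∨ u = z) := by tauto
  by_cases hall : x ∈ N ∧ y ∈ N ∧ z ∈ N
  · obtain ⟨c, hc⟩ := exists_obst_ne_of_collinear (μ := μ) hxw hyw hzw (hq.1 x hall.1)
      (hq.1 y hall.2.1) (hq.1 z hall.2.2) (hq.fst_ne hxz) (hq.fst_ne hyz) hg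
    exact ⟨c, fun h => absurd h hno, hc⟩
  have harea : area q x y z ≠ 0 := by
    by_cases hzN : z ∈ N
    · by_cases hyN : y ∈ N
      · rw [← area_rotate]
        exact hq.area_ne_of_notMem hyz hxy.symm hxz.symm (by tauto)
      · rw [← area_rotate, ← area_rotate]
        exact hq.area_ne_of_notMem hxz.symm hyz.symm hxy hyN
    · exact hq.area_ne_of_notMem hxy hxz hyz hzN
  refine ⟨_, fun h => absurd h hno, ne_of_eq_of_ne (obst_update_line hxw hyw hzw (1 / 2)) ?_⟩
  refine neg_ne_zero.2 (mul_ne_zero (mul_ne_zero (by norm_num) harea) hg)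

lemma Ind.exists_degree_le_three {p : V → Fin 2 → ℝ} (hp : GenPos p) {B : Set (Sym2 V)}
    (hB : Ind p B) (hne : B.Nonempty) (u : V) :
    ∃ w ∈ vertexSpan B, w ≠ u ∧ (nb B w).ncard ≤ 3 := by
  classical
  have := Fintype.ofFinite V
  have hd : ∀ e ∈ B, ¬ e.IsDiag := fun e he => hB.not_isDiag he
  obtain ⟨e0, he0⟩ := hne
  have hsub := subset_pairs_vertexSpan B
  have h2 := two_le_ncard_of_mem (hd _ he0) (hsub he0)
  have h1 := hB.ncard_add_three_le hp h2 hsub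
  by_contra! hcon
  have hsum := sum_nb_ncard hd (vertexSpan B \ {u}).toFinset
  have h3 : ∀ w ∈ (vertexSpan B \ {u}).toFinset, 4 ≤ (nb B w).ncard := by
    intro w hw
    rw [Set.mem_toFinset] at hw
    exact hcon w hw.1 hw.2
  have h4 := Finset.sum_le_sum h3
  rw [hsum] at h4
  have h5 : {e ∈ B | ∃ w ∈ e, w ∈ (vertexSpan B \ {u}).toFinset}.ncard ≤ B.ncard :=
    Set.ncard_le_ncard (Set.sep_subset _ _)
  have h6 : {e ∈ B | ∀ w ∈ e, w ∈ (vertexSpan B \ {u}).toFinset}.ncard ≤ B.ncard :=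
    Set.ncard_le_ncard (Set.sep_subset _ _)
  rw [Finset.sum_const, smul_eq_mul, ← Set.ncard_eq_toFinset_card'] at h4
  have h7 : (vertexSpan B).ncard ≤ (vertexSpan B \ {u}).ncard + 1 :=
    Set.ncard_le_ncard_sdiff_add_ncard _ {u} |>.trans (by simp)
  omega

lemma nb_away {S : Set (Sym2 V)} {u w : V} (huw : w ≠ u) : nb (away S w) u = nb S u \ {w} := by
  ext v
  simp only [nb, away, Set.mem_ofPred_eq, Sym2.mem_iff, not_or, Set.mem_sdiff,
    Set.mem_singleton_iff]
  tauto

/-- A generically independent edge set remains independent when the neighbours of one vertex are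
placed on a line, generically. -/
theorem GenOn.ind_star {p0 : V → Fin 2 → ℝ} (hp0 : Generic p0) {B : Set (Sym2 V)} (hB : Ind p0 B)
    {u : V} {p : V → Fin 2 → ℝ} (hp : GenOn (nb B u) p) : Ind p B := by
  classical
  induction hn : B.ncard using Nat.strong_induction_on generalizing B p with
  | _ n ih =>
  subst hn
  rcases B.eq_empty_or_nonempty with rfl | hne
  · exact Ind.empty p
  obtain ⟨w, hwB, hwu, hdeg⟩ := hB.exists_degree_le_three hp0.genPos hne u
  have hd : ∀ e ∈ B, ¬ e.IsDiag := fun e he => hB.not_isDiag he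
  have hB0 : Ind p0 (away B w) := hB.mono (away_subset B w)
  have hwB0 := notMem_vertexSpan_away B w
  have hN0 : nb (away B w) u = nb B u \ {w} := nb_away hwu
  have huN0 : u ∉ nb (away B w) u := fun h => ne_of_mem_nb (fun e he => hd e he.1) h rfl
  have hlt : (away B w).ncard + (nb B w).ncard = B.ncard := by
    have hinj : ((fun x => s(w, x)) '' nb B w).ncard = (nb B w).ncard :=
      Set.ncard_image_of_injective _ fun a b h => Sym2.congr_right.1 h
    conv_rhs => rw [← away_union_star B w]
    rw [Set.ncard_union_eq _ (Set.toFinite _) (Set.toFinite _), hinj]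
    rw [Set.disjoint_left]
    rintro e he ⟨x, _, rfl⟩
    exact he.2 (by simp)
  have hpos : 0 < (nb B w).ncard :=
    (Set.ncard_pos (Set.toFinite _)).2 (mem_vertexSpan_iff_nb.1 hwB)
  obtain ⟨q, hq⟩ := exists_genOn (nb (away B w) u)
  have hqB0 : Ind q (away B w) := ih _ (by omega) hB0 hq rfl
  have hupd : ∀ c : Fin 2 → ℝ, Ind (Function.update q w c) (away B w) := fun c =>
    (ind_congr fun e he => (row_placement_update_of_notMem he.2 c).symm).1 hqB0
  have hfin : ∀ c : Fin 2 → ℝ, (u ∈ nb B w → c 1 = 0) → Ind (Function.update q w c) B →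
      Ind p B := by
    refine fun c hc h => hp.ind (fun v hv => ?_) h
    by_cases hvw : v = w
    · subst hvw
      rw [Function.update_self]
      exact hc (by simpa [nb, Sym2.eq_swap] using hv)
    · rw [Function.update_of_ne hvw]
      exact hq.1 v (by rw [hN0]; exact ⟨hv, hvw⟩)
  have hnew : ∀ x ∈ nb B w, x ≠ w := fun x hx => (ne_of_mem_nb hd hx).symm
  have hunion := away_union_star B w
  obtain h1 | h2 | h3 : (nb B w).ncard = 1 ∨ (nb B w).ncard = 2 ∨ (nb B w).ncard = 3 := by omega
  · obtain ⟨x, hx⟩ := Set.ncard_eq_one.1 h1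
    have hxw := hnew x (by simp [hx])
    refine hfin ![q x 0 + 1, 0] (fun _ => by simp) ?_
    rw [← hunion, hx, Set.image_singleton, Set.union_singleton]
    exact (hupd _).insert_one hwB0 ⟨0, by simp [Function.update_of_ne hxw]⟩
  · obtain ⟨x, y, hxy, hn⟩ := Set.ncard_eq_two.1 h2
    have hxw := hnew x (by simp [hn])
    have hyw := hnew y (by simp [hn])
    obtain ⟨c, hc, hne⟩ : ∃ c : Fin 2 → ℝ, (u ∈ nb B w → c 1 = 0) ∧
        area (Function.update q w c) w x y ≠ 0 := by
      by_cases hu : u ∈ nb B w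
      · have h1 : q x 1 ≠ q y 1 := by
          rw [hn] at hu
          rcases hu with rfl | rfl
          · exact hq.snd_ne hxy huN0
          · exact (hq.snd_ne hxy.symm huN0).symm
        by_contra! hcon
        have e1 := hcon ![0, 0] (by simp)
        have e2 := hcon ![1, 0] (by simp)
        rw [area_update hxw hyw] at e1 e2
        simp only [Matrix.cons_val_zero, Matrix.cons_val_one] at e1 e2
        exact h1 (by linarith)
      · refine ⟨![q x 0, q x 1 + 1], fun h => absurd h hu, ?_⟩
        rw [area_update hxw hyw]
        simpa [sub_eq_zero] using hq.fst_ne hxy.symm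
    refine hfin c hc ?_
    have := (hupd c).insert_two hwB0 hne
    rwa [← hunion, hn, Set.image_pair, Set.pair_comm, Set.union_comm, Set.insert_union,
      Set.singleton_union]
  · have key : ∀ x y z, nb B w = {x, y, z} → x ≠ y → x ≠ z → y ≠ z →
        s(x, y) ∉ Cl p0 (away B w) → Ind p B := by
      intro x y z hn hxy hxz hyz hg
      have hgB : s(x, y) ∉ away B w := fun h => hg (subset_cl _ _ h)
      have hind : Ind p0 (Insert.insert s(x, y) (away B w)) := (ind_insert hgB).2 ⟨hB0, hg⟩
      obtain ⟨r, hr⟩ := exists_genOn (nb (Insert.insert s(x, y) (away B w)) u)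
      have hrI := ih _ (by
        have := Set.ncard_insert_le s(x, y) (away B w)
        omega) hind hr rfl
      have hqI : Ind q (Insert.insert s(x, y) (away B w)) :=
        hq.ind (fun v hv => hr.1 v (Or.inr hv)) hrI
      obtain ⟨μ, hμ, hμg⟩ := hqI.exists_motion hgB
      have hxw := hnew x (by simp [hn])
      have hyw := hnew y (by simp [hn])
      have hzw := hnew z (by simp [hn])
      obtain ⟨c, hc, hne⟩ := hq.exists_obst_ne huN0 hxw hyw hzw hxy hxz hyz
        (fun v hv => hμ _ hv) hμg
      refine hfin c (fun h => hc (by rw [hn] at h; simpa using h)) ?_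
      rw [← star_eq_of_nb hn]
      refine (hupd c).insert_three hwB0 hxw hyw hzw (fun f hf => ?_) hne
      rw [row_placement_update_of_notMem hf.2]
      exact hμ f hf
    obtain ⟨x, y, z, hxy, hxz, hyz, hn⟩ := exists_triple_of_ncard_eq_three h3
    by_cases g1 : s(x, y) ∈ Cl p0 (away B w)
    · by_cases g2 : s(x, z) ∈ Cl p0 (away B w)
      · by_cases g3 : s(y, z) ∈ Cl p0 (away B w)
        · refine absurd hB ?_
          rw [← star_eq_of_nb hn]
          exact not_ind_of_triangle hp0.genPos hwB0 hxy hxz hyz (Rig.triple hp0.genPos hxy g1 g2 g3)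
        · exact key y z x (by rw [hn]; ext; simp; tauto) hyz hxy.symm hxz.symm g3
      · exact key x z y (by rw [hn]; ext; simp; tauto) hxz hxy hyz.symm g2
    · exact key x y z hn hxy hxz hyz g1

end StarOnLine

section Perturbation

open Filter Topology

lemma continuous_row_self (e : Sym2 V) : Continuous fun p : V → Fin 2 → ℝ => row p e p := by
  induction e with
  | _ a b =>
    simp only [row_mk]
    fun_prop

variable [Finite V]

lemma isOpen_ind (B : Set (Sym2 V)) : IsOpen {p : V → Fin 2 → ℝ | Ind p B} := by
  obtain ⟨P, hP⟩ := exists_polynomial_ind B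
  simp only [hP]
  refine IsOpen.preimage (t := {0}ᶜ) ?_ isOpen_compl_singleton
  simp only [MvPolynomial.aeval_def, MvPolynomial.eval₂_eq_eval_map]
  exact (MvPolynomial.continuous_eval _).comp (by fun_prop)

lemma Ind.surjective {q : V → Fin 2 → ℝ} {B : Set (Sym2 V)} (hB : Ind q B) :
    Function.Surjective fun (μ : V → Fin 2 → ℝ) (e : B) => row q e μ := by
  classical
  have := Fintype.ofFinite B
  have h : ∀ e : B, ∃ μ, (∀ f ∈ B \ {e.1}, row q f μ = 0) ∧ row q e μ ≠ 0 := fun e =>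
    Ind.exists_motion (by rwa [Set.insert_sdiff_singleton, Set.insert_eq_of_mem e.2]) (by simp)
  choose μ hμ hne using h
  intro c
  refine ⟨∑ e : B, (c e / row q e (μ e)) • μ e, funext fun f => ?_⟩
  simp only [map_sum, map_smul, smul_eq_mul]
  rw [Finset.sum_eq_single f]
  · rw [div_mul_cancel₀ _ (hne f)]
  · intro e _ hef
    rw [hμ e f ⟨f.2, fun h => hef (Subtype.ext h).symm⟩, mul_zero]
  · simp

/-- The squared lengths of an independent edge set can be prescribed locally. -/
lemma Ind.image_mem_nhds {q : V → Fin 2 → ℝ} {B : Set (Sym2 V)} (hB : Ind q B)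
    {W : Set (V → Fin 2 → ℝ)} (hW : W ∈ 𝓝 q) :
    (fun (x : V → Fin 2 → ℝ) (e : B) => row x e x) '' W ∈ 𝓝 fun e : B => row q e q := by
  have := Fintype.ofFinite V
  have := Fintype.ofFinite B
  set φ : (V → Fin 2 → ℝ) → B → ℝ := fun x e => row x e x with hφ
  have hsm : ContDiff ℝ 1 φ := by
    refine contDiff_pi.2 fun e => ?_
    obtain ⟨e, he⟩ := e
    induction e with
    | _ a b =>
      simp only [hφ, row_mk]
      fun_prop
  have hstrict := hsm.contDiffAt.hasStrictFDerivAt (x := q) one_ne_zero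
  have hval : ∀ μ, fderiv ℝ φ q μ = fun e : B => 2 * row q e μ := by
    intro μ
    have h1 : HasDerivAt (fun t : ℝ => q + t • μ) μ 0 := by
      simpa using ((hasDerivAt_id (0 : ℝ)).smul_const μ).const_add q
    have h2 : HasFDerivAt φ (fderiv ℝ φ q) (q + (0 : ℝ) • μ) := by
      simpa using hstrict.hasFDerivAt
    have h3 := h2.comp_hasDerivAt 0 h1
    have h4 : HasDerivAt (φ ∘ fun t : ℝ => q + t • μ) (fun e : B => 2 * row q e μ) 0 :=
      hasDerivAt_pi.2 fun e => hasDerivAt_row q μ e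
    exact h3.unique h4
  have hsurj : (fderiv ℝ φ q).range = ⊤ := by
    rw [LinearMap.range_eq_top]
    intro c
    obtain ⟨μ, hμ⟩ := hB.surjective (fun e => c e / 2)
    refine ⟨μ, ?_⟩
    change fderiv ℝ φ q μ = c
    rw [hval]
    funext e
    have := congrFun hμ e
    simp only at this
    rw [this]
    ring
  have := hstrict.map_nhds_eq_of_surj hsurj
  change φ '' W ∈ 𝓝 (φ q)
  rw [← this]
  exact image_mem_map hW

lemma row_eq_of_mem_cl {p0 : V → Fin 2 → ℝ} (hp0 : Generic p0) {S : Set (Sym2 V)} {e : Sym2 V}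
    (he : e ∈ Cl p0 S) {p q : V → Fin 2 → ℝ} (hS : Ind ((1 / 2 : ℝ) • (p + q)) S)
    (h : ∀ f ∈ S, row p f p = row q f q) : row p e p = row q e q := by
  by_cases heS : e ∈ S
  · exact h e heS
  have hmem : e ∈ Cl ((1 / 2 : ℝ) • (p + q)) S := by
    by_contra hcon
    exact ((ind_insert heS).1 (hp0.ind ((ind_insert heS).2 ⟨hS, hcon⟩))).2 he
  have := hmem (p - q) fun f hf => by
    rw [row_smul, LinearMap.smul_apply, row_add_sub, h f hf, sub_self, smul_zero]
  rw [row_smul, LinearMap.smul_apply, row_add_sub] at this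
  simpa [sub_eq_zero] using this

/-- Placements near `p₁` are matched, in all edge lengths, by placements near `q₀`, provided this
is so on each edge up to an explicit deformation agreeing on enough edges of an independent set. -/
theorem eventually_exists_row_eq {p0 p₁ q₀ : V → Fin 2 → ℝ} (hp0 : Generic p0)
    {B E : Set (Sym2 V)} (hB : Ind q₀ B) (hpq : ∀ f ∈ B, row p₁ f p₁ = row q₀ f q₀)
    (hE : ∀ e ∈ E, ∃ S ⊆ B, e ∈ Cl p0 S ∧ ∃ T : (V → Fin 2 → ℝ) → V → Fin 2 → ℝ,
      ContinuousAt T p₁ ∧ T p₁ = q₀ ∧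
      ∀ p, row (T p) e (T p) = row p e p ∧ ∀ f ∈ S, row (T p) f (T p) = row p f p)
    {U : Set (V → Fin 2 → ℝ)} (hU : U ∈ 𝓝 q₀) :
    ∀ᶠ p in 𝓝 p₁, ∃ q ∈ U, ∀ e ∈ E, row q e q = row p e p := by
  have hmid : ∀ᶠ xy in 𝓝 q₀ ×ˢ 𝓝 q₀, Ind ((1 / 2 : ℝ) • (xy.1 + xy.2 : V → Fin 2 → ℝ)) B := by
    rw [← nhds_prod_eq]
    have hc : Continuous fun xy : (V → Fin 2 → ℝ) × (V → Fin 2 → ℝ) =>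
        (1 / 2 : ℝ) • (xy.1 + xy.2) := by fun_prop
    refine hc.continuousAt.eventually ((isOpen_ind B).mem_nhds ?_)
    have : (1 / 2 : ℝ) • (q₀ + q₀) = q₀ := by
      rw [← two_smul ℝ q₀, smul_smul]
      norm_num
    change Ind ((1 / 2 : ℝ) • (q₀ + q₀)) B
    rwa [this]
  obtain ⟨W, hW, hWB⟩ := (Filter.eventually_prod_self_iff (r := fun x y =>
    Ind ((1 / 2 : ℝ) • (x + y)) B)).1 hmid
  have h1 : ∀ᶠ p in 𝓝 p₁, ∃ q ∈ U ∩ W, ∀ f ∈ B, row q f q = row p f p := by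
    have hc : Continuous fun (p : V → Fin 2 → ℝ) (e : B) => row p e p :=
      continuous_pi fun e => continuous_row_self e.1
    have hφ : (fun e : B => row p₁ e p₁) = fun e : B => row q₀ e q₀ :=
      funext fun e => hpq e e.2
    have := hB.image_mem_nhds (inter_mem hU hW)
    rw [← hφ] at this
    filter_upwards [hc.continuousAt.eventually this] with p hp
    obtain ⟨q, hq, hqp⟩ := hp
    exact ⟨q, hq, fun f hf => congrFun hqp ⟨f, hf⟩⟩
  have h2 : ∀ᶠ p in 𝓝 p₁, ∀ e ∈ E, ∃ S ⊆ B, e ∈ Cl p0 S ∧ ∃ x ∈ W,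
      row x e x = row p e p ∧ ∀ f ∈ S, row x f x = row p f p := by
    refine (Filter.eventually_all_finite (Set.toFinite E)).2 fun e he => ?_
    obtain ⟨S, hSB, heS, T, hT, hTp, hTr⟩ := hE e he
    rw [ContinuousAt, hTp] at hT
    filter_upwards [hT hW] with p hp
    exact ⟨S, hSB, heS, T p, hp, hTr p⟩
  filter_upwards [h1, h2] with p ⟨q, hq, hqp⟩ hp
  refine ⟨q, hq.1, fun e he => ?_⟩
  obtain ⟨S, hSB, heS, x, hx, hxe, hxS⟩ := hp e he
  rw [← hxe]
  exact row_eq_of_mem_cl hp0 heS ((hWB q hq.2 x hx).mono hSB) fun f hf => by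
    rw [hqp f (hSB hf), hxS f hf]

end Perturbation

section Reflection

/-- The reflection of the point `x` in the line through `a` and `b`. -/
def reflect (a b x : Fin 2 → ℝ) : Fin 2 → ℝ :=
  let k := ((x 0 - a 0) * (b 0 - a 0) + (x 1 - a 1) * (b 1 - a 1)) /
    ((b 0 - a 0) ^ 2 + (b 1 - a 1) ^ 2)
  fun i => a i + 2 * k * (b i - a i) - (x i - a i)

lemma reflect_left (a b : Fin 2 → ℝ) : reflect a b a = a := by
  ext i; simp [reflect]

lemma reflect_right (a b : Fin 2 → ℝ) : reflect a b b = b := by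
  ext i
  by_cases h : (b 0 - a 0) ^ 2 + (b 1 - a 1) ^ 2 = 0
  · have h0 : b 0 - a 0 = 0 := by nlinarith [sq_nonneg (b 0 - a 0), sq_nonneg (b 1 - a 1)]
    have h1 : b 1 - a 1 = 0 := by nlinarith [sq_nonneg (b 0 - a 0), sq_nonneg (b 1 - a 1)]
    fin_cases i
    · simp [reflect, h0]; linarith
    · simp [reflect, h1]; linarith
  · simp only [reflect]
    rw [← pow_two, ← pow_two, div_self h]
    ring

lemma reflect_dist (a b x y : Fin 2 → ℝ) :
    (reflect a b x 0 - reflect a b y 0) * (reflect a b x 0 - reflect a b y 0) +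
      (reflect a b x 1 - reflect a b y 1) * (reflect a b x 1 - reflect a b y 1) =
    (x 0 - y 0) * (x 0 - y 0) + (x 1 - y 1) * (x 1 - y 1) := by
  by_cases h : (b 0 - a 0) ^ 2 + (b 1 - a 1) ^ 2 = 0
  · simp only [reflect, h, div_zero]
    ring
  · simp only [reflect]
    field_simp
    ring

lemma reflect_of_axis {a b : Fin 2 → ℝ} (ha : a 1 = 0) (hb : b 1 = 0) (hab : a 0 ≠ b 0)
    (x : Fin 2 → ℝ) : reflect a b x = ![x 0, -x 1] := by
  have h : b 0 - a 0 ≠ 0 := sub_ne_zero.2 hab.symm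
  ext i
  fin_cases i
  · simp [reflect, ha, hb]
    field_simp
    ring
  · simp [reflect, ha, hb]

lemma continuousAt_reflect {X : Type*} [TopologicalSpace X] {a b x : X → Fin 2 → ℝ} {t : X}
    (ha : ContinuousAt a t) (hb : ContinuousAt b t) (hx : ContinuousAt x t)
    (hab : a t 0 ≠ b t 0) : ContinuousAt (fun s => reflect (a s) (b s) (x s)) t := by
  have h : (b t 0 - a t 0) ^ 2 + (b t 1 - a t 1) ^ 2 ≠ 0 := by
    have := sq_pos_of_ne_zero (sub_ne_zero.2 hab.symm)
    positivity
  have ha' := fun i => (continuousAt_pi.1 ha) i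
  have hb' := fun i => (continuousAt_pi.1 hb) i
  have hx' := fun i => (continuousAt_pi.1 hx) i
  refine continuousAt_pi.2 fun i => ?_
  have hi := ha' i
  have hj := hb' i
  have hk := hx' i
  have h0 := ha' 0
  have h1 := ha' 1
  have h2 := hb' 0
  have h3 := hb' 1
  have h4 := hx' 0
  have h5 := hx' 1
  simp only [reflect]
  fun_prop (disch := assumption)

/-- Reflecting the part `X` of a placement in a line preserves the lengths of the edges that leave
`X` only at points on the line. -/
lemma exists_reflection [DecidableEq V] {X : Set V} {F : Set (Sym2 V)} {u : V} (huX : u ∈ X)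
    {q₀ : V → Fin 2 → ℝ} (hX : ∀ x ∈ X, x ≠ u → q₀ x 1 = 0)
    {a b : (V → Fin 2 → ℝ) → Fin 2 → ℝ} (ha : Continuous a) (hb : Continuous b) {p₁}
    (hp₁ : p₁ = Function.update q₀ u ![q₀ u 0, -q₀ u 1])
    (ha1 : a p₁ 1 = 0) (hb1 : b p₁ 1 = 0) (hab : a p₁ 0 ≠ b p₁ 0)
    (hF : ∀ x y, s(x, y) ∈ F → x ∈ X → y ∉ X → ∀ p, p x = a p ∨ p x = b p) :
    ∃ T : (V → Fin 2 → ℝ) → V → Fin 2 → ℝ, ContinuousAt T p₁ ∧ T p₁ = q₀ ∧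
      ∀ p, ∀ f ∈ F, row (T p) f (T p) = row p f p := by
  classical
  refine ⟨fun p w => if w ∈ X then reflect (a p) (b p) (p w) else p w, ?_, ?_, ?_⟩
  · refine continuousAt_pi.2 fun w => ?_
    by_cases hw : w ∈ X
    · simp only [hw, if_true]
      exact continuousAt_reflect ha.continuousAt hb.continuousAt
        (continuous_apply w).continuousAt hab
    · simp only [hw, if_false]
      exact (continuous_apply w).continuousAt
  · funext w
    by_cases hw : w ∈ X
    · simp only [hw, if_true]
      rw [reflect_of_axis ha1 hb1 hab, hp₁]
      ext i
      by_cases hwu : w = u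
      · subst hwu
        fin_cases i <;> simp
      · rw [Function.update_of_ne hwu]
        fin_cases i <;> simp [hX w hw hwu]
    · simp only [hw, if_false]
      rw [hp₁, Function.update_of_ne (by rintro rfl; exact hw huX)]
  · intro p f hf
    have key : ∀ x y, s(x, y) ∈ F → x ∈ X → y ∉ X → reflect (a p) (b p) (p x) = p x := by
      intro x y hxy hx hy
      rcases hF x y hxy hx hy p with h | h
      · rw [h, reflect_left]
      · rw [h, reflect_right]
    induction f with
    | _ x y =>
      simp only [row_mk]
      by_cases hx : x ∈ X <;> by_cases hy : y ∈ X
      · simp only [hx, hy, if_true]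
        exact reflect_dist _ _ _ _
      · simp only [hx, hy, if_true, if_false, key x y hf hx hy]
      · simp only [hx, hy, if_true, if_false, key y x (by rwa [Sym2.eq_swap]) hy hx]
      · simp only [hx, hy, if_false]

end Reflection

section Necessity

open Filter Topology

variable [Finite V]

lemma ind_star {p : V → Fin 2 → ℝ} (hp : GenPos p) {u : V} {N : Set V} (hu : u ∉ N) :
    Ind p ((fun x => s(u, x)) '' N) := by
  induction N, Set.toFinite N using Set.Finite.induction_on with
  | empty => simpa using Ind.empty p
  | @insert x N hx _ ih =>
    rw [Set.image_insert_eq, Sym2.eq_swap]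
    have hxu : x ≠ u := by rintro rfl; simp at hu
    refine (ih (by simp at hu; tauto)).insert_one ?_ ⟨0, hp.coord_ne x u hxu 0⟩
    rintro ⟨_, ⟨y, hy, rfl⟩, hxy⟩
    rcases Sym2.mem_iff.1 hxy with rfl | rfl
    · exact hxu rfl
    · exact hx hy

/-- If three internally disjoint paths do not exist, two vertices separate. -/
lemma exists_separating_pair {H : Set (Sym2 V)} (hd : ∀ e ∈ H, ¬ e.IsDiag) {u v : V}
    (huv : u ≠ v) (hH : s(u, v) ∉ H) (h3 : 3 ≤ (nb H u).ncard)
    (hP : ¬ InternallyDisjointPaths (SimpleGraph.fromEdgeSet H) u v 3) :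
    ∃ a b, a ≠ b ∧ ∃ X ⊆ vertexSpan H, u ∈ X ∧ v ∉ X ∧ a ∈ X ∧ b ∈ X ∧ a ≠ u ∧ b ≠ u ∧
      ∀ x y, s(x, y) ∈ H → x ∈ X → y ∉ X → x = a ∨ x = b := by
  have hadj : ¬ (SimpleGraph.fromEdgeSet H).Adj u v := by
    rw [SimpleGraph.fromEdgeSet_adj]
    tauto
  obtain ⟨S, hS, huS, hvS, hcon⟩ : ∃ S : Set V, S.ncard < 3 ∧ u ∉ S ∧ v ∉ S ∧
      ¬ ConnIn (SimpleGraph.fromEdgeSet H) Sᶜ u v := by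
    by_contra! hc
    exact hP (internallyDisjointPaths_of_forall_connIn huv hadj hc)
  have hu : u ∈ vertexSpan H := mem_vertexSpan_iff_nb.2 <|
    (Set.ncard_pos (Set.toFinite _)).1 (by omega)
  have hnb : nb H u ⊆ vertexSpan H \ {u, v} := by
    intro x hx
    refine ⟨⟨_, hx, by simp⟩, ?_⟩
    rintro (rfl | rfl)
    · exact ne_of_mem_nb hd hx rfl
    · exact hH hx
  obtain ⟨A, hSA, hA, hA2⟩ := Set.exists_subsuperset_card_eq
    (s := S ∩ vertexSpan H) (t := vertexSpan H \ {u, v}) (n := 2)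
    (fun x hx => ⟨hx.2, by
      rintro (rfl | rfl)
      · exact huS hx.1
      · exact hvS hx.1⟩)
    ((Set.ncard_le_ncard Set.inter_subset_left).trans (by omega))
    ((show 2 ≤ 3 by norm_num).trans (h3.trans (Set.ncard_le_ncard hnb)))
  obtain ⟨a, b, hab, rfl⟩ := Set.ncard_eq_two.1 hA2
  have ha := hA (show a ∈ {a, b} by simp)
  have hb := hA (show b ∈ {a, b} by simp)
  simp only [Set.mem_sdiff, Set.mem_insert_iff, Set.mem_singleton_iff, not_or] at ha hb
  have huab : u ∈ ({a, b} : Set V)ᶜ := by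
    simp [Ne.symm ha.2.1, Ne.symm hb.2.1]
  refine ⟨a, b, hab, {a, b} ∪ {x | ConnIn (SimpleGraph.fromEdgeSet H) {a, b}ᶜ u x}, ?_,
    Or.inr (ConnIn.refl huab), ?_, by simp, by simp, ha.2.1, hb.2.1, ?_⟩
  · rintro x ((rfl | rfl) | hx)
    · exact ha.1
    · exact hb.1
    · refine hx.induction hu fun c d _ hcd _ => ?_
      exact ⟨_, ((SimpleGraph.fromEdgeSet_adj H).1 hcd).1, by simp⟩
  · rintro ((rfl | rfl) | hv)
    · exact ha.2.2 rfl
    · exact hb.2.2 rfl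
    · refine hcon (hv.induction (P := fun c => ConnIn (SimpleGraph.fromEdgeSet H) Sᶜ u c)
        (ConnIn.refl huS) fun c d hc hcd hd => hc.tail hcd fun hdS => hd (hSA ⟨hdS, ?_⟩))
      exact ⟨_, ((SimpleGraph.fromEdgeSet_adj H).1 hcd).1, by simp⟩
  · rintro x y hxy (hx | hx) hy
    · exact hx
    · refine absurd (Or.inr (ConnIn.tail hx ?_ fun hyab => hy (Or.inl hyab))) hy
      rw [SimpleGraph.fromEdgeSet_adj]
      exact ⟨hxy, fun h => hd _ hxy (by simpa using h)⟩

variable [DecidableEq V]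

lemma rig_of_rdConnectedSet {p : V → Fin 2 → ℝ} (hp : Generic p) {H : Set (Sym2 V)}
    (hd : ∀ e ∈ H, ¬ e.IsDiag) (hH : RdConnectedSet 2 H) : Rig p H (vertexSpan H) := by
  rw [rig_iff]
  rintro a ⟨e, he, hae⟩ b ⟨f, hf, hbf⟩
  by_cases hab : a = b
  · exact diag_mem_cl p H (by simpa using hab)
  rcases hH.2 e he f hf with rfl | ⟨C, hCH, hC, heC, hfC⟩
  · rw [← (Sym2.mem_and_mem_iff hab).1 ⟨hae, hbf⟩]
    exact subset_cl p H he
  · rw [hp.rdCircuit_iff] at hC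
    exact cl_mono p hCH ((hC.rig hp fun e he => hd e (hCH he)).mem ⟨e, heC, hae⟩ ⟨f, hfC, hbf⟩)

lemma three_le_nb_of_rdConnectedSet {p : V → Fin 2 → ℝ} (hp : Generic p) {H : Set (Sym2 V)}
    (hd : ∀ e ∈ H, ¬ e.IsDiag) (hH : RdConnectedSet 2 H) {u v : V} (huv : u ≠ v)
    (hu : u ∈ vertexSpan H) (hv : v ∈ vertexSpan H) (huvH : s(u, v) ∉ H) :
    3 ≤ (nb H u).ncard := by
  obtain ⟨e, he, hue⟩ := hu
  obtain ⟨f, hf, hvf⟩ := hv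
  rcases hH.2 e he f hf with rfl | ⟨C, hCH, hC, heC, hfC⟩
  · rw [(Sym2.mem_and_mem_iff huv).1 ⟨hue, hvf⟩] at he
    exact absurd he huvH
  · rw [hp.rdCircuit_iff] at hC
    exact (hC.three_le_nb hp.genPos (fun e he => hd e (hCH he)) ⟨e, heC, hue⟩).trans
      (Set.ncard_le_ncard fun x hx => hCH hx)

/-- The part of an `ℛ₂`-connected set that is to be reflected, with `u` in it but not `v`. -/
lemma exists_reflectable {p : V → Fin 2 → ℝ} (hp : Generic p) {H : Set (Sym2 V)}
    (hd : ∀ e ∈ H, ¬ e.IsDiag) (hH : RdConnectedSet 2 H) {u v : V} (huv : u ≠ v)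
    (huvH : s(u, v) ∉ H) (hP : u ∈ vertexSpan H → v ∈ vertexSpan H →
      ¬ InternallyDisjointPaths (SimpleGraph.fromEdgeSet H) u v 3) :
    ∃ X : Set V, u ∈ X ∧ v ∉ X ∧ (∀ x ∈ X, s(u, x) ∈ Cl p H) ∧
      ((∀ x y, s(x, y) ∈ H → x ∈ X → y ∈ X) ∨
        ∃ a b, a ∈ X ∧ b ∈ X ∧ a ≠ u ∧ b ≠ u ∧ a ≠ b ∧
          ∀ x y, s(x, y) ∈ H → x ∈ X → y ∉ X → x = a ∨ x = b) := by
  have hrig := rig_of_rdConnectedSet hp hd hH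
  by_cases hu : u ∈ vertexSpan H
  · by_cases hv : v ∈ vertexSpan H
    · obtain ⟨a, b, hab, X, hXH, huX, hvX, ha, hb, hau, hbu, hX⟩ := exists_separating_pair hd huv
        huvH (three_le_nb_of_rdConnectedSet hp hd hH huv hu hv huvH) (hP hu hv)
      exact ⟨X, huX, hvX, fun x hx => hrig.mem hu (hXH hx), Or.inr ⟨a, b, ha, hb, hau, hbu, hab, hX⟩⟩
    · exact ⟨vertexSpan H, hu, hv, fun x hx => hrig.mem hu hx,
        Or.inl fun x y hxy _ => ⟨_, hxy, by simp⟩⟩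
  · refine ⟨{u}, rfl, by simpa using huv.symm, ?_, Or.inl ?_⟩
    · rintro x rfl
      exact diag_mem_cl p H (by simp)
    · rintro x y hxy rfl
      exact absurd ⟨_, hxy, by simp⟩ hu

lemma circClass_eq {p : V → Fin 2 → ℝ} {E : Set (Sym2 V)} {e f : Sym2 V}
    (hf : f ∈ circClass p E e) : circClass p E f = circClass p E e := by
  have key : ∀ e f, f ∈ circClass p E e → circClass p E f ⊆ circClass p E e := by
    rintro e f hf g ⟨hg, rfl | ⟨C, hCE, hC, hfC, hgC⟩⟩
    · exact hf
    · exact hC.subset_circClass hCE hfC hf hgC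
  refine (key e f hf).antisymm (key f e ?_)
  obtain ⟨hfE, rfl | ⟨C, hCE, hC, heC, hfC⟩⟩ := hf
  · exact mem_circClass hfE
  · exact ⟨hCE heC, Or.inr ⟨C, hCE, hC, hfC, heC⟩⟩

/-- If no `ℛ₂`-connected subgraph links `u` to `v` by three paths, then some generic framework has
an equivalent one with a different distance between `u` and `v`. -/
theorem not_globallyLinked {G : SimpleGraph V} {u v : V} (huv : u ≠ v) (hadj : ¬ G.Adj u v)
    (h : ∀ F ⊆ G.edgeSet, RdConnectedSet 2 F → u ∈ vertexSpan F → v ∈ vertexSpan F →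
      ¬ InternallyDisjointPaths (SimpleGraph.fromEdgeSet F) u v 3) : ¬ GloballyLinked 2 G u v := by
  have := Fintype.ofFinite V
  obtain ⟨p0, hp0, -⟩ := exists_generic_dist_lt (0 : V → Fin 2 → ℝ) one_pos
  set E := G.edgeSet with hE
  have hd : ∀ e ∈ E, ¬ e.IsDiag := fun e he => G.not_isDiag_of_mem_edgeSet he
  have hclass : ∀ H, (∃ e ∈ E, circClass p0 E e = H) → ∃ X : Set V, u ∈ X ∧ v ∉ X ∧
      (∀ x ∈ X, s(u, x) ∈ Cl p0 H) ∧ ((∀ x y, s(x, y) ∈ H → x ∈ X → y ∈ X) ∨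
        ∃ a b, a ∈ X ∧ b ∈ X ∧ a ≠ u ∧ b ≠ u ∧ a ≠ b ∧
          ∀ x y, s(x, y) ∈ H → x ∈ X → y ∉ X → x = a ∨ x = b) := by
    rintro H ⟨e, he, rfl⟩
    have hsub := circClass_subset p0 E e
    have hconn := rdConnectedSet_circClass hp0 he
    exact exists_reflectable hp0 (fun f hf => hd f (hsub hf)) hconn huv
      (fun huvH => hadj (hsub huvH)) (h _ hsub hconn)
  choose! X huX hvX hXcl hXH using hclass
  set N : Set V := {x | x ≠ u ∧ ∃ e ∈ E, x ∈ X (circClass p0 E e)} with hN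
  have huN : u ∉ N := fun hu => hu.1 rfl
  have hvN : v ∉ N := fun ⟨_, e, he, hv⟩ => hvX _ ⟨e, he, rfl⟩ hv
  have hnbE : nb E u ⊆ N := by
    intro x hx
    refine ⟨(ne_of_mem_nb hd hx).symm, s(u, x), hx, ?_⟩
    have hmem := mem_circClass (p := p0) (e := s(u, x)) hx
    have hc : ∃ e ∈ E, circClass p0 E e = circClass p0 E s(u, x) := ⟨_, hx, rfl⟩
    rcases hXH _ hc with hX | ⟨a, b, -, -, hau, hbu, -, hX⟩
    · exact hX u x hmem (huX _ hc)
    · by_contra hxX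
      rcases hX u x hmem (huX _ hc) hxX with h | h
      · exact hau h.symm
      · exact hbu h.symm
  obtain ⟨B, hNB, hBE, hB, hEB⟩ := exists_basis p0 (ind_star hp0.genPos huN)
    (Set.subset_union_right (s := E))
  have hnbB : nb B u = N := by
    refine Set.Subset.antisymm (fun x hx => ?_) fun x hx => hNB ⟨x, hx, rfl⟩
    rcases hBE hx with hx | ⟨y, hy, hxy⟩
    · exact hnbE hx
    · rwa [← Sym2.congr_right.1 hxy]
  obtain ⟨q₀, hq₀⟩ := exists_genOn N
  have hBq : Ind q₀ B := GenOn.ind_star hp0 hB (u := u) (by rwa [hnbB])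
  set p₁ := Function.update q₀ u ![q₀ u 0, -q₀ u 1] with hp₁
  have hp₁N : ∀ x, x ≠ u → p₁ x = q₀ x := fun x hx => Function.update_of_ne hx _ _
  have hlen : ∀ f ∈ B, row p₁ f p₁ = row q₀ f q₀ := by
    have key : ∀ x, s(u, x) ∈ B → row p₁ s(u, x) p₁ = row q₀ s(u, x) q₀ := by
      intro x hx
      have hxN : x ∈ N := hnbB ▸ hx
      rw [row_mk, row_mk, hp₁N x hxN.1, hq₀.1 x hxN]
      simp only [hp₁, Function.update_self, Matrix.cons_val_zero, Matrix.cons_val_one]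
      ring
    intro f hf
    by_cases huf : u ∈ f
    · obtain ⟨x, rfl⟩ := Sym2.mem_iff_exists.1 huf
      exact key x hf
    · have hc : ∀ w ∈ f, p₁ w = q₀ w := fun w hw => hp₁N w (by rintro rfl; exact huf hw)
      exact row_congr hc hc
  have hmain : ∀ e ∈ E, ∃ S ⊆ B, e ∈ Cl p0 S ∧ ∃ T : (V → Fin 2 → ℝ) → V → Fin 2 → ℝ,
      ContinuousAt T p₁ ∧ T p₁ = q₀ ∧
      ∀ p, row (T p) e (T p) = row p e p ∧ ∀ f ∈ S, row (T p) f (T p) = row p f p := by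
    intro e he
    set H := circClass p0 E e with hH
    have hHE : H ⊆ E := circClass_subset p0 E e
    have heH : e ∈ H := mem_circClass he
    have hc : ∃ e ∈ E, circClass p0 E e = H := ⟨e, he, rfl⟩
    set H' := H ∪ (fun x => s(u, x)) '' (X H \ {u}) with hH'
    have hsub : H ⊆ Cl p0 (B ∩ H') := by
      refine subset_cl_inter_of_separated hHE (fun C hCE hC hne => ?_) hB
        (Set.subset_union_left.trans hEB) ?_ ?_
      · obtain ⟨f, hfC, hfH⟩ := hne
        exact hC.subset_circClass hCE hfC hfH
      · rintro f ⟨-, hf | ⟨x, hx, rfl⟩⟩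
        · exact subset_cl p0 H hf
        · exact hXcl H hc x hx.1
      · rintro f ⟨hfB, hfH'⟩
        rcases hBE hfB with hfE | ⟨x, ⟨hxu, e', he', hx⟩, rfl⟩
        · exact subset_cl _ _ ⟨hfE, fun hfH => hfH' (Or.inl hfH)⟩
        · have hEH : circClass p0 E e' ⊆ E \ H := by
            refine fun g hg => ⟨circClass_subset p0 E e' hg, fun hgH => ?_⟩
            have heq : circClass p0 E e' = H := (circClass_eq hg).symm.trans (circClass_eq hgH)
            exact hfH' (Or.inr ⟨x, ⟨heq ▸ hx, hxu⟩, rfl⟩)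
          exact cl_mono p0 hEH (hXcl _ ⟨e', he', rfl⟩ x hx)
    have hXN : ∀ x ∈ X H, x ≠ u → q₀ x 1 = 0 := fun x hx hxu => hq₀.1 x ⟨hxu, e, he, hx⟩
    have hT : ∃ T : (V → Fin 2 → ℝ) → V → Fin 2 → ℝ, ContinuousAt T p₁ ∧ T p₁ = q₀ ∧
        ∀ p, ∀ f ∈ H', row (T p) f (T p) = row p f p := by
      rcases hXH H hc with hX | ⟨a, b, haX, hbX, hau, hbu, hab, hX⟩
      · refine exists_reflection (huX H hc) hXN (a := fun _ => ![0, 0]) (b := fun _ => ![1, 0])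
          continuous_const continuous_const hp₁ (by simp) (by simp) (by simp) ?_
        rintro x y (hxy | ⟨z, hz, hzxy⟩) hx hy
        · exact absurd (hX x y hxy hx) hy
        · rcases Sym2.eq_iff.1 hzxy with ⟨rfl, rfl⟩ | ⟨rfl, rfl⟩
          · exact absurd hz.1 hy
          · exact absurd (huX H hc) hy
      · refine exists_reflection (huX H hc) hXN (a := fun p => p a) (b := fun p => p b)
          (continuous_apply a) (continuous_apply b) hp₁ ?_ ?_ ?_ ?_
        · rw [hp₁N a hau]; exact hXN a haX hau
        · rw [hp₁N b hbu]; exact hXN b hbX hbu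
        · rw [hp₁N a hau, hp₁N b hbu]; exact hq₀.fst_ne hab
        rintro x y (hxy | ⟨z, hz, hzxy⟩) hx hy
        · rcases hX x y hxy hx hy with rfl | rfl <;> simp
        · rcases Sym2.eq_iff.1 hzxy with ⟨rfl, rfl⟩ | ⟨rfl, rfl⟩
          · exact absurd hz.1 hy
          · exact absurd (huX H hc) hy
    obtain ⟨T, hTc, hTp, hTr⟩ := hT
    exact ⟨B ∩ H', Set.inter_subset_left, hsub heH, T, hTc, hTp,
      fun p => ⟨hTr p e (Or.inl heH), fun f hf => hTr p f hf.2⟩⟩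
  have hne : row p₁ s(u, v) p₁ ≠ row q₀ s(u, v) q₀ := by
    have hu1 := hq₀.snd_ne_zero huN
    have hv1 := hq₀.snd_ne_zero hvN
    rw [row_mk, row_mk, hp₁N v huv.symm]
    simp only [hp₁, Function.update_self, Matrix.cons_val_zero, Matrix.cons_val_one]
    intro h0
    exact mul_ne_zero hu1 hv1 (by linarith)
  obtain ⟨U₁, U₂, hU₁, hU₂, hm₁, hm₂, hdisj⟩ := t2_separation hne
  have hev := eventually_exists_row_eq hp0 hBq hlen hmain
    ((continuous_row_self s(u, v)).continuousAt.preimage_mem_nhds (hU₂.mem_nhds hm₂))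
  obtain ⟨ε, hε, hball⟩ := Metric.eventually_nhds_iff.1 (hev.and
    ((continuous_row_self s(u, v)).continuousAt.eventually (hU₁.mem_nhds hm₁)))
  obtain ⟨p, hp, hpp⟩ := exists_generic_dist_lt p₁ hε
  obtain ⟨⟨q, hqU, hqp⟩, hpU⟩ := hball (y := p) (by
    refine (dist_pi_lt_iff hε).2 fun w => (dist_pi_lt_iff hε).2 fun i => ?_
    rw [Real.dist_eq]
    exact hpp w i)
  intro hglob
  have := hglob p hp q fun a b hab => (eDist_eq_iff p q a b a b).2 (hqp s(a, b) hab).symm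
  rw [eDist_eq_iff] at this
  exact Set.disjoint_left.1 hdisj hpU (this ▸ hqU)

end Necessity

/-- Main theorem (a) ↔ (d): `{u,v}` is globally linked in `G` in `ℝ²` iff `uv ∈ E`
or there is an `ℛ₂`-connected subgraph `H` of `G` containing `u,v` with
`κ_H(u,v) ≥ 3`. -/
theorem globally_linked_iff_component {V : Type*} [Fintype V] [DecidableEq V]
    (G : SimpleGraph V) (u v : V) (huv : u ≠ v) :
    GloballyLinked 2 G u v ↔
      (G.Adj u v ∨ ∃ F : Set (Sym2 V), F ⊆ G.edgeSet ∧ RdConnectedSet 2 F ∧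
        u ∈ vertexSpan F ∧ v ∈ vertexSpan F ∧
        InternallyDisjointPaths (SimpleGraph.fromEdgeSet F) u v 3) := by
  have := Finite.of_fintype V
  constructor
  · intro h
    by_contra! hcon
    obtain ⟨hadj, hF⟩ := hcon
    exact not_globallyLinked huv hadj (fun F hFG hFc hu hv => hF F hFG hFc hu hv) h
  · rintro (hadj | ⟨F, hFG, hF, hu, hv, hP⟩)
    · intro p _ q hq
      exact (hq u v hadj).symm
    · exact globallyLinked_of_connected hFG hF hu hv hP

end Rigidity
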